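/- (Philipp's law of the iterated logarithm for discrepancies; Erdős–Gál conjecture) Let (n_k)_{k ≥ 1} be a sequence of positive integers satisfying the Hadamard gap condition n_{k+1}/n_k ≥ q for all k ≥ 1, for some q > 1. Then there exists a constant C_q depending only on q such that for Lebesgue-almost every x ∈ [0,1], 1/(4√2) ≤ limsup_{N → ∞} N · D_N^*(⟨n_1 x⟩, …, ⟨n_N x⟩) / √(2 N log log N) ≤ C_q. -/

import Mathlib

open MeasureTheory Filter Real

/-- The star-discrepancy of the points `x 1, …, x N` in the unit interval:
`D_N^* = sup_{0 ≤ a ≤ 1} | (1/N) ∑_{k=1}^N 1_{[0,a)}(x_k) - a |`. -/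
noncomputable def starDiscrepancy (N : ℕ) (x : ℕ → ℝ) : ℝ :=
  ⨆ a : Set.Icc (0 : ℝ) 1,
    |(∑ k ∈ Finset.Icc 1 N,
        (Set.Ico (0 : ℝ) (a : ℝ)).indicator (fun _ => (1 : ℝ)) (x k)) / N - (a : ℝ)|

/-- The `m`-th cosine `x ↦ cos (2π m x)`. -/
noncomputable def cosFn (m : ℕ) (x : ℝ) : ℝ := Real.cos (2 * π * m * x)

/-- Cosine polynomials with frequencies in `[a, b]`. -/
noncomputable def cosSpan (a b : ℕ) : Submodule ℝ (ℝ → ℝ) :=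
  Submodule.span ℝ (cosFn '' Set.Icc a b)

lemma cosFn_mem {a b m : ℕ} (ha : a ≤ m) (hb : m ≤ b) : cosFn m ∈ cosSpan a b :=
  Submodule.subset_span ⟨m, ⟨ha, hb⟩, rfl⟩

lemma cosSpan_mono {a a' b b' : ℕ} (ha : a' ≤ a) (hb : b ≤ b') : cosSpan a b ≤ cosSpan a' b' :=
  Submodule.span_mono (Set.image_mono (Set.Icc_subset_Icc ha hb))

lemma cosFn_zero : cosFn 0 = 1 := by
  funext x; simp [cosFn]

lemma one_mem_cosSpan (b : ℕ) : (1 : ℝ → ℝ) ∈ cosSpan 0 b := by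
  rw [← cosFn_zero]; exact cosFn_mem le_rfl (Nat.zero_le _)

lemma const_mem_cosSpan (c : ℝ) (b : ℕ) : (fun _ => c : ℝ → ℝ) ∈ cosSpan 0 b := by
  have := (cosSpan 0 b).smul_mem c (one_mem_cosSpan b)
  convert this using 1
  funext x; simp

lemma cosFn_continuous (m : ℕ) : Continuous (cosFn m) := by
  unfold cosFn; fun_prop

lemma continuous_of_mem_cosSpan {a b : ℕ} {f : ℝ → ℝ} (hf : f ∈ cosSpan a b) : Continuous f := by
  refine Submodule.span_induction (p := fun f _ => Continuous f) ?_ ?_ ?_ ?_ hf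
  · rintro _ ⟨m, -, rfl⟩; exact cosFn_continuous m
  · exact continuous_zero
  · intro f g _ _ hf hg; exact hf.add hg
  · intro c f _ hf; exact hf.const_smul c

lemma cosFn_mul_cosFn {k l : ℕ} (h : l ≤ k) :
    cosFn k * cosFn l = (1 / 2 : ℝ) • cosFn (k - l) + (1 / 2 : ℝ) • cosFn (k + l) := by
  funext x
  simp only [Pi.mul_apply, Pi.add_apply, Pi.smul_apply, smul_eq_mul, cosFn]
  rw [Nat.cast_sub h, Nat.cast_add]
  have e1 : 2 * π * ((k : ℝ) - l) * x = 2 * π * k * x - 2 * π * l * x := by ring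
  have e2 : 2 * π * ((k : ℝ) + l) * x = 2 * π * k * x + 2 * π * l * x := by ring
  rw [e1, e2, Real.cos_sub, Real.cos_add]; ring

lemma mul_mem_cosSpan {b c : ℕ} {f g : ℝ → ℝ} (hf : f ∈ cosSpan 0 b) (hg : g ∈ cosSpan 0 c) :
    f * g ∈ cosSpan 0 (b + c) := by
  have key : ∀ k l : ℕ, l ≤ k → k + l ≤ b + c → cosFn k * cosFn l ∈ cosSpan 0 (b + c) := by
    intro k l hkl hbc
    rw [cosFn_mul_cosFn hkl]
    exact add_mem (Submodule.smul_mem _ _ (cosFn_mem (Nat.zero_le _) (by omega)))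
      (Submodule.smul_mem _ _ (cosFn_mem (Nat.zero_le _) (by omega)))
  refine Submodule.span_induction (p := fun f _ => f * g ∈ cosSpan 0 (b + c)) ?_ ?_ ?_ ?_ hf
  · rintro _ ⟨k, hk, rfl⟩
    refine Submodule.span_induction (p := fun g _ => cosFn k * g ∈ cosSpan 0 (b + c))
      ?_ ?_ ?_ ?_ hg
    · rintro _ ⟨l, hl, rfl⟩
      simp only [Set.mem_Icc] at hk hl
      rcases le_total l k with h | h
      · exact key k l h (by omega)
      · rw [mul_comm]; exact key l k h (by omega)
    · simp
    · intro u v _ _ hu hv; rw [mul_add]; exact add_mem hu hv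
    · intro r u _ hu; rw [mul_smul_comm]; exact Submodule.smul_mem _ _ hu
  · simp
  · intro u v _ _ hu hv; rw [add_mul]; exact add_mem hu hv
  · intro r u _ hu; rw [smul_mul_assoc]; exact Submodule.smul_mem _ _ hu

lemma integral_cosFn {m : ℕ} (hm : 0 < m) : ∫ x in (0 : ℝ)..1, cosFn m x = 0 := by
  unfold cosFn
  have h : (2 * π * m : ℝ) ≠ 0 := by positivity
  rw [intervalIntegral.integral_comp_mul_left (fun y => Real.cos y) h, integral_cos]
  have : Real.sin (2 * π * m) = 0 := by
    rw [show 2 * π * (m : ℝ) = (2 * m : ℕ) * π by push_cast; ring]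
    exact Real.sin_nat_mul_pi _
  simp [this]

lemma integral_eq_zero_of_mem_cosSpan {a b : ℕ} {f : ℝ → ℝ} (ha : 0 < a) (hf : f ∈ cosSpan a b) :
    ∫ x in (0 : ℝ)..1, f x = 0 := by
  refine (Submodule.span_induction
    (p := fun f _ => Continuous f ∧ ∫ x in (0 : ℝ)..1, f x = 0) ?_ ?_ ?_ ?_ hf).2
  · rintro _ ⟨m, hm, rfl⟩
    exact ⟨cosFn_continuous m, integral_cosFn (lt_of_lt_of_le ha hm.1)⟩
  · exact ⟨continuous_zero, by simp⟩
  · rintro u v _ _ ⟨hu, hu'⟩ ⟨hv, hv'⟩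
    refine ⟨hu.add hv, ?_⟩
    simp only [Pi.add_apply]
    rw [intervalIntegral.integral_add (hu.intervalIntegrable _ _) (hv.intervalIntegrable _ _),
      hu', hv', add_zero]
  · rintro c u _ ⟨hu, hu'⟩
    refine ⟨hu.const_smul c, ?_⟩
    simp [hu']

lemma mul_mem_cosSpan_of_lt {b a c : ℕ} {f g : ℝ → ℝ} (hba : b < a) (hf : f ∈ cosSpan 0 b)
    (hg : g ∈ cosSpan a c) : f * g ∈ cosSpan 1 (b + c) := by
  refine Submodule.span_induction (p := fun f _ => f * g ∈ cosSpan 1 (b + c)) ?_ ?_ ?_ ?_ hf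
  · rintro _ ⟨k, hk, rfl⟩
    refine Submodule.span_induction (p := fun g _ => cosFn k * g ∈ cosSpan 1 (b + c))
      ?_ ?_ ?_ ?_ hg
    · rintro _ ⟨l, hl, rfl⟩
      simp only [Set.mem_Icc] at hk hl
      rw [mul_comm, cosFn_mul_cosFn (by omega)]
      exact add_mem (Submodule.smul_mem _ _ (cosFn_mem (by omega) (by omega)))
        (Submodule.smul_mem _ _ (cosFn_mem (by omega) (by omega)))
    · simp
    · intro u v _ _ hu hv; rw [mul_add]; exact add_mem hu hv
    · intro r u _ hu; rw [mul_smul_comm]; exact Submodule.smul_mem _ _ hu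
  · simp
  · intro u v _ _ hu hv; rw [add_mul]; exact add_mem hu hv
  · intro r u _ hu; rw [smul_mul_assoc]; exact Submodule.smul_mem _ _ hu

/-- Cosine polynomials living on well separated frequency ranges behave under integration
like independent random variables. -/
lemma integral_prod_of_separated (b : ℕ → ℕ) (F : ℕ → ℝ → ℝ) (c : ℕ → ℝ)
    (hF : ∀ j, (fun x => F j x - c j) ∈ cosSpan (1 + ∑ i ∈ Finset.range j, b i) (b j)) (M : ℕ) :
    ((∏ j ∈ Finset.range M, F j) ∈ cosSpan 0 (∑ i ∈ Finset.range M, b i)) ∧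
    ∫ x in (0 : ℝ)..1, ∏ j ∈ Finset.range M, F j x = ∏ j ∈ Finset.range M, c j := by
  induction M with
  | zero => simpa using one_mem_cosSpan 0
  | succ M ih =>
    obtain ⟨h1, h2⟩ := ih
    have hd : F M = (fun x => F M x - c M) + (fun _ => c M) := by funext x; simp
    have hFM : F M ∈ cosSpan 0 (b M) := by
      rw [hd]
      exact add_mem (cosSpan_mono (Nat.zero_le _) le_rfl (hF M)) (const_mem_cosSpan _ _)
    refine ⟨?_, ?_⟩
    · rw [Finset.prod_range_succ, Finset.sum_range_succ]
      exact mul_mem_cosSpan h1 hFM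
    · have hz := mul_mem_cosSpan_of_lt (by omega) h1 (hF M)
      have h0 := integral_eq_zero_of_mem_cosSpan one_pos hz
      have hc := continuous_of_mem_cosSpan hz
      have hc1 := continuous_of_mem_cosSpan h1
      have hI : IntervalIntegrable (fun x => (∏ j ∈ Finset.range M, F j) x * c M) volume 0 1 :=
        (hc1.mul continuous_const).intervalIntegrable _ _
      have : ∀ x, ∏ j ∈ Finset.range (M + 1), F j x
          = ((∏ j ∈ Finset.range M, F j) * (fun x => F M x - c M)) x
            + (∏ j ∈ Finset.range M, F j) x * c M := by
        intro x
        simp only [Finset.prod_range_succ, Pi.mul_apply, Finset.prod_apply]; ring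
      simp_rw [this]
      rw [intervalIntegral.integral_add (hc.intervalIntegrable _ _)
        hI, h0, zero_add,
        intervalIntegral.integral_mul_const, Finset.prod_range_succ, ← h2]
      simp only [Finset.prod_apply]

/-- `ν` is a sequence of positive integers with Hadamard gaps `q`. -/
def IsLacunary (q : ℝ) (ν : ℕ → ℕ) : Prop :=
  (∀ k, 0 < ν k) ∧ ∀ k, q * ν k ≤ ν (k + 1)

lemma IsLacunary.shift {q : ℝ} {ν : ℕ → ℕ} (h : IsLacunary q ν) (s : ℕ) :
    IsLacunary q (fun k => ν (k + s)) :=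
  ⟨fun k => h.1 _, fun k => by
    have := h.2 (k + s)
    rwa [show k + s + 1 = k + 1 + s by ring] at this⟩

lemma IsLacunary.pow_mul_le {q : ℝ} {ν : ℕ → ℕ} (hq : 1 < q) (h : IsLacunary q ν) (k d : ℕ) :
    q ^ d * ν k ≤ ν (k + d) := by
  induction d with
  | zero => simp
  | succ d ih =>
    calc q ^ (d + 1) * ν k = q * (q ^ d * ν k) := by ring
      _ ≤ q * ν (k + d) := by gcongr
      _ ≤ ν (k + d + 1) := h.2 _

lemma IsLacunary.strictMono {q : ℝ} {ν : ℕ → ℕ} (hq : 1 < q) (h : IsLacunary q ν) :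
    StrictMono ν := by
  refine strictMono_nat_of_lt_succ fun k => ?_
  have h1 : (0 : ℝ) < ν k := by exact_mod_cast h.1 k
  have := h.2 k
  have : (ν k : ℝ) < ν (k + 1) := by nlinarith
  exact_mod_cast this

/-- The block sum over the indices `j P ≤ k < j P + B`. -/
noncomputable def blockSum (ν : ℕ → ℕ) (P B : ℕ) (c : ℕ → ℝ) (j : ℕ) (x : ℝ) : ℝ :=
  ∑ k ∈ Finset.Ico (j * P) (j * P + B), c k * cosFn (ν k) x

/-- The gap length `g` suffices to separate blocks of a lacunary sequence with ratio `q`. -/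
def GapCond (q : ℝ) (g : ℕ) : Prop := 2 * q < q ^ g * (q - 1) ^ 2 ∧ 2 * q < q ^ g * (q - 1)

lemma exists_gapCond {q : ℝ} (hq : 1 < q) : ∃ g : ℕ, 0 < g ∧ GapCond q g := by
  have hq1 : 0 < q - 1 := by linarith
  have hlim := tendsto_pow_atTop_atTop_of_one_lt hq
  have h1 := (hlim.atTop_mul_const (pow_pos hq1 2)).eventually_gt_atTop (2 * q)
  have h2 := (hlim.atTop_mul_const hq1).eventually_gt_atTop (2 * q)
  obtain ⟨g, hg⟩ := (h1.and (h2.and (eventually_gt_atTop 0))).exists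
  exact ⟨g, hg.2.2, hg.1, hg.2.1⟩

lemma IsLacunary.sum_block_le {q : ℝ} {ν : ℕ → ℕ} (hq : 1 < q) (h : IsLacunary q ν) {P : ℕ}
    (hP : 0 < P) (B j : ℕ) :
    ∑ i ∈ Finset.range (j + 1), (ν (i * P + B) : ℝ) ≤ ν (j * P + B) * (q / (q - 1)) := by
  have hq1 : 0 < q - 1 := by linarith
  induction j with
  | zero =>
    have : (1 : ℝ) ≤ q / (q - 1) := by rw [le_div_iff₀ hq1]; linarith
    simpa using le_mul_of_one_le_right (Nat.cast_nonneg (ν B)) this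
  | succ j ih =>
    rw [Finset.sum_range_succ]
    have h1 : q * ν (j * P + B) ≤ ν ((j + 1) * P + B) := by
      refine (h.2 _).trans ?_
      exact_mod_cast (h.strictMono hq).monotone (by nlinarith)
    have e : (ν ((j + 1) * P + B) : ℝ) * (q / (q - 1))
        = ν ((j + 1) * P + B) * (1 / (q - 1)) + ν ((j + 1) * P + B) := by
      field_simp; ring
    rw [e]
    have : (ν (j * P + B) : ℝ) * (q / (q - 1)) ≤ ν ((j + 1) * P + B) * (1 / (q - 1)) := by
      rw [mul_div_assoc', mul_one_div]
      gcongr; linarith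
    linarith

lemma IsLacunary.block_sep {q : ℝ} {ν : ℕ → ℕ} (hq : 1 < q) (h : IsLacunary q ν) {g : ℕ}
    (hg : 0 < g) (hgap : GapCond q g) (B j : ℕ) :
    (∑ i ∈ Finset.range j, 2 * ν (i * (B + g) + B) < ν (j * (B + g))) ∧
    ∀ k l, j * (B + g) ≤ l → l < k →
      ∑ i ∈ Finset.range j, 2 * ν (i * (B + g) + B) < ν k - ν l := by
  have hq1 : 0 < q - 1 := by linarith
  have hmono := h.strictMono hq
  have diff : ∀ k l, j * (B + g) ≤ l → l < k → (ν (j * (B + g)) : ℝ) * (q - 1) ≤ ν k - ν l := by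
    intro k l hl hk
    have h1 : (ν (l + 1) : ℝ) ≤ ν k := by exact_mod_cast hmono.monotone hk
    have h2 := h.2 l
    have h3 : (ν (j * (B + g)) : ℝ) ≤ ν l := by exact_mod_cast hmono.monotone hl
    nlinarith
  rcases j with _ | j
  · refine ⟨by simpa using h.1 _, fun k l _ hk => ?_⟩
    simpa using hmono hk
  · have h1 := h.sum_block_le hq (P := B + g) (by omega) B j
    have h2 : q ^ g * ν (j * (B + g) + B) ≤ ν ((j + 1) * (B + g)) := by
      have := h.pow_mul_le hq (j * (B + g) + B) g
      rwa [show j * (B + g) + B + g = (j + 1) * (B + g) by ring] at this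
    have h0 : (0 : ℝ) < ν (j * (B + g) + B) := by exact_mod_cast h.1 _
    have hs : ((∑ i ∈ Finset.range (j + 1), 2 * ν (i * (B + g) + B) : ℕ) : ℝ)
        ≤ 2 * (ν (j * (B + g) + B) * (q / (q - 1))) := by
      push_cast
      rw [← Finset.mul_sum]; linarith
    refine ⟨?_, fun k l hl hk => ?_⟩
    · have : ((∑ i ∈ Finset.range (j + 1), 2 * ν (i * (B + g) + B) : ℕ) : ℝ)
          < ν ((j + 1) * (B + g)) := by
        refine hs.trans_lt (lt_of_lt_of_le ?_ h2)
        have : 2 * (q / (q - 1)) < q ^ g := by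
          rw [mul_div_assoc', div_lt_iff₀ hq1]; exact hgap.2
        nlinarith
      exact_mod_cast this
    · rw [Nat.lt_sub_iff_add_lt]
      have : ((∑ i ∈ Finset.range (j + 1), 2 * ν (i * (B + g) + B) : ℕ) : ℝ) < ν k - ν l := by
        refine hs.trans_lt (lt_of_lt_of_le ?_ (diff k l hl hk))
        have : 2 * (q / (q - 1)) < q ^ g * (q - 1) := by
          rw [mul_div_assoc', div_lt_iff₀ hq1]; nlinarith [hgap.1]
        nlinarith
      have : ((∑ i ∈ Finset.range (j + 1), 2 * ν (i * (B + g) + B) : ℕ) : ℝ) + ν l < ν k := by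
        linarith
      exact_mod_cast this

lemma IsLacunary.blockSum_mem {q : ℝ} {ν : ℕ → ℕ} (hq : 1 < q) (h : IsLacunary q ν) {g : ℕ}
    (hg : 0 < g) (hgap : GapCond q g) (B : ℕ) (c : ℕ → ℝ) (j : ℕ) :
    blockSum ν (B + g) B c j ∈
      cosSpan (1 + ∑ i ∈ Finset.range j, 2 * ν (i * (B + g) + B)) (2 * ν (j * (B + g) + B)) := by
  have hmono := (h.strictMono hq).monotone
  have e : blockSum ν (B + g) B c j
      = ∑ k ∈ Finset.Ico (j * (B + g)) (j * (B + g) + B), c k • cosFn (ν k) := by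
    funext x; simp [blockSum, Finset.sum_apply]
  rw [e]
  refine Submodule.sum_mem _ fun k hk => Submodule.smul_mem _ _ ?_
  rw [Finset.mem_Ico] at hk
  have h1 := (h.block_sep hq hg hgap B j).1
  have h2 := hmono hk.1
  have h3 := hmono hk.2.le
  exact cosFn_mem (by omega) (by omega)

lemma IsLacunary.blockSum_sq_mem {q : ℝ} {ν : ℕ → ℕ} (hq : 1 < q) (h : IsLacunary q ν) {g : ℕ}
    (hg : 0 < g) (hgap : GapCond q g) (B : ℕ) (c : ℕ → ℝ) (j : ℕ) :
    (fun x => blockSum ν (B + g) B c j x ^ 2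
        - ∑ k ∈ Finset.Ico (j * (B + g)) (j * (B + g) + B), c k ^ 2 / 2) ∈
      cosSpan (1 + ∑ i ∈ Finset.range j, 2 * ν (i * (B + g) + B)) (2 * ν (j * (B + g) + B)) := by
  have hmono := (h.strictMono hq).monotone
  set I := Finset.Ico (j * (B + g)) (j * (B + g) + B) with hI
  have e : (fun x => blockSum ν (B + g) B c j x ^ 2 - ∑ k ∈ I, c k ^ 2 / 2)
      = ∑ k ∈ I, ∑ l ∈ I, (c k * c l) •
          (cosFn (ν k) * cosFn (ν l) - if k = l then (fun _ => 1 / 2 : ℝ → ℝ) else 0) := by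
    funext x
    simp only [Finset.sum_apply, Pi.smul_apply, Pi.sub_apply, Pi.mul_apply, smul_eq_mul, mul_sub,
      Finset.sum_sub_distrib, blockSum]
    congr 1
    · rw [sq, Finset.sum_mul_sum]
      exact Finset.sum_congr rfl fun k _ => Finset.sum_congr rfl fun l _ => by ring
    · refine Finset.sum_congr rfl fun k hk => ?_
      rw [Finset.sum_eq_single k]
      · simp; ring
      · intro l _ hl; simp [Ne.symm hl]
      · intro hk'; exact absurd hk hk'
  rw [e]
  have h1 := (h.block_sep hq hg hgap B j).1
  have key : ∀ k ∈ I, ∀ l ∈ I, l < k → cosFn (ν k) * cosFn (ν l) ∈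
      cosSpan (1 + ∑ i ∈ Finset.range j, 2 * ν (i * (B + g) + B)) (2 * ν (j * (B + g) + B)) := by
    intro k hk l hl hlk
    rw [hI, Finset.mem_Ico] at hk hl
    have h0 := (h.block_sep hq hg hgap B j).2 k l hl.1 hlk
    have h2 := hmono hk.1
    have h3 := hmono hk.2.le
    have h4 := hmono hlk.le
    rw [cosFn_mul_cosFn h4]
    exact add_mem (Submodule.smul_mem _ _ (cosFn_mem (by omega) (by omega)))
      (Submodule.smul_mem _ _ (cosFn_mem (by omega) (by omega)))
  refine Submodule.sum_mem _ fun k hk => Submodule.sum_mem _ fun l hl => Submodule.smul_mem _ _ ?_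
  rcases lt_trichotomy k l with hkl | rfl | hkl
  · rw [if_neg hkl.ne, sub_zero, mul_comm (cosFn _)]; exact key l hl k hk hkl
  · rw [if_pos rfl, cosFn_mul_cosFn le_rfl, Nat.sub_self, cosFn_zero]
    rw [hI, Finset.mem_Ico] at hk
    have h2 := hmono hk.1
    have h3 := hmono hk.2.le
    have : (1 / 2 : ℝ) • (1 : ℝ → ℝ) + (1 / 2 : ℝ) • cosFn (ν k + ν k) - (fun _ => 1 / 2)
        = (1 / 2 : ℝ) • cosFn (ν k + ν k) := by
      funext x; simp
    rw [this]
    exact Submodule.smul_mem _ _ (cosFn_mem (by omega) (by omega))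
  · rw [if_neg hkl.ne', sub_zero]; exact key k hk l hl hkl

lemma exp_le_quadratic_mul {y : ℝ} (hy : |y| ≤ 1) :
    Real.exp y ≤ (1 + y + y ^ 2 / 2) * Real.exp (|y| ^ 3) := by
  have h := Real.exp_bound hy (n := 3) (by norm_num)
  simp only [Finset.sum_range_succ, Finset.sum_range_zero] at h
  norm_num [Nat.factorial] at h
  have h1 := (abs_le.mp h).2
  have h2 : |y| ^ 3 + 1 ≤ Real.exp (|y| ^ 3) := Real.add_one_le_exp _
  have h3 : 0 ≤ |y| ^ 3 := by positivity
  have h4 : 1 / 2 ≤ 1 + y + y ^ 2 / 2 := by nlinarith [sq_nonneg (y + 1)]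
  have h5 : (1 + y + y ^ 2 / 2) * (|y| ^ 3 + 1) ≤ (1 + y + y ^ 2 / 2) * Real.exp (|y| ^ 3) := by
    gcongr
  nlinarith

lemma quadratic_le_exp {y : ℝ} (hy : |y| ≤ 1) :
    1 + y + y ^ 2 / 2 ≤ Real.exp (y + |y| ^ 3) := by
  have h := Real.exp_bound hy (n := 3) (by norm_num)
  simp only [Finset.sum_range_succ, Finset.sum_range_zero] at h
  norm_num [Nat.factorial] at h
  have h1 := (abs_le.mp h).1
  have h2 : |y| ^ 3 + 1 ≤ Real.exp (|y| ^ 3) := Real.add_one_le_exp _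
  have h3 : 0 ≤ |y| ^ 3 := by positivity
  have h4 : 1 / 3 ≤ Real.exp y := by
    have : Real.exp (-1) ≤ Real.exp y := Real.exp_le_exp.mpr (abs_le.mp hy).1
    have h5 : Real.exp 1 < 3 := lt_trans Real.exp_one_lt_d9 (by norm_num)
    have : 1 / 3 ≤ Real.exp (-1) := by
      rw [Real.exp_neg, ← one_div]
      exact one_div_le_one_div_of_le (Real.exp_pos _) h5.le
    linarith
  rw [Real.exp_add]
  have h5 : Real.exp y * (|y| ^ 3 + 1) ≤ Real.exp y * Real.exp (|y| ^ 3) := by gcongr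
  nlinarith

lemma exp_le_one_add_add_sq {y : ℝ} (hy : |y| ≤ 1) : Real.exp y ≤ 1 + y + y ^ 2 := by
  have := (abs_le.mp (Real.abs_exp_sub_one_sub_id_le hy)).2
  linarith

lemma cosFn_abs_le (m : ℕ) (x : ℝ) : |cosFn m x| ≤ 1 := Real.abs_cos_le_one _

lemma blockSum_continuous (ν : ℕ → ℕ) (P B : ℕ) (c : ℕ → ℝ) (j : ℕ) :
    Continuous (blockSum ν P B c j) := by
  unfold blockSum
  exact continuous_finsetSum _ fun k _ => continuous_const.mul (cosFn_continuous _)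

lemma blockSum_abs_le (ν : ℕ → ℕ) (P B : ℕ) {c : ℕ → ℝ} {C : ℝ} (hc : ∀ k, |c k| ≤ C) (j : ℕ)
    (x : ℝ) : |blockSum ν P B c j x| ≤ B * C := by
  calc |blockSum ν P B c j x|
      ≤ ∑ k ∈ Finset.Ico (j * P) (j * P + B), |c k * cosFn (ν k) x| :=
        Finset.abs_sum_le_sum_abs _ _
    _ ≤ ∑ k ∈ Finset.Ico (j * P) (j * P + B), C := by
        refine Finset.sum_le_sum fun k _ => ?_
        rw [abs_mul]
        calc |c k| * |cosFn (ν k) x| ≤ |c k| * 1 := by gcongr; exact cosFn_abs_le _ _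
          _ ≤ C := by simpa using hc k
    _ = B * C := by simp

lemma integral_prod_quadratic {q : ℝ} {ν : ℕ → ℕ} (hq : 1 < q) (h : IsLacunary q ν) {g : ℕ}
    (hg : 0 < g) (hgap : GapCond q g) (B : ℕ) (c α β : ℕ → ℝ) (s : Finset ℕ) :
    ∫ x in (0 : ℝ)..1, ∏ j ∈ s, (1 + α j * blockSum ν (B + g) B c j x
        + β j * blockSum ν (B + g) B c j x ^ 2)
      = ∏ j ∈ s, (1 + β j * ∑ k ∈ Finset.Ico (j * (B + g)) (j * (B + g) + B), c k ^ 2 / 2) := by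
  obtain ⟨M, hM⟩ : ∃ M, s ⊆ Finset.range M := by
    refine ⟨s.sup id + 1, fun j hj => ?_⟩
    simpa [Nat.lt_succ_iff] using Finset.le_sup (f := id) hj
  have e : ∀ (f : ℕ → ℝ), ∏ j ∈ s, f j = ∏ j ∈ Finset.range M, if j ∈ s then f j else 1 := by
    intro f
    rw [Finset.prod_ite_mem, Finset.inter_eq_right.mpr hM]
  simp_rw [e]
  have := (integral_prod_of_separated (fun j => 2 * ν (j * (B + g) + B))
    (fun j x => if j ∈ s then (1 + α j * blockSum ν (B + g) B c j x
        + β j * blockSum ν (B + g) B c j x ^ 2) else 1)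
    (fun j => if j ∈ s then
      (1 + β j * ∑ k ∈ Finset.Ico (j * (B + g)) (j * (B + g) + B), c k ^ 2 / 2) else 1) ?_ M).2
  · exact this
  · intro j
    by_cases hj : j ∈ s
    · simp only [hj, if_true]
      have h1 := Submodule.smul_mem _ (α j) (h.blockSum_mem hq hg hgap B c j)
      have h2 := Submodule.smul_mem _ (β j) (h.blockSum_sq_mem hq hg hgap B c j)
      convert add_mem h1 h2 using 1
      funext x
      simp only [Pi.add_apply, Pi.smul_apply, smul_eq_mul]
      ring
    · simp only [hj, if_false, sub_self]
      exact Submodule.zero_mem _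

/-- Exponential moments of a separated family of block sums. -/
lemma integral_exp_blockSum_le {q : ℝ} {ν : ℕ → ℕ} (hq : 1 < q) (h : IsLacunary q ν) {g : ℕ}
    (hg : 0 < g) (hgap : GapCond q g) (B : ℕ) {c : ℕ → ℝ} {C : ℝ} (hc : ∀ k, |c k| ≤ C)
    (hC : B * C ≤ 1) (s : Finset ℕ) :
    ∫ x in (0 : ℝ)..1, Real.exp (∑ j ∈ s, blockSum ν (B + g) B c j x)
      ≤ Real.exp (∑ j ∈ s, ∑ k ∈ Finset.Ico (j * (B + g)) (j * (B + g) + B), c k ^ 2 / 2) := by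
  have hle : ∀ j x, |blockSum ν (B + g) B c j x| ≤ 1 := fun j x =>
    (blockSum_abs_le ν _ B hc j x).trans hC
  have hcont := fun j => blockSum_continuous ν (B + g) B c j
  calc ∫ x in (0 : ℝ)..1, Real.exp (∑ j ∈ s, blockSum ν (B + g) B c j x)
      ≤ ∫ x in (0 : ℝ)..1, ∏ j ∈ s, (1 + 1 * blockSum ν (B + g) B c j x
        + 1 * blockSum ν (B + g) B c j x ^ 2) := by
        refine intervalIntegral.integral_mono_on zero_le_one ?_ ?_ fun x _ => ?_
        · exact Continuous.intervalIntegrable (by fun_prop) _ _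
        · exact Continuous.intervalIntegrable (by fun_prop) _ _
        · rw [Real.exp_sum]
          refine Finset.prod_le_prod (fun j _ => (Real.exp_pos _).le) fun j _ => ?_
          rw [one_mul, one_mul]; exact exp_le_one_add_add_sq (hle j x)
    _ = ∏ j ∈ s, (1 + 1 * ∑ k ∈ Finset.Ico (j * (B + g)) (j * (B + g) + B), c k ^ 2 / 2) :=
        integral_prod_quadratic hq h hg hgap B c (fun _ => 1) (fun _ => 1) s
    _ ≤ _ := by
        rw [Real.exp_sum]
        refine Finset.prod_le_prod (fun j _ => ?_) fun j _ => ?_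
        · have : 0 ≤ ∑ k ∈ Finset.Ico (j * (B + g)) (j * (B + g) + B), c k ^ 2 / 2 :=
            Finset.sum_nonneg fun k _ => by positivity
          linarith
        · rw [one_mul, add_comm]; exact Real.add_one_le_exp _

lemma sum_range_mul_two_blocks (f : ℕ → ℝ) (g M : ℕ) :
    ∑ k ∈ Finset.range (M * (g + g)), f k
      = ∑ j ∈ Finset.range M, ∑ k ∈ Finset.Ico (j * (g + g)) (j * (g + g) + g), f k
        + ∑ j ∈ Finset.range M, ∑ k ∈ Finset.Ico (j * (g + g)) (j * (g + g) + g), f (k + g) := by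
  induction M with
  | zero => simp
  | succ M ih =>
    rw [Finset.sum_range_succ, Finset.sum_range_succ]
    have e : ∑ k ∈ Finset.Ico (M * (g + g)) (M * (g + g) + g), f (k + g)
        = ∑ k ∈ Finset.Ico (M * (g + g) + g) (M * (g + g) + g + g), f k := by
      rw [Finset.sum_Ico_add' f]
    rw [e, show (M + 1) * (g + g) = M * (g + g) + g + g by ring, ← Finset.sum_range_add_sum_Ico f
      (show M * (g + g) ≤ M * (g + g) + g + g by omega), ih,
      ← Finset.sum_Ico_consecutive f (show M * (g + g) ≤ M * (g + g) + g by omega)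
        (show M * (g + g) + g ≤ M * (g + g) + g + g by omega)]
    ring

/-- Lacunary cosine sums are subgaussian. -/
lemma integral_exp_cos_le {q : ℝ} {ν : ℕ → ℕ} (hq : 1 < q) (h : IsLacunary q ν) {g : ℕ}
    (hg : 0 < g) (hgap : GapCond q g) {c : ℕ → ℝ} {C : ℝ} (hc : ∀ k, |c k| ≤ C)
    (hC : 2 * g * C ≤ 1) (N : ℕ) :
    ∫ x in (0 : ℝ)..1, Real.exp (∑ k ∈ Finset.range N, c k * cosFn (ν k) x)
      ≤ Real.exp (2 * ∑ k ∈ Finset.range N, c k ^ 2) := by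
  have hC0 : 0 ≤ C := (abs_nonneg _).trans (hc 0)
  set c' : ℕ → ℝ := fun k => if k < N then c k else 0 with hc'
  have hsub : Finset.range N ⊆ Finset.range (N * (g + g)) :=
    Finset.range_subset_range.mpr (by nlinarith)
  have ext : ∀ f : ℕ → ℝ → ℝ, (∀ k, f k 0 = 0) →
      ∑ k ∈ Finset.range N, f k (c k) = ∑ k ∈ Finset.range (N * (g + g)), f k (c' k) := by
    intro f hf
    rw [← Finset.sum_subset hsub (f := fun k => f k (c' k))]
    · refine Finset.sum_congr rfl fun k hk => ?_
      simp [hc', Finset.mem_range.mp hk]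
    · intro k _ hk
      simp only [Finset.mem_range] at hk
      simp [hc', hk, hf]
  have e1 : ∀ x, ∑ k ∈ Finset.range N, c k * cosFn (ν k) x
      = ∑ j ∈ Finset.range N, blockSum ν (g + g) g c' j x
        + ∑ j ∈ Finset.range N, blockSum (fun k => ν (k + g)) (g + g) g (fun k => c' (k + g)) j x := by
    intro x
    rw [ext (fun k t => t * cosFn (ν k) x) (fun k => by simp), sum_range_mul_two_blocks]
    rfl
  have e2 : ∑ k ∈ Finset.range N, c k ^ 2
      = ∑ j ∈ Finset.range N, ∑ k ∈ Finset.Ico (j * (g + g)) (j * (g + g) + g), c' k ^ 2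
        + ∑ j ∈ Finset.range N,
          ∑ k ∈ Finset.Ico (j * (g + g)) (j * (g + g) + g), c' (k + g) ^ 2 := by
    rw [ext (fun k t => t ^ 2) (fun k => by simp), sum_range_mul_two_blocks]
  have hcc : ∀ k, |2 * c' k| ≤ 2 * C := by
    intro k
    rw [abs_mul, abs_two]
    by_cases hk : k < N
    · simp only [hc', hk, if_true]; linarith [hc k]
    · simp only [hc', hk, if_false, abs_zero]; linarith
  have hC2 : (g : ℝ) * (2 * C) ≤ 1 := by linarith
  have b1 := integral_exp_blockSum_le hq h hg hgap g hcc hC2 (Finset.range N)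
  have b2 := integral_exp_blockSum_le hq (h.shift g) hg hgap g (c := fun k => 2 * c' (k + g))
    (fun k => hcc _) hC2 (Finset.range N)
  have two : ∀ (ν' : ℕ → ℕ) (d : ℕ → ℝ) (x : ℝ),
      ∑ j ∈ Finset.range N, blockSum ν' (g + g) g (fun k => 2 * d k) j x
        = 2 * ∑ j ∈ Finset.range N, blockSum ν' (g + g) g d j x := by
    intro ν' d x
    simp only [blockSum, Finset.mul_sum, mul_assoc]
  have two' : ∀ d : ℕ → ℝ,
      ∑ j ∈ Finset.range N, ∑ k ∈ Finset.Ico (j * (g + g)) (j * (g + g) + g), (2 * d k) ^ 2 / 2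
        = 2 * ∑ j ∈ Finset.range N,
          ∑ k ∈ Finset.Ico (j * (g + g)) (j * (g + g) + g), d k ^ 2 := by
    intro d
    simp only [Finset.mul_sum]
    exact Finset.sum_congr rfl fun j _ => Finset.sum_congr rfl fun k _ => by ring
  rw [two' c'] at b1
  rw [two' (fun k => c' (k + g))] at b2
  simp_rw [two ν c'] at b1
  simp_rw [two (fun k => ν (k + g)) (fun k => c' (k + g))] at b2
  have n1 : 0 ≤ ∑ j ∈ Finset.range N,
      ∑ k ∈ Finset.Ico (j * (g + g)) (j * (g + g) + g), c' k ^ 2 :=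
    Finset.sum_nonneg fun j _ => Finset.sum_nonneg fun k _ => sq_nonneg _
  have n2 : 0 ≤ ∑ j ∈ Finset.range N,
      ∑ k ∈ Finset.Ico (j * (g + g)) (j * (g + g) + g), c' (k + g) ^ 2 :=
    Finset.sum_nonneg fun j _ => Finset.sum_nonneg fun k _ => sq_nonneg _
  have c1 := fun j => blockSum_continuous ν (g + g) g c' j
  have c2 := fun j => blockSum_continuous (fun k => ν (k + g)) (g + g) g (fun k => c' (k + g)) j
  rw [e2]
  set Q1 := ∑ j ∈ Finset.range N,
      ∑ k ∈ Finset.Ico (j * (g + g)) (j * (g + g) + g), c' k ^ 2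
  set Q2 := ∑ j ∈ Finset.range N,
      ∑ k ∈ Finset.Ico (j * (g + g)) (j * (g + g) + g), c' (k + g) ^ 2
  have m1 : Real.exp (2 * Q1) ≤ Real.exp (2 * (Q1 + Q2)) := Real.exp_le_exp.mpr (by linarith)
  have m2 : Real.exp (2 * Q2) ≤ Real.exp (2 * (Q1 + Q2)) := Real.exp_le_exp.mpr (by linarith)
  simp_rw [e1]
  set S1 : ℝ → ℝ := fun x => ∑ j ∈ Finset.range N, blockSum ν (g + g) g c' j x
  set S2 : ℝ → ℝ := fun x => ∑ j ∈ Finset.range N,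
    blockSum (fun k => ν (k + g)) (g + g) g (fun k => c' (k + g)) j x
  have d1 : Continuous S1 := continuous_finsetSum _ fun j _ => c1 j
  have d2 : Continuous S2 := continuous_finsetSum _ fun j _ => c2 j
  calc ∫ x in (0 : ℝ)..1, Real.exp (S1 x + S2 x)
      ≤ ∫ x in (0 : ℝ)..1, (1 / 2 * Real.exp (2 * S1 x) + 1 / 2 * Real.exp (2 * S2 x)) := by
        refine intervalIntegral.integral_mono_on zero_le_one ?_ ?_ fun x _ => ?_
        · exact Continuous.intervalIntegrable (by fun_prop) _ _
        · exact Continuous.intervalIntegrable (by fun_prop) _ _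
        · rw [Real.exp_add, two_mul (S1 x), two_mul (S2 x), Real.exp_add, Real.exp_add]
          nlinarith [sq_nonneg (Real.exp (S1 x) - Real.exp (S2 x))]
    _ = 1 / 2 * (∫ x in (0 : ℝ)..1, Real.exp (2 * S1 x))
        + 1 / 2 * (∫ x in (0 : ℝ)..1, Real.exp (2 * S2 x)) := by
        rw [intervalIntegral.integral_add, intervalIntegral.integral_const_mul,
          intervalIntegral.integral_const_mul]
        · exact Continuous.intervalIntegrable (by fun_prop) _ _
        · exact Continuous.intervalIntegrable (by fun_prop) _ _
    _ ≤ _ := by linarith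

/-- Sums over the blocks `j ∈ s` of pure cosines. -/
noncomputable def bigSum (ν : ℕ → ℕ) (P B : ℕ) (s : Finset ℕ) (x : ℝ) : ℝ :=
  ∑ j ∈ s, blockSum ν P B 1 j x

/-- The density of a tilted measure, a product of quadratic polynomials in the block sums. -/
noncomputable def tiltDensity (ν : ℕ → ℕ) (P B : ℕ) (lam : ℕ → ℝ) (s : Finset ℕ) (x : ℝ) : ℝ :=
  ∏ j ∈ s, (1 + lam j * blockSum ν P B 1 j x + lam j ^ 2 / 2 * blockSum ν P B 1 j x ^ 2)
    / (1 + lam j ^ 2 * B / 4)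

lemma bigSum_continuous (ν : ℕ → ℕ) (P B : ℕ) (s : Finset ℕ) : Continuous (bigSum ν P B s) :=
  continuous_finsetSum _ fun j _ => blockSum_continuous ν P B 1 j

lemma tiltDensity_continuous (ν : ℕ → ℕ) (P B : ℕ) (lam : ℕ → ℝ) (s : Finset ℕ) :
    Continuous (tiltDensity ν P B lam s) := by
  have := fun j => blockSum_continuous ν P B 1 j
  unfold tiltDensity
  fun_prop

lemma tiltDensity_nonneg (ν : ℕ → ℕ) (P B : ℕ) (lam : ℕ → ℝ) (s : Finset ℕ) (x : ℝ) :
    0 ≤ tiltDensity ν P B lam s x := by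
  refine Finset.prod_nonneg fun j _ => div_nonneg ?_ (by positivity)
  nlinarith [sq_nonneg (lam j * blockSum ν P B 1 j x + 1)]

lemma tiltDensity_union (ν : ℕ → ℕ) (P B : ℕ) (lam : ℕ → ℝ) {s t : Finset ℕ} (h : Disjoint s t)
    (x : ℝ) : tiltDensity ν P B lam (s ∪ t) x
      = tiltDensity ν P B lam s x * tiltDensity ν P B lam t x :=
  Finset.prod_union h

lemma integral_tiltDensity {q : ℝ} {ν : ℕ → ℕ} (hq : 1 < q) (h : IsLacunary q ν) {g : ℕ}
    (hg : 0 < g) (hgap : GapCond q g) (B : ℕ) (lam : ℕ → ℝ) (s : Finset ℕ) :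
    ∫ x in (0 : ℝ)..1, tiltDensity ν (B + g) B lam s x = 1 := by
  have := integral_prod_quadratic hq h hg hgap B 1 lam (fun j => lam j ^ 2 / 2) s
  unfold tiltDensity
  simp_rw [Finset.prod_div_distrib]
  rw [intervalIntegral.integral_div, this]
  rw [div_eq_one_iff_eq]
  · refine Finset.prod_congr rfl fun j _ => ?_
    simp; ring
  · exact Finset.prod_ne_zero_iff.mpr fun j _ => by positivity

lemma exp_neg_le_inv {y : ℝ} (hy : 0 ≤ y) : 1 / (1 + y) ≤ Real.exp (-y + y ^ 2) := by
  rw [div_le_iff₀ (by linarith)]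
  have := Real.add_one_le_exp (-y + y ^ 2)
  have h3 : 0 ≤ y ^ 3 := by positivity
  nlinarith

lemma tiltDensity_le {ν : ℕ → ℕ} {P B : ℕ} (hB : 0 < B) {lam : ℕ → ℝ} {s : Finset ℕ} {l : ℝ}
    (hl : ∀ j ∈ s, lam j = l) (hl0 : 0 ≤ l) (hlB : l * B ≤ 1) (x : ℝ) :
    tiltDensity ν P B lam s x
      ≤ Real.exp (l * bigSum ν P B s x - l ^ 2 * (s.card * B / 2) / 2
          + 2 * s.card * (l * B) ^ 3) := by
  have hB1 : (1 : ℝ) ≤ B := by exact_mod_cast hB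
  have e : l * bigSum ν P B s x - l ^ 2 * (s.card * B / 2) / 2 + 2 * s.card * (l * B) ^ 3
      = ∑ j ∈ s, (l * blockSum ν P B 1 j x - l ^ 2 * B / 4 + 2 * (l * B) ^ 3) := by
    rw [Finset.sum_add_distrib, Finset.sum_sub_distrib, Finset.sum_const, Finset.sum_const,
      ← Finset.mul_sum]
    simp only [bigSum, nsmul_eq_mul]; ring
  rw [e, Real.exp_sum]
  refine Finset.prod_le_prod (fun j _ => div_nonneg ?_ (by positivity)) fun j hj => ?_
  · nlinarith [sq_nonneg (lam j * blockSum ν P B 1 j x + 1)]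
  rw [hl j hj]
  set X := blockSum ν P B 1 j x
  have hX : |X| ≤ B := by simpa using blockSum_abs_le ν P B (c := 1) (C := 1) (by simp) j x
  have hlX : |l * X| ≤ l * B := by rw [abs_mul, abs_of_nonneg hl0]; gcongr
  have h1 := quadratic_le_exp (hlX.trans hlB)
  have h2 := exp_neg_le_inv (y := l ^ 2 * B / 4) (by positivity)
  have h3 : |l * X| ^ 3 ≤ (l * B) ^ 3 := by gcongr
  have h4 : (l ^ 2 * B / 4) ^ 2 ≤ (l * B) ^ 3 := by
    have h40 : 0 ≤ l * B := by positivity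
    have h41 : (l * B) ^ 4 ≤ (l * B) ^ 3 := pow_le_pow_of_le_one h40 hlB (by norm_num)
    have h42 : l ^ 4 * (B : ℝ) ^ 2 ≤ l ^ 4 * (B : ℝ) ^ 4 :=
      mul_le_mul_of_nonneg_left (pow_le_pow_right₀ hB1 (by norm_num)) (by positivity)
    have h43 : 0 ≤ l ^ 4 * (B : ℝ) ^ 2 := by positivity
    nlinarith
  rw [div_eq_mul_one_div]
  calc (1 + l * X + l ^ 2 / 2 * X ^ 2) * (1 / (1 + l ^ 2 * B / 4))
      ≤ Real.exp (l * X + |l * X| ^ 3) * Real.exp (-(l ^ 2 * B / 4) + (l ^ 2 * B / 4) ^ 2) := by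
        gcongr
        calc 1 + l * X + l ^ 2 / 2 * X ^ 2 = 1 + l * X + (l * X) ^ 2 / 2 := by ring
          _ ≤ _ := h1
    _ ≤ _ := by
        rw [← Real.exp_add, Real.exp_le_exp]; linarith

lemma integral_exp_bigSum_le {q : ℝ} {ν : ℕ → ℕ} (hq : 1 < q) (h : IsLacunary q ν) {g : ℕ}
    (hg : 0 < g) (hgap : GapCond q g) (B : ℕ) {l : ℝ} (hl0 : 0 ≤ l) (hlB : l * B ≤ 1)
    (s : Finset ℕ) :
    ∫ x in (0 : ℝ)..1, Real.exp (l * bigSum ν (B + g) B s x)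
      ≤ Real.exp (l ^ 2 * (s.card * B / 2) / 2 + s.card * (l * B) ^ 3) := by
  have hcont := fun j => blockSum_continuous ν (B + g) B 1 j
  have hbc := bigSum_continuous ν (B + g) B s
  have e1 : ∀ x, l * bigSum ν (B + g) B s x - s.card * (l * B) ^ 3
      = ∑ j ∈ s, (l * blockSum ν (B + g) B 1 j x - (l * B) ^ 3) := by
    intro x
    rw [Finset.sum_sub_distrib, Finset.sum_const, ← Finset.mul_sum]
    simp only [bigSum, nsmul_eq_mul]
  have key : ∫ x in (0 : ℝ)..1, Real.exp (l * bigSum ν (B + g) B s x - s.card * (l * B) ^ 3)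
      ≤ Real.exp (l ^ 2 * (s.card * B / 2) / 2) := by
    calc ∫ x in (0 : ℝ)..1, Real.exp (l * bigSum ν (B + g) B s x - s.card * (l * B) ^ 3)
        ≤ ∫ x in (0 : ℝ)..1, ∏ j ∈ s, (1 + l * blockSum ν (B + g) B 1 j x
            + l ^ 2 / 2 * blockSum ν (B + g) B 1 j x ^ 2) := by
          refine intervalIntegral.integral_mono_on zero_le_one ?_ ?_ fun x _ => ?_
          · exact Continuous.intervalIntegrable (by fun_prop) _ _
          · exact Continuous.intervalIntegrable (by fun_prop) _ _
          · rw [e1, Real.exp_sum]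
            refine Finset.prod_le_prod (fun j _ => (Real.exp_pos _).le) fun j _ => ?_
            set X := blockSum ν (B + g) B 1 j x
            have hX : |X| ≤ B := by
              simpa using blockSum_abs_le ν (B + g) B (c := 1) (C := 1) (by simp) j x
            have hlX : |l * X| ≤ l * B := by rw [abs_mul, abs_of_nonneg hl0]; gcongr
            have h1 := exp_le_quadratic_mul (hlX.trans hlB)
            have h3 : |l * X| ^ 3 ≤ (l * B) ^ 3 := by gcongr
            rw [Real.exp_sub, div_le_iff₀ (Real.exp_pos _)]
            refine h1.trans ?_
            have h4 : 0 ≤ 1 + l * X + l ^ 2 / 2 * X ^ 2 := by nlinarith [sq_nonneg (l * X + 1)]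
            rw [show 1 + l * X + (l * X) ^ 2 / 2 = 1 + l * X + l ^ 2 / 2 * X ^ 2 by ring]
            gcongr
      _ = ∏ j ∈ s, (1 + l ^ 2 / 2 * ∑ k ∈ Finset.Ico (j * (B + g)) (j * (B + g) + B),
            (1 : ℕ → ℝ) k ^ 2 / 2) :=
          integral_prod_quadratic hq h hg hgap B 1 (fun _ => l) (fun _ => l ^ 2 / 2) s
      _ ≤ ∏ j ∈ s, Real.exp (l ^ 2 * B / 4) := by
          refine Finset.prod_le_prod (fun j _ => ?_) fun j _ => ?_
          · simp; positivity
          · refine le_trans (le_of_eq ?_) (Real.add_one_le_exp _)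
            simp; ring
      _ = _ := by
          rw [← Real.exp_sum, Finset.sum_const, nsmul_eq_mul]; congr 1; ring
  simp_rw [Real.exp_sub] at key
  rw [intervalIntegral.integral_div, div_le_iff₀ (Real.exp_pos _), ← Real.exp_add] at key
  exact key

/-- The sum over all indices below `N` that lie outside of the blocks `j ∈ s`. -/
noncomputable def restSum (ν : ℕ → ℕ) (P B : ℕ) (s : Finset ℕ) (N : ℕ) (x : ℝ) : ℝ :=
  ∑ k ∈ Finset.range N, cosFn (ν k) x - bigSum ν P B s x

lemma restSum_continuous (ν : ℕ → ℕ) (P B : ℕ) (s : Finset ℕ) (N : ℕ) :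
    Continuous (restSum ν P B s N) :=
  (continuous_finsetSum _ fun _ _ => cosFn_continuous _).sub (bigSum_continuous ν P B s)

/-- Summation over the union of the blocks `j ∈ s`. -/
lemma sum_blocks_eq {g B : ℕ} (s : Finset ℕ) (f : ℕ → ℝ) :
    ∑ j ∈ s, ∑ k ∈ Finset.Ico (j * (B + g)) (j * (B + g) + B), f k
      = ∑ k ∈ s.biUnion (fun j => Finset.Ico (j * (B + g)) (j * (B + g) + B)), f k := by
  rw [Finset.sum_biUnion]
  intro i _ j _ hij
  rw [Function.onFun, Finset.disjoint_left]
  intro k hk hk'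
  rw [Finset.mem_Ico] at hk hk'
  rcases lt_or_gt_of_ne hij with h | h
  · have : (i + 1) * (B + g) ≤ j * (B + g) := Nat.mul_le_mul_right _ h
    rw [add_mul] at this; omega
  · have : (j + 1) * (B + g) ≤ i * (B + g) := Nat.mul_le_mul_right _ h
    rw [add_mul] at this; omega

lemma integral_exp_bigSum_restSum_le {q : ℝ} {ν : ℕ → ℕ} (hq : 1 < q) (h : IsLacunary q ν) {g : ℕ}
    (hg : 0 < g) (hgap : GapCond q g) (B : ℕ) {l κ : ℝ} (hl : 2 * g * |l| ≤ 1)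
    (hκ : 2 * g * |κ| ≤ 1) {s : Finset ℕ} {N : ℕ} (hN : ∀ j ∈ s, j * (B + g) + B ≤ N) :
    ∫ x in (0 : ℝ)..1, Real.exp (l * bigSum ν (B + g) B s x + κ * restSum ν (B + g) B s N x)
      ≤ Real.exp (2 * (l ^ 2 * (s.card * B) + κ ^ 2 * (N - s.card * B))) := by
  set T := s.biUnion (fun j => Finset.Ico (j * (B + g)) (j * (B + g) + B)) with hT
  have hTN : T ⊆ Finset.range N := by
    intro k hk
    obtain ⟨j, hj, hk⟩ := Finset.mem_biUnion.mp hk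
    rw [Finset.mem_Ico] at hk
    exact Finset.mem_range.mpr (lt_of_lt_of_le hk.2 (hN j hj))
  have hcard : (T.card : ℝ) = s.card * B := by
    have := sum_blocks_eq (g := g) (B := B) s (fun _ => 1)
    simp only [Finset.sum_const, Nat.card_Ico, add_tsub_cancel_left, nsmul_eq_mul, mul_one] at this
    exact this.symm
  have main := integral_exp_cos_le hq h hg hgap (c := fun k => if k ∈ T then l else κ)
    (C := max |l| |κ|) (fun k => by by_cases hk : k ∈ T <;> simp [hk])
    (by
      rcases max_choice |l| |κ| with h' | h' <;> rw [h'] <;> assumption) N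
  have split : ∀ (f : ℕ → ℝ), ∑ k ∈ Finset.range N, f k
      = ∑ k ∈ T, f k + ∑ k ∈ Finset.range N \ T, f k := fun f => by
    rw [add_comm, Finset.sum_sdiff hTN]
  have e1 : ∀ x, ∑ k ∈ Finset.range N, (if k ∈ T then l else κ) * cosFn (ν k) x
      = l * bigSum ν (B + g) B s x + κ * restSum ν (B + g) B s N x := by
    intro x
    have hb : bigSum ν (B + g) B s x = ∑ k ∈ T, cosFn (ν k) x := by
      rw [hT, ← sum_blocks_eq]
      simp [bigSum, blockSum]
    rw [restSum, hb, split, split (fun k => cosFn (ν k) x), add_sub_cancel_left, Finset.mul_sum,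
      Finset.mul_sum]
    congr 1
    · exact Finset.sum_congr rfl fun k hk => by simp [hk]
    · refine Finset.sum_congr rfl fun k hk => ?_
      rw [if_neg (Finset.mem_sdiff.mp hk).2]
  have e2 : ∑ k ∈ Finset.range N, (if k ∈ T then l else κ) ^ 2
      = l ^ 2 * (s.card * B) + κ ^ 2 * (N - s.card * B) := by
    have hc2 : ((Finset.range N \ T).card : ℝ) = N - s.card * B := by
      rw [Finset.card_sdiff_of_subset hTN, Nat.cast_sub (Finset.card_le_card hTN), hcard,
        Finset.card_range]
    rw [split, ← hc2, ← hcard]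
    congr 1
    · rw [Finset.sum_congr rfl (g := fun _ => l ^ 2) fun k hk => by simp [hk], Finset.sum_const,
        nsmul_eq_mul, mul_comm]
    · rw [Finset.sum_congr rfl (g := fun _ => κ ^ 2) fun k hk => by
        rw [if_neg (Finset.mem_sdiff.mp hk).2], Finset.sum_const, nsmul_eq_mul, mul_comm]
  simp_rw [e1] at main
  rw [e2] at main
  exact main

lemma measureReal_forall_eq_zero_le {Ω : Type*} [MeasurableSpace Ω] {μ : Measure Ω}
    [IsProbabilityMeasure μ] {f : ℕ → Ω → ℝ} {a : ℕ → ℝ} {δ : ℝ} {s : Finset ℕ}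
    (hf : ∀ i ∈ s, Measurable (f i)) (h0 : ∀ i ∈ s, ∀ x, 0 ≤ f i x)
    (h1 : ∀ i ∈ s, ∀ x, f i x ≤ 1) (hle : ∀ i ∈ s, ∫ x, f i x ∂μ ≤ a i)
    (hge : ∀ i ∈ s, a i * (1 - δ) ≤ ∫ x, f i x ∂μ)
    (hprod : ∀ i ∈ s, ∀ l ∈ s, i ≠ l → ∫ x, f i x * f l x ∂μ ≤ a i * a l) :
    (∑ i ∈ s, a i) ^ 2 * μ.real {x | ∀ i ∈ s, f i x = 0}
      ≤ (∑ i ∈ s, a i) + 2 * δ * (∑ i ∈ s, a i) ^ 2 := by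
  set S := ∑ i ∈ s, a i with hS
  set Z : Ω → ℝ := fun x => ∑ i ∈ s, f i x with hZ
  have ha : ∀ i ∈ s, 0 ≤ a i := fun i hi =>
    (integral_nonneg (h0 i hi)).trans (hle i hi)
  have hS0 : 0 ≤ S := Finset.sum_nonneg ha
  have hfi : ∀ i ∈ s, Integrable (f i) μ := fun i hi =>
    Integrable.of_bound (hf i hi).aestronglyMeasurable 1 (ae_of_all _ fun x => by
      rw [Real.norm_eq_abs, abs_of_nonneg (h0 i hi x)]; exact h1 i hi x)
  have hfil : ∀ i ∈ s, ∀ l ∈ s, Integrable (fun x => f i x * f l x) μ := fun i hi l hl =>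
    Integrable.of_bound ((hf i hi).mul (hf l hl)).aestronglyMeasurable 1 (ae_of_all _ fun x => by
      rw [Real.norm_eq_abs, abs_of_nonneg (mul_nonneg (h0 i hi x) (h0 l hl x))]
      exact mul_le_one₀ (h1 i hi x) (h0 l hl x) (h1 l hl x))
  have hZi : Integrable Z μ := integrable_finsetSum _ hfi
  have hZsq : ∀ x, Z x ^ 2 = ∑ i ∈ s, ∑ l ∈ s, f i x * f l x := fun x => by
    rw [sq, Finset.sum_mul_sum]
  have hZ2i : Integrable (fun x => Z x ^ 2) μ := by
    simp_rw [hZsq]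
    exact integrable_finsetSum _ fun i hi => integrable_finsetSum _ fun l hl => hfil i hi l hl
  have hZ2 : ∫ x, Z x ^ 2 ∂μ ≤ S + S ^ 2 := by
    simp_rw [hZsq]
    rw [integral_finsetSum _ fun i hi => integrable_finsetSum _ fun l hl => hfil i hi l hl]
    calc ∑ i ∈ s, ∫ x, ∑ l ∈ s, f i x * f l x ∂μ
        ≤ ∑ i ∈ s, (a i + ∑ l ∈ s, a i * a l) := by
          refine Finset.sum_le_sum fun i hi => ?_
          rw [integral_finsetSum _ fun l hl => hfil i hi l hl, ← Finset.add_sum_erase _ _ hi]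
          refine add_le_add ?_ ?_
          · refine (integral_mono (hfil i hi i hi) (hfi i hi) fun x => ?_).trans (hle i hi)
            exact mul_le_of_le_one_left (h0 i hi x) (h1 i hi x)
          · refine (Finset.sum_le_sum fun l hl => ?_).trans
              (Finset.sum_le_sum_of_subset_of_nonneg (Finset.erase_subset i s)
                fun l hl _ => mul_nonneg (ha i hi) (ha l hl))
            rw [Finset.mem_erase] at hl
            exact hprod i hi l hl.2 hl.1.symm
      _ = S + S ^ 2 := by
          rw [Finset.sum_add_distrib, sq, hS, Finset.sum_mul_sum]
  have hZ1 : S * (1 - δ) ≤ ∫ x, Z x ∂μ := by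
    rw [hZ, integral_finsetSum _ hfi, hS, Finset.sum_mul]
    exact Finset.sum_le_sum hge
  have hvar : ∫ x, (Z x - S) ^ 2 ∂μ ≤ S + 2 * δ * S ^ 2 := by
    have e : ∀ x, (Z x - S) ^ 2 = Z x ^ 2 - 2 * S * Z x + S ^ 2 := fun x => by ring
    simp_rw [e]
    have hs2 : Integrable (fun x => Z x ^ 2 - 2 * S * Z x) μ := hZ2i.sub (hZi.const_mul _)
    rw [integral_add hs2 (integrable_const _), integral_sub hZ2i (hZi.const_mul _),
      integral_const_mul]
    simp only [integral_const, probReal_univ, one_smul]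
    nlinarith
  refine le_trans ?_ hvar
  have hvi : Integrable (fun x => (Z x - S) ^ 2) μ := by
    have e : ∀ x, (Z x - S) ^ 2 = Z x ^ 2 - 2 * S * Z x + S ^ 2 := fun x => by ring
    simp_rw [e]
    exact (hZ2i.sub (hZi.const_mul _)).add (integrable_const _)
  have hm : MeasurableSet {x | ∀ i ∈ s, f i x = 0} := by
    have : {x | ∀ i ∈ s, f i x = 0} = ⋂ i ∈ s, {x | f i x = 0} := by ext; simp
    rw [this]
    exact Finset.measurableSet_biInter _ fun i hi => measurableSet_eq_fun (hf i hi) measurable_const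
  calc S ^ 2 * μ.real {x | ∀ i ∈ s, f i x = 0}
      = ∫ x, {x | ∀ i ∈ s, f i x = 0}.indicator (fun _ => S ^ 2) x ∂μ := by
        rw [integral_indicator hm, setIntegral_const, smul_eq_mul, mul_comm]
    _ ≤ ∫ x, (Z x - S) ^ 2 ∂μ := by
        refine integral_mono ((integrable_const _).indicator hm) hvi fun x => ?_
        by_cases hx : x ∈ {x | ∀ i ∈ s, f i x = 0}
        · have : Z x = 0 := Finset.sum_eq_zero hx
          simp only [Set.indicator_of_mem hx, this]
          exact le_of_eq (by ring)
        · simp only [Set.indicator_of_notMem hx]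
          positivity

lemma ae_frequently_ne_zero {Ω : Type*} [MeasurableSpace Ω] {μ : Measure Ω}
    [IsProbabilityMeasure μ] {f : ℕ → Ω → ℝ} {a δ : ℕ → ℝ}
    (hf : ∀ i, Measurable (f i)) (h0 : ∀ i x, 0 ≤ f i x)
    (h1 : ∀ i x, f i x ≤ 1) (hle : ∀ i, ∫ x, f i x ∂μ ≤ a i)
    (hge : ∀ i, a i * (1 - δ i) ≤ ∫ x, f i x ∂μ)
    (hprod : ∀ i l, i ≠ l → ∫ x, f i x * f l x ∂μ ≤ a i * a l)
    (hδ : Tendsto δ atTop (nhds 0)) (hsum : ¬ Summable a) :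
    ∀ᵐ x ∂μ, ∃ᶠ i in atTop, f i x ≠ 0 := by
  have ha : ∀ i, 0 ≤ a i := fun i => (integral_nonneg (h0 i)).trans (hle i)
  have key : ∀ i₀, μ {x | ∀ i, i₀ ≤ i → f i x = 0} = 0 := by
    intro i₀
    rw [← measureReal_eq_zero_iff]
    refine le_antisymm (le_of_forall_pos_le_add fun ε hε => ?_) measureReal_nonneg
    rw [zero_add]
    obtain ⟨i₁, hi₁⟩ := eventually_atTop.mp (hδ.eventually_le_const (show 0 < ε / 4 by linarith))
    set i₂ := max i₀ i₁
    have hsum2 : Tendsto (fun n => ∑ i ∈ Finset.range n, a (i + i₂)) atTop atTop := by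
      rw [← not_summable_iff_tendsto_nat_atTop_of_nonneg fun i => ha _]
      rwa [summable_nat_add_iff]
    obtain ⟨n, hn⟩ := (hsum2.eventually_ge_atTop (2 / ε)).exists
    set s := (Finset.range n).map (addRightEmbedding i₂) with hs
    have hs2 : ∀ i ∈ s, i₂ ≤ i := by
      intro i hi
      obtain ⟨j, -, rfl⟩ := Finset.mem_map.mp hi
      simp
    have hS : ∑ i ∈ s, a i = ∑ i ∈ Finset.range n, a (i + i₂) := by simp [hs]
    rw [← hS] at hn
    have main := measureReal_forall_eq_zero_le (μ := μ) (f := f) (a := a) (δ := ε / 4) (s := s)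
      (fun i _ => hf i) (fun i _ => h0 i) (fun i _ => h1 i) (fun i _ => hle i)
      (fun i hi => le_trans (by
        have := hi₁ i ((le_max_right _ _).trans (hs2 i hi))
        gcongr
        exact ha i) (hge i))
      (fun i _ l _ hil => hprod i l hil)
    set S := ∑ i ∈ s, a i
    have hSpos : 0 < S := lt_of_lt_of_le (by positivity) hn
    have hmono : μ.real {x | ∀ i, i₀ ≤ i → f i x = 0} ≤ μ.real {x | ∀ i ∈ s, f i x = 0} :=
      measureReal_mono fun x hx i hi => hx i ((le_max_left _ _).trans (hs2 i hi))
    refine hmono.trans ?_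
    rw [div_le_iff₀ hε] at hn
    have : S ^ 2 * μ.real {x | ∀ i ∈ s, f i x = 0} ≤ S ^ 2 * ε := by nlinarith
    exact le_of_mul_le_mul_left this (by positivity)
  have : ∀ᵐ x ∂μ, ∀ i₀, ¬ ∀ i, i₀ ≤ i → f i x = 0 := ae_all_iff.mpr fun i₀ => by
    rw [ae_iff]; simpa using key i₀
  filter_upwards [this] with x hx
  rw [frequently_atTop]
  intro i₀
  have := hx i₀
  push Not at this
  exact this

/-- The set where the big block sum is close to its tilted mean and the rest is small. -/
def goodSet (ν : ℕ → ℕ) (P B : ℕ) (s : Finset ℕ) (N : ℕ) (l ε t : ℝ) : Set ℝ :=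
  {x | ((1 - ε) * (l * (s.card * B / 2)) ≤ bigSum ν P B s x
      ∧ bigSum ν P B s x ≤ (1 + ε) * (l * (s.card * B / 2))) ∧ |restSum ν P B s N x| ≤ t}

lemma measurableSet_goodSet (ν : ℕ → ℕ) (P B : ℕ) (s : Finset ℕ) (N : ℕ) (l ε t : ℝ) :
    MeasurableSet (goodSet ν P B s N l ε t) := by
  have h1 := (bigSum_continuous ν P B s).measurable
  have h2 := (restSum_continuous ν P B s N).abs.measurable
  exact ((measurableSet_le measurable_const h1).inter
    (measurableSet_le h1 measurable_const)).inter (measurableSet_le h2 measurable_const)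

lemma tiltDensity_le_of_mem_goodSet {ν : ℕ → ℕ} {P B : ℕ} (hB : 0 < B) {lam : ℕ → ℝ}
    {s : Finset ℕ} {N : ℕ} {l ε t : ℝ} (hl : ∀ j ∈ s, lam j = l) (hl0 : 0 ≤ l) (hlB : l * B ≤ 1)
    {x : ℝ} (hx : x ∈ goodSet ν P B s N l ε t) :
    tiltDensity ν P B lam s x
      ≤ Real.exp ((1 / 2 + ε) * (l ^ 2 * (s.card * B / 2)) + 10 * s.card * (l * B) ^ 3) := by
  refine (tiltDensity_le hB hl hl0 hlB x).trans (Real.exp_le_exp.mpr ?_)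
  have h1 : l * bigSum ν P B s x ≤ l * ((1 + ε) * (l * (s.card * B / 2))) :=
    mul_le_mul_of_nonneg_left hx.1.2 hl0
  have h2 : (0 : ℝ) ≤ s.card * (l * B) ^ 3 := by positivity
  nlinarith

lemma indicator_compl_goodSet_le (ν : ℕ → ℕ) (P B : ℕ) (s : Finset ℕ) (N : ℕ) {l ε t κ : ℝ}
    (hl0 : 0 ≤ l) (hε : 0 ≤ ε) (hκ : 0 ≤ κ) (x : ℝ) :
    (goodSet ν P B s N l ε t)ᶜ.indicator (fun _ => (1 : ℝ)) x
      ≤ Real.exp (ε * l * ((1 - ε) * (l * (s.card * B / 2)) - bigSum ν P B s x))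
        + Real.exp (ε * l * (bigSum ν P B s x - (1 + ε) * (l * (s.card * B / 2))))
        + Real.exp (κ * (restSum ν P B s N x - t)) + Real.exp (κ * (-restSum ν P B s N x - t)) := by
  have hεl : 0 ≤ ε * l := by positivity
  by_cases hx : x ∈ (goodSet ν P B s N l ε t)ᶜ
  · rw [Set.indicator_of_mem hx]
    have p1 := Real.exp_pos (ε * l * ((1 - ε) * (l * (s.card * B / 2)) - bigSum ν P B s x))
    have p2 := Real.exp_pos (ε * l * (bigSum ν P B s x - (1 + ε) * (l * (s.card * B / 2))))
    have p3 := Real.exp_pos (κ * (restSum ν P B s N x - t))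
    have p4 := Real.exp_pos (κ * (-restSum ν P B s N x - t))
    simp only [goodSet, Set.mem_compl_iff, Set.mem_ofPred_eq, not_and_or, not_le] at hx
    rcases hx with (hx | hx) | hx
    · have := Real.one_le_exp (mul_nonneg hεl (sub_nonneg.mpr hx.le))
      linarith
    · have := Real.one_le_exp (mul_nonneg hεl (sub_nonneg.mpr hx.le))
      linarith
    · rcases lt_abs.mp hx with hx | hx
      · have := Real.one_le_exp (mul_nonneg hκ (sub_nonneg.mpr hx.le))
        linarith
      · have := Real.one_le_exp (mul_nonneg hκ (sub_nonneg.mpr hx.le))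
        linarith
  · rw [Set.indicator_of_notMem hx]; positivity

lemma integral_tiltDensity_compl_goodSet_le {q : ℝ} {ν : ℕ → ℕ} (hq : 1 < q) (h : IsLacunary q ν)
    {g : ℕ} (hg : 0 < g) (hgap : GapCond q g) {B : ℕ} (hB : 0 < B) {lam : ℕ → ℝ}
    {s : Finset ℕ} {N : ℕ} {l ε t κ : ℝ} (hl : ∀ j ∈ s, lam j = l) (hl0 : 0 ≤ l)
    (hε : 0 ≤ ε) (hε1 : ε ≤ 1) (hκ : 0 ≤ κ) (hlB : 2 * (l * B) ≤ 1) (hlg : 2 * g * l ≤ 1)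
    (hκg : 2 * g * κ ≤ 1) (hN : ∀ j ∈ s, j * (B + g) + B ≤ N) :
    ∫ x in (0 : ℝ)..1, (goodSet ν (B + g) B s N l ε t)ᶜ.indicator
        (tiltDensity ν (B + g) B lam s) x
      ≤ 2 * Real.exp (-(ε ^ 2 * (l ^ 2 * (s.card * B / 2)) / 2) + 10 * s.card * (l * B) ^ 3)
        + 2 * Real.exp (10 * s.card * (l * B) ^ 3
          + 2 * (l ^ 2 * (s.card * B) + κ ^ 2 * (N - s.card * B)) - κ * t) := by
  have hWc := bigSum_continuous ν (B + g) B s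
  have hRc := restSum_continuous ν (B + g) B s N
  have hhc := tiltDensity_continuous ν (B + g) B lam s
  set W := bigSum ν (B + g) B s
  set R := restSum ν (B + g) B s N
  set V : ℝ := s.card * B / 2 with hV
  set E : ℝ := s.card * (l * B) ^ 3 with hE
  have hE0 : 0 ≤ E := by positivity
  have pt : ∀ x, (goodSet ν (B + g) B s N l ε t)ᶜ.indicator (tiltDensity ν (B + g) B lam s) x
      ≤ ((Real.exp (((1 - ε) * l) * W x) * Real.exp (-(l ^ 2 * V / 2) + 2 * E + ε * (1 - ε) * l ^ 2 * V)
        + Real.exp (((1 + ε) * l) * W x) * Real.exp (-(l ^ 2 * V / 2) + 2 * E - ε * (1 + ε) * l ^ 2 * V))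
        + Real.exp (l * W x + κ * R x) * Real.exp (2 * E - κ * t))
        + Real.exp (l * W x + (-κ) * R x) * Real.exp (2 * E - κ * t) := by
    intro x
    have h1 := indicator_compl_goodSet_le ν (B + g) B s N (t := t) hl0 hε hκ x
    have h2 := tiltDensity_le (ν := ν) (P := B + g) hB hl hl0 (by linarith [mul_nonneg hl0 (Nat.cast_nonneg (α := ℝ) B)]) x
    have e0 : (goodSet ν (B + g) B s N l ε t)ᶜ.indicator (tiltDensity ν (B + g) B lam s) x
        = tiltDensity ν (B + g) B lam s x
          * (goodSet ν (B + g) B s N l ε t)ᶜ.indicator (fun _ => (1 : ℝ)) x := by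
      by_cases hx : x ∈ (goodSet ν (B + g) B s N l ε t)ᶜ
      · rw [Set.indicator_of_mem hx, Set.indicator_of_mem hx, mul_one]
      · rw [Set.indicator_of_notMem hx, Set.indicator_of_notMem hx, mul_zero]
    rw [e0]
    refine (mul_le_mul h2 h1 (Set.indicator_nonneg (fun _ _ => zero_le_one) _)
      (Real.exp_pos _).le).trans ?_
    rw [mul_add, mul_add, mul_add]
    simp only [← Real.exp_add]
    have hl2V : 0 ≤ l ^ 2 * V := by positivity
    gcongr ?_ + ?_ + ?_ + ?_
    · refine Real.exp_le_exp.mpr (le_of_eq ?_); ring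
    · refine Real.exp_le_exp.mpr (le_of_eq ?_); ring
    · refine Real.exp_le_exp.mpr ?_; linear_combination (1 / 2) * hl2V
    · refine Real.exp_le_exp.mpr ?_; linear_combination (1 / 2) * hl2V
  have hlV : 0 ≤ l * B := by positivity
  have i1 := integral_exp_bigSum_le hq h hg hgap B (l := (1 - ε) * l)
    (mul_nonneg (by linarith) hl0) (by nlinarith) s
  have i2 := integral_exp_bigSum_le hq h hg hgap B (l := (1 + ε) * l)
    (mul_nonneg (by linarith) hl0) (by nlinarith) s
  have i3 := integral_exp_bigSum_restSum_le hq h hg hgap B (l := l) (κ := κ)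
    (by rwa [abs_of_nonneg hl0]) (by rwa [abs_of_nonneg hκ]) hN
  have i4 := integral_exp_bigSum_restSum_le hq h hg hgap B (l := l) (κ := -κ)
    (by rwa [abs_of_nonneg hl0]) (by rwa [abs_neg, abs_of_nonneg hκ]) hN
  rw [neg_sq] at i4
  have c1 : IntervalIntegrable (fun x => Real.exp (((1 - ε) * l) * W x)
      * Real.exp (-(l ^ 2 * V / 2) + 2 * E + ε * (1 - ε) * l ^ 2 * V)) volume 0 1 :=
    Continuous.intervalIntegrable (by fun_prop) _ _
  have c2 : IntervalIntegrable (fun x => Real.exp (((1 + ε) * l) * W x)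
      * Real.exp (-(l ^ 2 * V / 2) + 2 * E - ε * (1 + ε) * l ^ 2 * V)) volume 0 1 :=
    Continuous.intervalIntegrable (by fun_prop) _ _
  have c3 : ∀ κ : ℝ, IntervalIntegrable (fun x => Real.exp (l * W x + κ * R x)
      * Real.exp (2 * E - κ * t)) volume 0 1 := fun κ =>
    Continuous.intervalIntegrable (by fun_prop) _ _
  have c4 : IntervalIntegrable (fun x => Real.exp (l * W x + (-κ) * R x)
      * Real.exp (2 * E - κ * t)) volume 0 1 := 
    Continuous.intervalIntegrable (by fun_prop) _ _
  refine (intervalIntegral.integral_mono_on zero_le_one ?_ (((c1.add c2).add (c3 κ)).add c4)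
    fun x _ => pt x).trans ?_
  · rw [intervalIntegrable_iff]
    exact ((intervalIntegrable_iff.mp (hhc.intervalIntegrable 0 1))).indicator
      (measurableSet_goodSet ν (B + g) B s N l ε t).compl
  rw [intervalIntegral.integral_add ((c1.add c2).add (c3 κ)) c4,
    intervalIntegral.integral_add (c1.add c2) (c3 κ), intervalIntegral.integral_add c1 c2]
  simp only [intervalIntegral.integral_mul_const]
  have f1 : (1 - ε) ^ 3 ≤ 1 := pow_le_one₀ (by linarith) (by linarith)
  have f2 : (1 + ε) ^ 3 ≤ 8 := by
    calc (1 + ε) ^ 3 ≤ 2 ^ 3 := by gcongr; linarith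
      _ = 8 := by norm_num
  have m1 := mul_le_mul_of_nonneg_right i1
    (Real.exp_pos (-(l ^ 2 * V / 2) + 2 * E + ε * (1 - ε) * l ^ 2 * V)).le
  have m2 := mul_le_mul_of_nonneg_right i2
    (Real.exp_pos (-(l ^ 2 * V / 2) + 2 * E - ε * (1 + ε) * l ^ 2 * V)).le
  have m3 := mul_le_mul_of_nonneg_right i3 (Real.exp_pos (2 * E - κ * t)).le
  have m4 := mul_le_mul_of_nonneg_right i4 (Real.exp_pos (2 * E - κ * t)).le
  rw [← Real.exp_add] at m1 m2 m3 m4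
  have n1 : Real.exp (((1 - ε) * l) ^ 2 * V / 2 + s.card * ((1 - ε) * l * B) ^ 3
      + (-(l ^ 2 * V / 2) + 2 * E + ε * (1 - ε) * l ^ 2 * V))
      ≤ Real.exp (-(ε ^ 2 * (l ^ 2 * V) / 2) + 10 * E) := by
    refine Real.exp_le_exp.mpr ?_
    have : s.card * ((1 - ε) * l * B) ^ 3 = (1 - ε) ^ 3 * E := by rw [hE]; ring
    rw [this]
    nlinarith
  have n2 : Real.exp (((1 + ε) * l) ^ 2 * V / 2 + s.card * ((1 + ε) * l * B) ^ 3
      + (-(l ^ 2 * V / 2) + 2 * E - ε * (1 + ε) * l ^ 2 * V))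
      ≤ Real.exp (-(ε ^ 2 * (l ^ 2 * V) / 2) + 10 * E) := by
    refine Real.exp_le_exp.mpr ?_
    have : s.card * ((1 + ε) * l * B) ^ 3 = (1 + ε) ^ 3 * E := by rw [hE]; ring
    rw [this]
    nlinarith
  have n3 : Real.exp (2 * (l ^ 2 * (s.card * B) + κ ^ 2 * (N - s.card * B)) + (2 * E - κ * t))
      ≤ Real.exp (10 * E + 2 * (l ^ 2 * (s.card * B) + κ ^ 2 * (N - s.card * B)) - κ * t) := by
    refine Real.exp_le_exp.mpr ?_
    linarith
  have e10 : 10 * (s.card : ℝ) * (l * B) ^ 3 = 10 * E := by rw [hE]; ring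
  rw [e10]
  linarith

/-- Geometric ranges of block indices. -/
def stageSet (A i : ℕ) : Finset ℕ := Finset.Ico (A ^ i) (A ^ (i + 1))

lemma log_eq_of_mem_stageSet {A i j : ℕ} (hj : j ∈ stageSet A i) : Nat.log A j = i := by
  rw [stageSet, Finset.mem_Ico] at hj
  exact Nat.log_eq_of_pow_le_of_lt_pow hj.1 hj.2

lemma disjoint_stageSet {A i l : ℕ} (h : i ≠ l) : Disjoint (stageSet A i) (stageSet A l) := by
  rw [Finset.disjoint_left]
  intro j hj hj'
  exact h ((log_eq_of_mem_stageSet hj).symm.trans (log_eq_of_mem_stageSet hj'))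

lemma ae_frequently_goodSet {q : ℝ} {ν : ℕ → ℕ} (hq : 1 < q) (h : IsLacunary q ν)
    {g : ℕ} (hg : 0 < g) (hgap : GapCond q g) {A B : ℕ} (hB : 0 < B) {l κ t a : ℕ → ℝ} {ε : ℝ}
    (hε : 0 ≤ ε) (hε1 : ε ≤ 1) (ha : ∀ i, 0 ≤ a i)
    (hl0 : ∀ᶠ i in atTop, 0 ≤ l i) (hκ : ∀ᶠ i in atTop, 0 ≤ κ i)
    (hlB : ∀ᶠ i in atTop, 2 * (l i * B) ≤ 1) (hlg : ∀ᶠ i in atTop, 2 * g * l i ≤ 1)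
    (hκg : ∀ᶠ i in atTop, 2 * g * κ i ≤ 1)
    (hal : ∀ᶠ i in atTop, a i * Real.exp ((1 / 2 + ε) * (l i ^ 2 * ((stageSet A i).card * B / 2))
      + 10 * (stageSet A i).card * (l i * B) ^ 3) ≤ 1)
    (hbad : Tendsto (fun i =>
        2 * Real.exp (-(ε ^ 2 * (l i ^ 2 * ((stageSet A i).card * B / 2)) / 2)
          + 10 * (stageSet A i).card * (l i * B) ^ 3)
        + 2 * Real.exp (10 * (stageSet A i).card * (l i * B) ^ 3
          + 2 * (l i ^ 2 * ((stageSet A i).card * B)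
            + κ i ^ 2 * (((B + g) * A ^ (i + 1) : ℕ) - (stageSet A i).card * B)) - κ i * t i))
      atTop (nhds 0))
    (hsum : ¬ Summable a) :
    ∀ᵐ x ∂(volume.restrict (Set.Icc (0 : ℝ) 1)), ∃ᶠ i in atTop,
      x ∈ goodSet ν (B + g) B (stageSet A i) ((B + g) * A ^ (i + 1)) (l i) ε (t i) := by
  set D : ℕ → ℝ := fun i =>
        2 * Real.exp (-(ε ^ 2 * (l i ^ 2 * ((stageSet A i).card * B / 2)) / 2)
          + 10 * (stageSet A i).card * (l i * B) ^ 3)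
        + 2 * Real.exp (10 * (stageSet A i).card * (l i * B) ^ 3
          + 2 * (l i ^ 2 * ((stageSet A i).card * B)
            + κ i ^ 2 * (((B + g) * A ^ (i + 1) : ℕ) - (stageSet A i).card * B)) - κ i * t i)
    with hD
  obtain ⟨I, hI⟩ := eventually_atTop.mp (hl0.and (hκ.and (hlB.and (hlg.and (hκg.and hal)))))
  set G : ℕ → Set ℝ := fun i =>
    goodSet ν (B + g) B (stageSet A i) ((B + g) * A ^ (i + 1)) (l i) ε (t i) with hG
  have hGm : ∀ i, MeasurableSet (G i) := fun i => measurableSet_goodSet _ _ _ _ _ _ _ _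
  set lam : ℕ → ℝ := fun j => l (Nat.log A j) with hlam
  set H : ℕ → ℝ → ℝ := fun i => tiltDensity ν (B + g) B lam (stageSet A i) with hH
  have hlam2 : ∀ i, ∀ j ∈ stageSet A i, lam j = l i := fun i j hj => by
    rw [hlam]; simp only [log_eq_of_mem_stageSet hj]
  have hHc : ∀ i, Continuous (H i) := fun i => tiltDensity_continuous _ _ _ _ _
  have hH0 : ∀ i x, 0 ≤ H i x := fun i x => tiltDensity_nonneg _ _ _ _ _ x
  have toInt : ∀ f : ℝ → ℝ, ∫ x, f x ∂(volume.restrict (Set.Icc (0 : ℝ) 1))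
      = ∫ x in (0 : ℝ)..1, f x := fun f => by
    rw [intervalIntegral.integral_of_le zero_le_one, integral_Icc_eq_integral_Ioc]
  have hHi : ∀ f : ℝ → ℝ, Continuous f →
      Integrable f (volume.restrict (Set.Icc (0 : ℝ) 1)) := fun f hf =>
    hf.integrableOn_Icc
  have : IsProbabilityMeasure (volume.restrict (Set.Icc (0 : ℝ) 1)) := ⟨by simp⟩
  set f : ℕ → ℝ → ℝ := fun i => (G (i + I)).indicator (fun x => a (i + I) * H (i + I) x) with hf
  have hf0 : ∀ i x, 0 ≤ f i x := fun i x =>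
    Set.indicator_nonneg (fun y _ => mul_nonneg (ha _) (hH0 _ y)) x
  have hfle : ∀ i x, f i x ≤ a (i + I) * H (i + I) x := fun i x =>
    Set.indicator_le_self' (fun y _ => mul_nonneg (ha _) (hH0 _ y)) x
  have hfint : ∀ i, Integrable (f i) (volume.restrict (Set.Icc (0 : ℝ) 1)) := fun i =>
    (hHi _ (continuous_const.mul (hHc _))).indicator (hGm _)
  have hH1 : ∀ i, ∫ x, H i x ∂(volume.restrict (Set.Icc (0 : ℝ) 1)) = 1 := fun i => by
    rw [toInt]; exact integral_tiltDensity hq h hg hgap B lam _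
  have main := ae_frequently_ne_zero (μ := volume.restrict (Set.Icc (0 : ℝ) 1)) (f := f)
    (a := fun i => a (i + I)) (δ := fun i => D (i + I)) (fun i => ?_) hf0 (fun i x => ?_)
    (fun i => ?_) (fun i => ?_) (fun i j hij => ?_) ?_ ?_
  · filter_upwards [main] with x hx
    rw [frequently_atTop] at hx ⊢
    intro i₀
    obtain ⟨i, hi, hix⟩ := hx i₀
    exact ⟨i + I, by omega, Set.mem_of_indicator_ne_zero hix⟩
  · exact ((continuous_const.mul (hHc _)).measurable).indicator (hGm _)
  · by_cases hx : x ∈ G (i + I)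
    · obtain ⟨h1, h2, h3, h4, h5, h6⟩ := hI (i + I) (by omega)
      rw [hf]
      simp only [Set.indicator_of_mem hx]
      refine le_trans (mul_le_mul_of_nonneg_left ?_ (ha _)) h6
      have hB0 : 0 ≤ l (i + I) * B := mul_nonneg h1 (Nat.cast_nonneg _)
      exact tiltDensity_le_of_mem_goodSet hB (hlam2 _) h1 (by linarith) hx
    · rw [hf]
      simp only [Set.indicator_of_notMem hx]
      exact zero_le_one
  · refine (integral_mono (hfint i) ((hHi _ (hHc _)).const_mul _) (hfle i)).trans ?_
    rw [integral_const_mul, hH1, mul_one]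
  · obtain ⟨h1, h2, h3, h4, h5, h6⟩ := hI (i + I) (by omega)
    have hb := integral_tiltDensity_compl_goodSet_le hq h hg hgap hB (hlam2 (i + I)) h1 hε hε1 h2
      h3 h4 h5 (N := (B + g) * A ^ (i + I + 1)) (t := t (i + I)) (fun j hj => by
        have := (Finset.mem_Ico.mp hj).2
        calc j * (B + g) + B ≤ (j + 1) * (B + g) := by rw [add_mul]; omega
          _ ≤ A ^ (i + I + 1) * (B + g) := Nat.mul_le_mul_right _ this
          _ = _ := mul_comm _ _)
    rw [← toInt] at hb
    have e : ∀ x, f i x = a (i + I) * H (i + I) x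
        - a (i + I) * (G (i + I))ᶜ.indicator (H (i + I)) x := by
      intro x
      by_cases hx : x ∈ G (i + I)
      · rw [hf]; simp only [Set.indicator_of_mem hx]
        rw [Set.indicator_of_notMem (by simpa using hx)]; ring
      · rw [hf]; simp only [Set.indicator_of_notMem hx]
        rw [Set.indicator_of_mem (by simpa using hx)]; ring
    simp_rw [e]
    rw [integral_sub ((hHi _ (hHc _)).const_mul _)
      (((hHi _ (hHc _)).indicator (hGm _).compl).const_mul _), integral_const_mul,
      integral_const_mul, hH1, ← mul_sub]
    exact mul_le_mul_of_nonneg_left (sub_le_sub_left hb _) (ha _)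
  · calc ∫ x, f i x * f j x ∂(volume.restrict (Set.Icc (0 : ℝ) 1))
        ≤ ∫ x, a (i + I) * a (j + I) * tiltDensity ν (B + g) B lam
            (stageSet A (i + I) ∪ stageSet A (j + I)) x ∂(volume.restrict (Set.Icc (0 : ℝ) 1)) := by
          refine integral_mono_of_nonneg (ae_of_all _ fun x => mul_nonneg (hf0 i x) (hf0 j x))
            (hHi _ (continuous_const.mul (tiltDensity_continuous _ _ _ _ _)))
            (ae_of_all _ fun x => ?_)
          simp only []
          rw [tiltDensity_union ν _ B lam (disjoint_stageSet (by omega))]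
          calc f i x * f j x ≤ (a (i + I) * H (i + I) x) * (a (j + I) * H (j + I) x) :=
                mul_le_mul (hfle i x) (hfle j x) (hf0 j x) (mul_nonneg (ha _) (hH0 _ x))
            _ = _ := by ring
      _ = _ := by
          rw [integral_const_mul, toInt, integral_tiltDensity hq h hg hgap, mul_one]
  · exact (tendsto_add_atTop_iff_nat I).mpr hbad
  · rwa [summable_nat_add_iff]

lemma card_stageSet {A : ℕ} (hA : 0 < A) (i : ℕ) :
    ((stageSet A i).card : ℝ) = (A : ℝ) ^ i * (A - 1) := by
  rw [stageSet, Nat.card_Ico, Nat.cast_sub (Nat.pow_le_pow_right hA (Nat.le_succ i))]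
  push_cast; rw [pow_succ]; ring

lemma tendsto_loglog_pow_div (n : ℕ) :
    Tendsto (fun x : ℝ => Real.log (Real.log x) ^ n / x) atTop (nhds 0) := by
  have h1 : Tendsto (fun x : ℝ => Real.log x ^ n / x) atTop (nhds 0) :=
    (isLittleO_pow_log_id_atTop (n := n)).tendsto_div_nhds_zero
  refine tendsto_of_tendsto_of_tendsto_of_le_of_le' tendsto_const_nhds h1 ?_ ?_
  · filter_upwards [eventually_gt_atTop 0,
      (tendsto_log_atTop.comp tendsto_log_atTop).eventually_ge_atTop 0] with x hx hx2
    exact div_nonneg (pow_nonneg hx2 _) hx.le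
  · filter_upwards [eventually_gt_atTop 0, tendsto_log_atTop.eventually_ge_atTop 1,
      (tendsto_log_atTop.comp tendsto_log_atTop).eventually_ge_atTop 0] with x hx hx1 hx2
    have : Real.log (Real.log x) ≤ Real.log x := (Real.log_le_self (by linarith))
    have hx3 : 0 ≤ Real.log (Real.log x) := hx2
    gcongr

set_option maxHeartbeats 1000000 in
lemma ae_frequently_cos_sum_ge_aux {q : ℝ} {ν : ℕ → ℕ} (hq : 1 < q) (h : IsLacunary q ν) {ε : ℝ}
    (hε : 0 < ε) (hε1 : ε ≤ 1 / 5) :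
    ∀ᵐ x ∂(volume.restrict (Set.Icc (0 : ℝ) 1)), ∃ᶠ N : ℕ in atTop,
      (1 - 5 * ε) * √(N * Real.log (Real.log N)) ≤ ∑ k ∈ Finset.range N, cosFn (ν k) x := by
  obtain ⟨g, hg, hgap⟩ := exists_gapCond hq
  set δ : ℝ := ε ^ 2 / 200 with hδ
  have hδ0 : 0 < δ := by positivity
  have hδε : δ ≤ ε := by nlinarith
  obtain ⟨A, hA⟩ := exists_nat_ge (2 / δ)
  obtain ⟨B, hB'⟩ := exists_nat_ge (2 * g / δ)
  have hg1 : (1 : ℝ) ≤ g := by exact_mod_cast hg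
  have hA2 : 2 ≤ δ * A := by rwa [div_le_iff₀' hδ0] at hA
  have hB2 : 2 * g ≤ δ * B := by rwa [div_le_iff₀' hδ0] at hB'
  have hA3 : (2 : ℝ) ≤ A := by nlinarith
  have hB3 : (2 : ℝ) ≤ B := by nlinarith
  have hAn : 2 ≤ A := by exact_mod_cast hA3
  have hBn : 2 ≤ B := by exact_mod_cast hB3
  set θ : ℝ := 1 / (1 + 2 * ε) with hθ
  have hθ0 : 0 < θ := by positivity
  have hθ1 : θ ≤ 1 := by rw [hθ, div_le_one (by positivity)]; linarith
  have hθe : θ * (1 + 2 * ε) = 1 := by rw [hθ]; field_simp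
  set M : ℕ → ℝ := fun i => (stageSet A i).card * B with hM
  set N : ℕ → ℕ := fun i => (B + g) * A ^ (i + 1) with hN
  set L : ℕ → ℝ := fun i => Real.log (Real.log (N i)) with hL
  have hcard : ∀ i, ((stageSet A i).card : ℝ) = (A : ℝ) ^ i * (A - 1) := card_stageSet (by omega)
  have hNr : ∀ i, (N i : ℝ) = (B + g) * (A : ℝ) ^ (i + 1) := fun i => by rw [hN]; push_cast; ring
  have hN0 : ∀ i, (0 : ℝ) < N i := fun i => by rw [hNr]; positivity
  have hMN : ∀ i, M i ≤ N i := fun i => by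
    rw [hM, hNr]; simp only [hcard]
    have : (0 : ℝ) ≤ (A : ℝ) ^ i := by positivity
    calc (A : ℝ) ^ i * (A - 1) * B ≤ A ^ i * A * (B + g) := by gcongr <;> linarith
      _ = _ := by ring
  have hMN2 : ∀ i, (1 - δ) * N i ≤ M i := fun i => by
    rw [hM, hNr]; simp only [hcard]
    have h1 : (1 - δ) * ((B + g) * A) ≤ (A - 1) * B := by nlinarith
    calc (1 - δ) * ((B + g) * (A : ℝ) ^ (i + 1)) = A ^ i * ((1 - δ) * ((B + g) * A)) := by ring
      _ ≤ A ^ i * ((A - 1) * B) := by gcongr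
      _ = _ := by ring
  have hδ1 : δ ≤ 1 / 5 := hδε.trans hε1
  have hM0 : ∀ i, 0 < M i := fun i => lt_of_lt_of_le (mul_pos (by linarith) (hN0 i)) (hMN2 i)
  have hNt : Tendsto (fun i => (N i : ℝ)) atTop atTop := by
    simp_rw [hNr]
    refine Tendsto.const_mul_atTop (by positivity) ?_
    exact (tendsto_pow_atTop_atTop_of_one_lt (by linarith)).comp (tendsto_add_atTop_nat 1)
  have hLt : Tendsto L atTop atTop := (tendsto_log_atTop.comp tendsto_log_atTop).comp hNt
  have hLN : ∀ n : ℕ, Tendsto (fun i => L i ^ n / N i) atTop (nhds 0) := fun n =>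
    (tendsto_loglog_pow_div n).comp hNt
  set l : ℕ → ℝ := fun i => √(4 * θ * L i / M i) with hl
  set κ : ℕ → ℝ := fun i => 10 / ε * √(L i / N i) with hκ
  set t : ℕ → ℝ := fun i => ε * √(N i * L i) with ht
  set E : ℕ → ℝ := fun i => 10 * (stageSet A i).card * (l i * B) ^ 3 with hE
  have hl2 : ∀ᶠ i in atTop, l i ^ 2 * M i = 4 * θ * L i := by
    filter_upwards [hLt.eventually_ge_atTop 0] with i hi
    rw [hl]; simp only
    rw [Real.sq_sqrt (div_nonneg (by positivity) (hM0 i).le), div_mul_cancel₀ _ (hM0 i).ne']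
  have hl0 : ∀ i, 0 ≤ l i := fun i => Real.sqrt_nonneg _
  have hlle : ∀ᶠ i in atTop, l i ≤ √(8 * (L i ^ 1 / N i)) := by
    filter_upwards [hLt.eventually_ge_atTop 0] with i hi
    refine Real.sqrt_le_sqrt ?_
    rw [pow_one, ← mul_div_assoc 8, div_le_div_iff₀ (hM0 i) (hN0 i)]
    have h1 : (N i : ℝ) ≤ 2 * M i := by
      have := hMN2 i
      have := hN0 i
      nlinarith
    calc 4 * θ * L i * N i ≤ 4 * 1 * L i * (2 * M i) := by gcongr
      _ = _ := by ring
  have hsq0 : ∀ n : ℕ, Tendsto (fun i => √(8 * (L i ^ n / N i))) atTop (nhds 0) := fun n => by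
    have := ((hLN n).const_mul 8).sqrt
    simpa using this
  have hlt : Tendsto l atTop (nhds 0) :=
    squeeze_zero' (Eventually.of_forall hl0) hlle (hsq0 1)
  have hκt : Tendsto κ atTop (nhds 0) := by
    have := ((hLN 1).sqrt).const_mul (10 / ε)
    simp only [pow_one, Real.sqrt_zero, mul_zero] at this
    exact this
  have hEeq : ∀ᶠ i in atTop, E i = 40 * B ^ 2 * θ * (L i * l i) := by
    filter_upwards [hl2] with i hi
    have : E i = 10 * B ^ 2 * (l i ^ 2 * M i) * l i := by rw [hE, hM]; ring
    rw [this, hi]; ring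
  have hEt : Tendsto E atTop (nhds 0) := by
    refine Tendsto.congr' (hEeq.mono fun i hi => hi.symm) ?_
    have : Tendsto (fun i => L i * l i) atTop (nhds 0) := by
      refine squeeze_zero' (g := fun i => √(8 * (L i ^ 3 / N i))) ?_ ?_ (hsq0 3)
      · filter_upwards [hLt.eventually_ge_atTop 0] with i hi
        exact mul_nonneg hi (hl0 i)
      · filter_upwards [hLt.eventually_ge_atTop 0, hlle] with i hi hi2
        calc L i * l i ≤ L i * √(8 * (L i ^ 1 / N i)) := by gcongr
          _ = √(L i ^ 2 * (8 * (L i ^ 1 / N i))) := by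
            rw [Real.sqrt_mul (sq_nonneg _), Real.sqrt_sq hi]
          _ = _ := by congr 1; ring
    simpa using this.const_mul (40 * B ^ 2 * θ)
  set a : ℕ → ℝ := fun i => Real.exp (-1 - L i) with ha
  have main := ae_frequently_goodSet hq h hg hgap (A := A) (B := B) (l := l) (κ := κ) (t := t)
    (a := a) (by omega) hε.le (by linarith) (fun i => (Real.exp_pos _).le)
    (Eventually.of_forall hl0)
    (Eventually.of_forall fun i => mul_nonneg (by positivity) (Real.sqrt_nonneg _))
    ?_ ?_ ?_ ?_ ?_ ?_
  · have hNtn : Tendsto N atTop atTop := tendsto_natCast_atTop_iff.mp hNt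
    filter_upwards [main] with x hx
    refine hNtn.frequently ((hx.and_eventually
      (hl2.and (hLt.eventually_ge_atTop 0))).mono fun i hi => ?_)
    obtain ⟨⟨⟨hi1, -⟩, hi3⟩, hi4, hi5⟩ := hi
    have e : ∑ k ∈ Finset.range (N i), cosFn (ν k) x
        = bigSum ν (B + g) B (stageSet A i) x
          + restSum ν (B + g) B (stageSet A i) (N i) x := by rw [restSum]; ring
    rw [e]
    have h1 := (abs_le.mp hi3).1
    set r := √(N i * L i) with hr
    have hr0 : 0 ≤ r := Real.sqrt_nonneg _
    have hr2 : r ^ 2 = N i * L i := Real.sq_sqrt (mul_nonneg (hN0 i).le hi5)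
    have hc : (1 - 2 * ε) * (1 - ε) * r ≤ l i * (M i / 2) := by
      have hnn : 0 ≤ l i * (M i / 2) := mul_nonneg (hl0 i) (by have := hM0 i; linarith)
      refine le_of_sq_le_sq ?_ hnn
      have e2 : (l i * (M i / 2)) ^ 2 = θ * (L i * M i) := by
        calc (l i * (M i / 2)) ^ 2 = (l i ^ 2 * M i) * M i / 4 := by ring
          _ = _ := by rw [hi4]; ring
      rw [e2, mul_pow, hr2]
      have hθ2 : 1 - 2 * ε ≤ θ := by nlinarith
      have hc0 : 0 ≤ (1 - 2 * ε) * (1 - ε) := mul_nonneg (by linarith) (by linarith)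
      have hc1 : (1 - 2 * ε) * (1 - ε) ≤ 1 := by nlinarith
      calc ((1 - 2 * ε) * (1 - ε)) ^ 2 * (N i * L i)
          ≤ ((1 - 2 * ε) * (1 - ε)) * (N i * L i) := by
            refine mul_le_mul_of_nonneg_right ?_ (mul_nonneg (hN0 i).le hi5)
            rw [sq]; exact mul_le_of_le_one_left hc0 hc1
        _ ≤ (θ * (1 - δ)) * (N i * L i) := by
            refine mul_le_mul_of_nonneg_right ?_ (mul_nonneg (hN0 i).le hi5)
            exact mul_le_mul hθ2 (by linarith) (by linarith) hθ0.le
        _ = θ * (L i * ((1 - δ) * N i)) := by ring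
        _ ≤ _ := by
            have := hMN2 i
            gcongr
    have h2 : (1 - ε) * ((1 - 2 * ε) * (1 - ε) * r) ≤ (1 - ε) * (l i * (M i / 2)) :=
      mul_le_mul_of_nonneg_left hc (by linarith)
    have h3 : (1 - 5 * ε) * r ≤ (1 - ε) * ((1 - 2 * ε) * (1 - ε) * r) - ε * r := by
      have : 1 - 5 * ε ≤ (1 - ε) * ((1 - 2 * ε) * (1 - ε)) - ε := by linarith [mul_nonneg (sq_nonneg ε) (show 0 ≤ 5 - 2 * ε by linarith)]
      calc (1 - 5 * ε) * r ≤ ((1 - ε) * ((1 - 2 * ε) * (1 - ε)) - ε) * r := by gcongr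
        _ = _ := by ring
    have h4 : t i = ε * r := rfl
    linarith
  · have := (hlt.mul_const (B : ℝ)).const_mul 2
    rw [zero_mul, mul_zero] at this
    exact this.eventually_le_const zero_lt_one
  · have := hlt.const_mul (2 * (g : ℝ))
    rw [mul_zero] at this
    exact this.eventually_le_const zero_lt_one
  · have := hκt.const_mul (2 * (g : ℝ))
    rw [mul_zero] at this
    exact this.eventually_le_const zero_lt_one
  · filter_upwards [hl2, hEt.eventually_le_const zero_lt_one] with i hi hi2
    rw [ha]; simp only
    rw [← Real.exp_add, Real.exp_le_one_iff]
    have e : (1 / 2 + ε) * (l i ^ 2 * ((stageSet A i).card * B / 2))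
        = θ * (1 + 2 * ε) * L i := by
      calc _ = (1 / 2 + ε) * (l i ^ 2 * M i) / 2 := by rw [hM]; ring
        _ = _ := by rw [hi]; ring
    rw [e, hθe]
    change -1 - L i + (1 * L i + E i) ≤ 0
    linarith
  · have hb1 : Tendsto (fun i => -(ε ^ 2 * θ) * L i + E i) atTop atBot :=
      (hLt.const_mul_atTop_of_neg (by nlinarith [mul_pos (pow_pos hε 2) hθ0])).atBot_add hEt
    have hb2 : Tendsto (fun i => -1 * L i + E i) atTop atBot :=
      (hLt.const_mul_atTop_of_neg (by norm_num)).atBot_add hEt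
    have hb := ((tendsto_exp_atBot.comp hb1).const_mul 2).add
      ((tendsto_exp_atBot.comp hb2).const_mul 2)
    simp only [mul_zero, add_zero] at hb
    refine squeeze_zero' (Eventually.of_forall fun i => by positivity) ?_ hb
    filter_upwards [hl2, hLt.eventually_ge_atTop 0] with i hi hi0
    change 2 * Real.exp (-(ε ^ 2 * (l i ^ 2 * (M i / 2)) / 2) + E i)
      + 2 * Real.exp (E i + 2 * (l i ^ 2 * M i + κ i ^ 2 * (N i - M i)) - κ i * t i) ≤ _
    have e1 : κ i * t i = 10 * L i := by
      rw [hκ, ht]; simp only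
      calc 10 / ε * √(L i / N i) * (ε * √(N i * L i))
          = 10 * (√(L i / N i) * √(N i * L i)) := by field_simp
        _ = 10 * √(L i ^ 2) := by
          rw [← Real.sqrt_mul (div_nonneg hi0 (hN0 i).le)]
          congr 2
          have := (hN0 i).ne'
          field_simp
        _ = _ := by rw [Real.sqrt_sq hi0]
    have e2 : κ i ^ 2 * (N i - M i) ≤ L i / 2 := by
      have e3 : κ i ^ 2 = 100 / ε ^ 2 * (L i / N i) := by
        rw [hκ]; simp only
        rw [mul_pow, Real.sq_sqrt (div_nonneg hi0 (hN0 i).le)]; ring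
      have e4 : (N i : ℝ) - M i ≤ δ * N i := by linarith [hMN2 i]
      calc κ i ^ 2 * (N i - M i) ≤ κ i ^ 2 * (δ * N i) := by gcongr
        _ = L i / 2 := by
          have := (hN0 i).ne'
          rw [e3, hδ]; field_simp; ring
    refine add_le_add (mul_le_mul_of_nonneg_left (Real.exp_le_exp.mpr ?_) zero_le_two)
      (mul_le_mul_of_nonneg_left (Real.exp_le_exp.mpr ?_) zero_le_two)
    · have : l i ^ 2 * (M i / 2) = 2 * θ * L i := by linarith
      rw [this]
      exact le_of_eq (by ring)
    · rw [e1, hi]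
      have : θ * L i ≤ 1 * L i := by gcongr
      linarith
  · intro hsum
    refine Real.not_summable_one_div_natCast ((summable_nat_add_iff 1).mp ?_)
    set C : ℝ := Real.log (B + g) + Real.log A with hC
    have hlogA : 0 ≤ Real.log A := Real.log_nonneg (by linarith)
    have hlogB : 0 ≤ Real.log ((B : ℝ) + g) := Real.log_nonneg (by linarith)
    refine Summable.of_nonneg_of_le (fun i => by positivity) (fun i => ?_)
      (hsum.mul_left (C * Real.exp 1))
    have hlogN : Real.log (N i) = Real.log (B + g) + (i + 1) * Real.log A := by
      rw [hNr, Real.log_mul (by positivity) (by positivity), Real.log_pow]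
      push_cast; ring
    have hAlog : 0 < Real.log A := Real.log_pos (by linarith)
    have hpos : 0 < Real.log (N i) := by rw [hlogN]; positivity
    have hle : Real.log (N i) ≤ C * ((i : ℝ) + 1) := by
      rw [hlogN, hC]
      have : (0 : ℝ) ≤ i := Nat.cast_nonneg i
      nlinarith
    have : C * Real.exp 1 * a i = C / Real.log (N i) := by
      rw [ha]; simp only
      rw [Real.exp_sub, Real.exp_neg, hL]; simp only
      rw [Real.exp_log hpos]
      have := (Real.exp_pos 1).ne'
      field_simp
    rw [this, div_le_div_iff₀ (by positivity) hpos]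
    push_cast
    linarith

lemma ae_frequently_cos_sum_ge {q : ℝ} {ν : ℕ → ℕ} (hq : 1 < q) (h : IsLacunary q ν) :
    ∀ᵐ x ∂(volume.restrict (Set.Icc (0 : ℝ) 1)), ∀ η : ℝ, 0 < η → ∃ᶠ N : ℕ in atTop,
      (1 - η) * √(N * Real.log (Real.log N)) ≤ ∑ k ∈ Finset.range N, cosFn (ν k) x := by
  have : ∀ᵐ x ∂(volume.restrict (Set.Icc (0 : ℝ) 1)), ∀ n : ℕ, ∃ᶠ N : ℕ in atTop,
      (1 - 1 / ((n : ℝ) + 1)) * √(N * Real.log (Real.log N))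
        ≤ ∑ k ∈ Finset.range N, cosFn (ν k) x := by
    refine ae_all_iff.mpr fun n => ?_
    have := ae_frequently_cos_sum_ge_aux hq h (ε := 1 / (5 * ((n : ℝ) + 1))) (by positivity)
      (by
        refine one_div_le_one_div_of_le (by norm_num) ?_
        have : (0 : ℝ) ≤ n := Nat.cast_nonneg n
        linarith)
    have e : 5 * (1 / (5 * ((n : ℝ) + 1))) = 1 / ((n : ℝ) + 1) := by
      have : (n : ℝ) + 1 ≠ 0 := by positivity
      field_simp
    rwa [e] at this
  filter_upwards [this] with x hx η hη
  obtain ⟨n, hn⟩ := exists_nat_one_div_lt hη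
  refine (hx n).mono fun N hN => le_trans ?_ hN
  gcongr

lemma abs_indicator_sum_div_sub_le (N : ℕ) (x : ℕ → ℝ) (a : Set.Icc (0 : ℝ) 1) :
    |(∑ k ∈ Finset.Icc 1 N,
        (Set.Ico (0 : ℝ) (a : ℝ)).indicator (fun _ => (1 : ℝ)) (x k)) / N - (a : ℝ)| ≤ 1 := by
  have h0 : 0 ≤ ∑ k ∈ Finset.Icc 1 N,
      (Set.Ico (0 : ℝ) (a : ℝ)).indicator (fun _ => (1 : ℝ)) (x k) :=
    Finset.sum_nonneg fun k _ => Set.indicator_nonneg (fun _ _ => zero_le_one) _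
  have h1 : ∑ k ∈ Finset.Icc 1 N,
      (Set.Ico (0 : ℝ) (a : ℝ)).indicator (fun _ => (1 : ℝ)) (x k) ≤ N := by
    calc _ ≤ ∑ k ∈ Finset.Icc 1 N, (1 : ℝ) :=
          Finset.sum_le_sum fun k _ => Set.indicator_le_self' (fun _ _ => zero_le_one) _
      _ = N := by simp
  have h2 := div_nonneg h0 (Nat.cast_nonneg (α := ℝ) N)
  have h3 := div_le_one_of_le₀ h1 (Nat.cast_nonneg (α := ℝ) N)
  rw [abs_le]
  constructor <;> linarith [a.2.1, a.2.2]

lemma bddAbove_discrepancy (N : ℕ) (x : ℕ → ℝ) :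
    BddAbove (Set.range fun a : Set.Icc (0 : ℝ) 1 => |(∑ k ∈ Finset.Icc 1 N,
        (Set.Ico (0 : ℝ) (a : ℝ)).indicator (fun _ => (1 : ℝ)) (x k)) / N - (a : ℝ)|) :=
  ⟨1, by rintro _ ⟨a, rfl⟩; exact abs_indicator_sum_div_sub_le N x a⟩

lemma starDiscrepancy_nonneg (N : ℕ) (x : ℕ → ℝ) : 0 ≤ starDiscrepancy N x :=
  Real.iSup_nonneg fun _ => abs_nonneg _

lemma abs_sum_sub_le_mul_starDiscrepancy (N : ℕ) (x : ℕ → ℝ) {a : ℝ} (ha : a ∈ Set.Icc (0 : ℝ) 1) :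
    |(∑ k ∈ Finset.Icc 1 N, (Set.Ico (0 : ℝ) a).indicator (fun _ => (1 : ℝ)) (x k)) - N * a|
      ≤ N * starDiscrepancy N x := by
  rcases Nat.eq_zero_or_pos N with rfl | hN
  · simp
  · have hN' : (0 : ℝ) < N := by exact_mod_cast hN
    have := le_ciSup (bddAbove_discrepancy N x) ⟨a, ha⟩
    have h2 : (N : ℝ) * |(∑ k ∈ Finset.Icc 1 N,
        (Set.Ico (0 : ℝ) a).indicator (fun _ => (1 : ℝ)) (x k)) / N - a|
        ≤ N * starDiscrepancy N x := mul_le_mul_of_nonneg_left this hN'.le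
    refine le_trans (le_of_eq ?_) h2
    rw [← abs_of_pos hN', ← abs_mul, abs_of_pos hN']
    congr 1
    field_simp

lemma integral_sin_two_pi (u v : ℝ) :
    ∫ a in u..v, 2 * π * Real.sin (2 * π * a) = Real.cos (2 * π * u) - Real.cos (2 * π * v) := by
  have hd : ∀ a : ℝ, HasDerivAt (fun a => -Real.cos (2 * π * a))
      (2 * π * Real.sin (2 * π * a)) a := fun a => by
    have := (((hasDerivAt_id a).const_mul (2 * π)).cos).neg
    exact this.congr_deriv (by simp only [id]; ring)
  rw [intervalIntegral.integral_eq_sub_of_hasDerivAt (fun a _ => hd a)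
    (Continuous.intervalIntegrable (by fun_prop) _ _)]
  ring

lemma integral_mul_sin_two_pi : ∫ a in (0 : ℝ)..1, 2 * π * Real.sin (2 * π * a) * a = -1 := by
  have hd : ∀ a : ℝ, HasDerivAt (fun a => -(Real.cos (2 * π * a) * a)
      + Real.sin (2 * π * a) / (2 * π)) (2 * π * Real.sin (2 * π * a) * a) a := fun a => by
    have h1 := (((hasDerivAt_id a).const_mul (2 * π)).cos.mul (hasDerivAt_id a)).neg
    have h2 := (((hasDerivAt_id a).const_mul (2 * π)).sin).div_const (2 * π)
    refine (h1.add h2).congr_deriv ?_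
    have := Real.pi_ne_zero
    simp only [id]
    field_simp
    ring
  rw [intervalIntegral.integral_eq_sub_of_hasDerivAt (fun a _ => hd a)
    (Continuous.intervalIntegrable (by fun_prop) _ _)]
  simp

lemma integral_sin_mul_indicator {y : ℝ} (hy : y ∈ Set.Ico (0 : ℝ) 1) :
    ∫ a in (0 : ℝ)..1, 2 * π * Real.sin (2 * π * a)
      * (Set.Ico (0 : ℝ) a).indicator (fun _ => (1 : ℝ)) y = Real.cos (2 * π * y) - 1 := by
  have e : ∀ a : ℝ, 2 * π * Real.sin (2 * π * a) * (Set.Ico (0 : ℝ) a).indicator (fun _ => (1 : ℝ)) y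
      = (Set.Ioi y).indicator (fun a => 2 * π * Real.sin (2 * π * a)) a := fun a => by
    by_cases ha : y < a
    · rw [Set.indicator_of_mem (show y ∈ Set.Ico 0 a from ⟨hy.1, ha⟩),
        Set.indicator_of_mem (show a ∈ Set.Ioi y from ha), mul_one]
    · rw [Set.indicator_of_notMem (fun h : y ∈ Set.Ico 0 a => ha h.2),
        Set.indicator_of_notMem (show a ∉ Set.Ioi y from ha), mul_zero]
  simp_rw [e]
  rw [intervalIntegral.integral_of_le zero_le_one, setIntegral_indicator measurableSet_Ioi,
    Set.Ioc_inter_Ioi, max_eq_right hy.1, ← intervalIntegral.integral_of_le hy.2.le,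
    integral_sin_two_pi, mul_one, Real.cos_two_pi]

/-- Koksma's inequality for the function `cos (2 π y)`. -/
lemma sum_cos_le_mul_starDiscrepancy (N : ℕ) {x : ℕ → ℝ} (hx : ∀ k, x k ∈ Set.Ico (0 : ℝ) 1) :
    ∑ k ∈ Finset.Icc 1 N, Real.cos (2 * π * x k) ≤ 4 * (N * starDiscrepancy N x) := by
  set D := (N : ℝ) * starDiscrepancy N x
  set F : ℝ → ℝ := fun a =>
    (∑ k ∈ Finset.Icc 1 N, (Set.Ico (0 : ℝ) a).indicator (fun _ => (1 : ℝ)) (x k)) - N * a with hF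
  have hFle : ∀ a ∈ Set.Icc (0 : ℝ) 1, |F a| ≤ D := fun a ha =>
    abs_sum_sub_le_mul_starDiscrepancy N x ha
  have hind : ∀ (k : ℕ) (u v : ℝ), IntervalIntegrable (fun a => 2 * π * Real.sin (2 * π * a)
      * (Set.Ico (0 : ℝ) a).indicator (fun _ => (1 : ℝ)) (x k)) volume u v := by
    intro k u v
    have hc : Continuous fun a => 2 * π * Real.sin (2 * π * a) := by fun_prop
    have hmono : Monotone fun a => (Set.Ico (0 : ℝ) a).indicator (fun _ => (1 : ℝ)) (x k) := by
      intro a b hab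
      exact Set.indicator_le_indicator_of_subset (Set.Ico_subset_Ico_right hab)
        (fun _ => zero_le_one) _
    exact (hmono.intervalIntegrable).continuousOn_mul hc.continuousOn
  have hFi : ∀ u v : ℝ, IntervalIntegrable (fun a => 2 * π * Real.sin (2 * π * a) * F a)
      volume u v := by
    intro u v
    have e : (fun a => 2 * π * Real.sin (2 * π * a) * F a) = fun a =>
        (∑ k ∈ Finset.Icc 1 N, 2 * π * Real.sin (2 * π * a)
          * (Set.Ico (0 : ℝ) a).indicator (fun _ => (1 : ℝ)) (x k))
        - 2 * π * Real.sin (2 * π * a) * a * N := by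
      funext a; rw [hF]; simp only; rw [mul_sub, Finset.mul_sum]; ring
    rw [e]
    refine IntervalIntegrable.sub ?_ (Continuous.intervalIntegrable (by fun_prop) _ _)
    have := IntervalIntegrable.sum (Finset.Icc 1 N) (f := fun k a => 2 * π * Real.sin (2 * π * a)
      * (Set.Ico (0 : ℝ) a).indicator (fun _ => (1 : ℝ)) (x k)) (fun k _ => hind k u v)
    refine this.congr ?_
    intro a _
    simp
  have e : ∑ k ∈ Finset.Icc 1 N, Real.cos (2 * π * x k)
      = ∫ a in (0 : ℝ)..1, 2 * π * Real.sin (2 * π * a) * F a := by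
    have e1 : ∀ a, 2 * π * Real.sin (2 * π * a) * F a =
        (∑ k ∈ Finset.Icc 1 N, 2 * π * Real.sin (2 * π * a)
          * (Set.Ico (0 : ℝ) a).indicator (fun _ => (1 : ℝ)) (x k))
        - 2 * π * Real.sin (2 * π * a) * a * N := by
      intro a; rw [hF]; simp only; rw [mul_sub, Finset.mul_sum]; ring
    simp_rw [e1]
    rw [intervalIntegral.integral_sub, intervalIntegral.integral_finsetSum (fun k _ => hind k 0 1),
      intervalIntegral.integral_mul_const, integral_mul_sin_two_pi]
    · simp_rw [fun k => integral_sin_mul_indicator (hx k)]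
      simp
    · have := IntervalIntegrable.sum (Finset.Icc 1 N) (f := fun k a => 2 * π * Real.sin (2 * π * a)
        * (Set.Ico (0 : ℝ) a).indicator (fun _ => (1 : ℝ)) (x k)) (fun k _ => hind k 0 1)
      refine this.congr ?_
      intro a _
      simp
    · exact Continuous.intervalIntegrable (by fun_prop) _ _
  rw [e, ← intervalIntegral.integral_add_adjacent_intervals (hFi 0 (1 / 2)) (hFi (1 / 2) 1)]
  have hpi := Real.pi_pos
  have b1 : ∫ a in (0 : ℝ)..1 / 2, 2 * π * Real.sin (2 * π * a) * F a ≤ 2 * D := by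
    calc _ ≤ ∫ a in (0 : ℝ)..1 / 2, 2 * π * Real.sin (2 * π * a) * D := by
          refine intervalIntegral.integral_mono_on (by norm_num) (hFi _ _)
            (Continuous.intervalIntegrable (by fun_prop) _ _) fun a ha => ?_
          have hs : 0 ≤ Real.sin (2 * π * a) :=
            Real.sin_nonneg_of_nonneg_of_le_pi (mul_nonneg (by positivity) ha.1)
              (by nlinarith [ha.2])
          have := (abs_le.mp (hFle a ⟨ha.1, by linarith [ha.2]⟩)).2
          gcongr
      _ = 2 * D := by
          rw [intervalIntegral.integral_mul_const, integral_sin_two_pi]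
          rw [show 2 * π * (1 / 2) = π by ring]
          simp; left; norm_num
  have b2 : ∫ a in (1 / 2 : ℝ)..1, 2 * π * Real.sin (2 * π * a) * F a ≤ 2 * D := by
    calc _ ≤ ∫ a in (1 / 2 : ℝ)..1, 2 * π * Real.sin (2 * π * a) * (-D) := by
          refine intervalIntegral.integral_mono_on (by norm_num) (hFi _ _)
            (Continuous.intervalIntegrable (by fun_prop) _ _) fun a ha => ?_
          have hs : Real.sin (2 * π * a) ≤ 0 := by
            rw [← Real.sin_sub_two_pi]
            exact Real.sin_nonpos_of_nonpos_of_neg_pi_le (by nlinarith [ha.2]) (by nlinarith [ha.1])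
          have := (abs_le.mp (hFle a ⟨by linarith [ha.1], ha.2⟩)).1
          exact mul_le_mul_of_nonpos_left this (mul_nonpos_of_nonneg_of_nonpos (by positivity) hs)
      _ = 2 * D := by
          rw [intervalIntegral.integral_mul_const, integral_sin_two_pi]
          rw [show 2 * π * (1 / 2) = π by ring, mul_one]
          simp; ring
  linarith

lemma intervalIntegrable_of_abs_le {f : ℝ → ℝ} {C : ℝ} (hf : Measurable f) (h : ∀ x, |f x| ≤ C)
    (u v : ℝ) : IntervalIntegrable f volume u v := by
  refine (intervalIntegrable_const (c := C)).mono_fun hf.aestronglyMeasurable ?_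
  refine Eventually.of_forall fun x => ?_
  exact (h x).trans (le_abs_self C)

/-- The centred indicator function of the interval `[a, b)` modulo `1`. -/
noncomputable def saw (a b y : ℝ) : ℝ := Int.fract (y - b) - Int.fract (y - a)

lemma measurable_saw (a b : ℝ) : Measurable (saw a b) :=
  (measurable_fract.comp (measurable_id.sub_const b)).sub
    (measurable_fract.comp (measurable_id.sub_const a))

lemma abs_saw_le (a b y : ℝ) : |saw a b y| ≤ 1 := by
  have h1 := Int.fract_nonneg (y - b)
  have h2 := Int.fract_lt_one (y - b)
  have h3 := Int.fract_nonneg (y - a)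
  have h4 := Int.fract_lt_one (y - a)
  rw [saw, abs_le]; constructor <;> linarith

lemma saw_eq_floor (a b y : ℝ) : saw a b y = ⌊y - a⌋ - ⌊y - b⌋ - (b - a) := by
  rw [saw, Int.fract, Int.fract]; ring

lemma saw_of_lt {a b y : ℝ} {z : ℤ} (hb : b ≤ a + 1) (h1 : a + z ≤ y) (h2 : y < b + z) :
    saw a b y = 1 - (b - a) := by
  have e1 : ⌊y - a⌋ = z := by rw [Int.floor_eq_iff]; constructor <;> linarith
  have e2 : ⌊y - b⌋ = z - 1 := by rw [Int.floor_eq_iff]; push_cast; constructor <;> linarith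
  rw [saw_eq_floor, e1, e2]; push_cast; ring

lemma saw_of_ge {a b y : ℝ} {z : ℤ} (hab : a ≤ b) (h1 : b + z ≤ y) (h2 : y < a + z + 1) :
    saw a b y = -(b - a) := by
  have e1 : ⌊y - a⌋ = z := by rw [Int.floor_eq_iff]; constructor <;> linarith
  have e2 : ⌊y - b⌋ = z := by rw [Int.floor_eq_iff]; constructor <;> linarith
  rw [saw_eq_floor, e1, e2]; ring

lemma intervalIntegrable_fract_sub (a u v : ℝ) :
    IntervalIntegrable (fun y => Int.fract (y - a)) volume u v := by
  refine intervalIntegrable_of_abs_le (C := 1) ?_ ?_ u v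
  · exact measurable_fract.comp (measurable_id.sub_const a)
  · intro x; rw [abs_of_nonneg (Int.fract_nonneg _)]; exact (Int.fract_lt_one _).le

lemma integral_fract_mem {s t : ℝ} (h : s ≤ t) :
    ∫ y in s..t, Int.fract y ∈ Set.Icc 0 (t - s) := by
  have hi : IntervalIntegrable (Int.fract : ℝ → ℝ) volume s t := by
    simpa using intervalIntegrable_fract_sub 0 s t
  constructor
  · exact intervalIntegral.integral_nonneg h fun y _ => Int.fract_nonneg y
  · calc _ ≤ ∫ y in s..t, (1 : ℝ) := intervalIntegral.integral_mono_on h hi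
          intervalIntegrable_const fun y _ => (Int.fract_lt_one y).le
      _ = t - s := by simp

lemma abs_integral_saw_le {a b : ℝ} (hab : a ≤ b) (u v : ℝ) :
    |∫ y in u..v, saw a b y| ≤ b - a := by
  have hi : ∀ s t : ℝ, IntervalIntegrable (Int.fract : ℝ → ℝ) volume s t := fun s t => by
    simpa using intervalIntegrable_fract_sub 0 s t
  have e : ∫ y in u..v, saw a b y
      = (∫ y in (u - b)..(u - a), Int.fract y) - ∫ y in (v - b)..(v - a), Int.fract y := by
    simp only [saw]
    rw [intervalIntegral.integral_sub (intervalIntegrable_fract_sub b u v)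
      (intervalIntegrable_fract_sub a u v),
      intervalIntegral.integral_comp_sub_right (fun y => Int.fract y),
      intervalIntegral.integral_comp_sub_right (fun y => Int.fract y),
      intervalIntegral.integral_interval_sub_interval_comm (hi _ _) (hi _ _) (hi _ _)]
  have h1 := integral_fract_mem (show u - b ≤ u - a by linarith)
  have h2 := integral_fract_mem (show v - b ≤ v - a by linarith)
  rw [e, abs_le]
  constructor <;> linarith [h1.1, h1.2, h2.1, h2.2]

lemma abs_integral_saw_mul_le {a b ν : ℝ} (hab : a ≤ b) (hν : 0 < ν) (u v : ℝ) :
    |∫ x in u..v, saw a b (ν * x)| ≤ (b - a) / ν := by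
  rw [intervalIntegral.integral_comp_mul_left (saw a b) hν.ne', smul_eq_mul, abs_mul,
    abs_of_pos (inv_pos.mpr hν), div_eq_inv_mul]
  exact mul_le_mul_of_nonneg_left (abs_integral_saw_le hab _ _) (inv_pos.mpr hν).le

lemma abs_integral_mul_saw_le_of_cell {a b η : ℝ} {f : ℝ → ℝ} (hab : a ≤ b) (hb : b ≤ a + 1)
    (hi : ∀ s t, IntervalIntegrable (fun y => f y * saw a b y) volume s t)
    (hη : ∀ s t, |∫ y in s..t, f y| ≤ η) {s t : ℝ} {z : ℤ} (h1 : a + z ≤ s) (hst : s ≤ t)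
    (h2 : t ≤ a + z + 1) : |∫ y in s..t, f y * saw a b y| ≤ η := by
  set m := max s (min t (b + z)) with hm
  have hsm : s ≤ m := le_max_left _ _
  have hmt : m ≤ t := max_le hst (min_le_left _ _)
  have e1 : ∫ y in s..m, f y * saw a b y = (∫ y in s..m, f y) * (1 - (b - a)) := by
    rw [← intervalIntegral.integral_mul_const]
    refine intervalIntegral.integral_congr_Ioo_of_le hsm fun y hy => ?_
    have : y < b + z := by
      rcases lt_max_iff.mp hy.2 with h | h
      · exact absurd h (not_lt.mpr hy.1.le)
      · exact h.trans_le (min_le_right _ _)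
    rw [saw_of_lt hb (h1.trans hy.1.le) this]
  have e2 : ∫ y in m..t, f y * saw a b y = (∫ y in m..t, f y) * (-(b - a)) := by
    rw [← intervalIntegral.integral_mul_const]
    refine intervalIntegral.integral_congr_Ioo_of_le hmt fun y hy => ?_
    have : b + z ≤ y := by
      have h3 : min t (b + z) < y := (le_max_right _ _).trans_lt hy.1
      rcases min_lt_iff.mp h3 with h | h
      · exact absurd h (not_lt.mpr hy.2.le)
      · exact h.le
    rw [saw_of_ge hab this (hy.2.trans_le h2)]
  rw [← intervalIntegral.integral_add_adjacent_intervals (hi s m) (hi m t), e1, e2]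
  have h3 := abs_le.mp (hη s m)
  have h4 := abs_le.mp (hη m t)
  rw [abs_le]
  constructor <;> nlinarith

lemma abs_integral_mul_saw_le {a b η : ℝ} {f : ℝ → ℝ} (hab : a ≤ b) (hb : b ≤ a + 1)
    (hi : ∀ s t, IntervalIntegrable (fun y => f y * saw a b y) volume s t)
    (hη : ∀ s t, |∫ y in s..t, f y| ≤ η) {u v : ℝ} (huv : u ≤ v) :
    |∫ y in u..v, f y * saw a b y| ≤ (v - u + 2) * η := by
  have hη0 : 0 ≤ η := (abs_nonneg _).trans (hη 0 0)
  have key : ∀ n : ℕ, ∀ v, u ≤ v → v ≤ a + ⌊u - a⌋ + (n + 1) →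
      |∫ y in u..v, f y * saw a b y| ≤ (n + 1) * η := by
    intro n
    induction n with
    | zero =>
      intro v huv hv
      have := abs_integral_mul_saw_le_of_cell hab hb hi hη (z := ⌊u - a⌋)
        (by linarith [Int.floor_le (u - a)]) huv (by push_cast at hv; linarith)
      simpa using this
    | succ n ih =>
      intro v huv hv
      push_cast at hv ⊢
      rcases le_total v (a + ⌊u - a⌋ + (n + 1)) with h | h
      · nlinarith [ih v huv h]
      · have hu : u ≤ a + ⌊u - a⌋ + (n + 1) := by
          have := Int.lt_floor_add_one (u - a)
          have : (0 : ℝ) ≤ n := n.cast_nonneg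
          linarith
        have h1 := ih _ hu le_rfl
        have h2 := abs_integral_mul_saw_le_of_cell hab hb hi hη (z := ⌊u - a⌋ + (n + 1))
          (s := a + ⌊u - a⌋ + (n + 1)) (by push_cast; linarith) h (by push_cast; linarith)
        rw [← intervalIntegral.integral_add_adjacent_intervals (hi u _) (hi _ v)]
        exact (abs_add_le _ _).trans (by linarith)
  have h1 := Nat.le_ceil (v - u)
  have h2 := Nat.ceil_lt_add_one (sub_nonneg.mpr huv)
  have h3 := Int.lt_floor_add_one (u - a)
  have h4 := key ⌈v - u⌉₊ v huv (by linarith)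
  refine h4.trans (mul_le_mul_of_nonneg_right ?_ hη0)
  linarith

lemma intervalIntegrable_saw_mul_saw (a b μ ν u v : ℝ) :
    IntervalIntegrable (fun x => saw a b (μ * x) * saw a b (ν * x)) volume u v := by
  refine intervalIntegrable_of_abs_le (C := 1) ?_ (fun x => ?_) u v
  · exact ((measurable_saw a b).comp (measurable_const_mul μ)).mul
      ((measurable_saw a b).comp (measurable_const_mul ν))
  · rw [abs_mul]
    exact mul_le_one₀ (abs_saw_le _ _ _) (abs_nonneg _) (abs_saw_le _ _ _)

lemma abs_integral_saw_mul_saw_le {a b μ ν u v : ℝ} (hab : a ≤ b) (hb : b ≤ a + 1) (hμ : 0 < μ)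
    (hν : 0 < ν) (huv : u ≤ v) (h1 : 1 ≤ ν * (v - u)) :
    |∫ x in u..v, saw a b (μ * x) * saw a b (ν * x)| ≤ 3 * (v - u) * (b - a) * (ν / μ) := by
  have e : ∀ x, saw a b (μ * x) * saw a b (ν * x)
      = (fun y => saw a b (μ / ν * y) * saw a b y) (ν * x) := fun x => by
    simp only; congr 2; field_simp
  simp_rw [e]
  rw [intervalIntegral.integral_comp_mul_left (fun y => saw a b (μ / ν * y) * saw a b y) hν.ne',
    smul_eq_mul, abs_mul, abs_of_pos (inv_pos.mpr hν)]
  have h2 := abs_integral_mul_saw_le (f := fun y => saw a b (μ / ν * y)) hab hb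
    (fun s t => by simpa using intervalIntegrable_saw_mul_saw a b (μ / ν) 1 s t)
    (fun s t => abs_integral_saw_mul_le hab (div_pos hμ hν) s t)
    (mul_le_mul_of_nonneg_left huv hν.le)
  calc _ ≤ ν⁻¹ * ((ν * v - ν * u + 2) * ((b - a) / (μ / ν))) :=
        mul_le_mul_of_nonneg_left h2 (inv_pos.mpr hν).le
    _ ≤ ν⁻¹ * ((3 * (ν * (v - u))) * ((b - a) / (μ / ν))) := by
        refine mul_le_mul_of_nonneg_left (mul_le_mul_of_nonneg_right ?_ ?_) (inv_pos.mpr hν).le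
        · linarith
        · exact div_nonneg (by linarith) (div_pos hμ hν).le
    _ = _ := by field_simp

lemma sum_pow_dist_le {r : ℝ} (h0 : 0 ≤ r) (h1 : r < 1) (k : ℕ) (s : Finset ℕ) :
    ∑ l ∈ s, r ^ ((k - l) + (l - k)) ≤ 2 / (1 - r) := by
  have hs := summable_geometric_of_lt_one h0 h1
  have ht := tsum_geometric_of_lt_one h0 h1
  have key : ∀ (s : Finset ℕ) (φ : ℕ → ℕ), Set.InjOn φ s → ∑ l ∈ s, r ^ φ l ≤ (1 - r)⁻¹ := by
    intro s φ hφ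
    rw [← ht, ← Finset.sum_image (f := fun i => r ^ i) hφ]
    exact hs.sum_le_tsum _ fun i _ => pow_nonneg h0 i
  have e1 := key (s.filter (· ≤ k)) (fun l => (k - l) + (l - k)) (by
    intro l hl l' hl' h
    simp only [Finset.coe_filter, Set.mem_ofPred_eq] at hl hl' h
    omega)
  have e2 := key (s.filter (¬ · ≤ k)) (fun l => (k - l) + (l - k)) (by
    intro l hl l' hl' h
    simp only [Finset.coe_filter, Set.mem_ofPred_eq] at hl hl' h
    omega)
  rw [← Finset.sum_filter_add_sum_filter_not s (· ≤ k), div_eq_mul_inv]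
  linarith

/-- Local variance bound for lacunary sums of centred indicators. -/
lemma integral_sum_saw_sq_le {q : ℝ} {ν : ℕ → ℕ} (hq : 1 < q) (h : IsLacunary q ν) {a b u v : ℝ}
    (hab : a ≤ b) (hb : b ≤ a + 1) (huv : u ≤ v) (s : Finset ℕ)
    (hs : ∀ k ∈ s, 1 ≤ (ν k : ℝ) * (v - u)) {c : ℕ → ℝ} (hc : ∀ k, |c k| ≤ 1) :
    ∫ x in u..v, (∑ k ∈ s, c k * saw a b (ν k * x)) ^ 2
      ≤ 6 * q / (q - 1) * s.card * (b - a) * (v - u) := by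
  have hq0 : 0 < q := by linarith
  have hpos : ∀ k, (0 : ℝ) < ν k := fun k => by exact_mod_cast h.1 k
  have cov : ∀ k l, l ≤ k → l ∈ s → |∫ x in u..v, saw a b (ν k * x) * saw a b (ν l * x)|
      ≤ 3 * (v - u) * (b - a) * q⁻¹ ^ ((k - l) + (l - k)) := by
    intro k l hlk hl
    refine (abs_integral_saw_mul_saw_le hab hb (hpos k) (hpos l) huv (hs l hl)).trans ?_
    refine mul_le_mul_of_nonneg_left ?_ (mul_nonneg (by linarith) (by linarith))
    obtain ⟨d, rfl⟩ := Nat.exists_eq_add_of_le hlk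
    have h1 := h.pow_mul_le hq l d
    rw [show l + d - l + (l - (l + d)) = d by omega, inv_pow, div_le_iff₀ (hpos _),
      ← div_eq_inv_mul, le_div_iff₀ (pow_pos hq0 d)]
    linarith
  have cov' : ∀ k ∈ s, ∀ l ∈ s, |∫ x in u..v, saw a b (ν k * x) * saw a b (ν l * x)|
      ≤ 3 * (v - u) * (b - a) * q⁻¹ ^ ((k - l) + (l - k)) := by
    intro k hk l hl
    rcases le_total l k with hlk | hlk
    · exact cov k l hlk hl
    · have := cov l k hlk hk
      simp_rw [mul_comm (saw a b (ν k * _))]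
      rwa [add_comm (k - l)]
  have e : ∀ x, (∑ k ∈ s, c k * saw a b (ν k * x)) ^ 2
      = ∑ k ∈ s, ∑ l ∈ s, (c k * c l) * (saw a b (ν k * x) * saw a b (ν l * x)) := by
    intro x
    rw [sq, Finset.sum_mul_sum]
    refine Finset.sum_congr rfl fun k _ => Finset.sum_congr rfl fun l _ => by ring
  simp_rw [e]
  rw [intervalIntegral.integral_finsetSum]
  · calc _ ≤ ∑ k ∈ s, ∑ l ∈ s, 3 * (v - u) * (b - a) * q⁻¹ ^ ((k - l) + (l - k)) := by
          refine Finset.sum_le_sum fun k hk => ?_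
          rw [intervalIntegral.integral_finsetSum]
          · refine Finset.sum_le_sum fun l hl => ?_
            rw [intervalIntegral.integral_const_mul]
            refine (le_abs_self _).trans ?_
            rw [abs_mul, abs_mul]
            have hcc : |c k| * |c l| ≤ 1 := mul_le_one₀ (hc k) (abs_nonneg _) (hc l)
            exact (mul_le_of_le_one_left (abs_nonneg _) hcc).trans (cov' k hk l hl)
          · exact fun l _ => (intervalIntegrable_saw_mul_saw ..).const_mul _
      _ ≤ ∑ k ∈ s, 3 * (v - u) * (b - a) * (2 / (1 - q⁻¹)) := by
          refine Finset.sum_le_sum fun k _ => ?_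
          rw [← Finset.mul_sum]
          refine mul_le_mul_of_nonneg_left ?_ (mul_nonneg (by linarith) (by linarith))
          exact sum_pow_dist_le (inv_nonneg.mpr hq0.le) (inv_lt_one_of_one_lt₀ hq) k s
      _ = _ := by
          have : q - 1 ≠ 0 := by linarith
          have : 1 - q⁻¹ ≠ 0 := by
            have := inv_lt_one_of_one_lt₀ hq
            linarith
          rw [Finset.sum_const, nsmul_eq_mul]
          field_simp
          ring
  · intro k _
    have := IntervalIntegrable.sum (μ := volume) (a := u) (b := v) s
      (f := fun l x => (c k * c l) * (saw a b (ν k * x) * saw a b (ν l * x)))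
      (fun l _ => (intervalIntegrable_saw_mul_saw ..).const_mul _)
    simpa only [Finset.sum_fn] using this

/-- The left endpoint of the dyadic cell of order `r` that contains `x`. -/
noncomputable def dyadicFloor (r : ℕ) (x : ℝ) : ℝ := ⌊(2 : ℝ) ^ r * x⌋ / 2 ^ r

lemma dyadicFloor_le (r : ℕ) (x : ℝ) : dyadicFloor r x ≤ x := by
  rw [dyadicFloor, div_le_iff₀ (by positivity)]
  linarith [Int.floor_le ((2 : ℝ) ^ r * x)]

lemma lt_dyadicFloor_add (r : ℕ) (x : ℝ) : x < dyadicFloor r x + 1 / 2 ^ r := by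
  rw [dyadicFloor, ← add_div, lt_div_iff₀ (by positivity)]
  linarith [Int.lt_floor_add_one ((2 : ℝ) ^ r * x)]

lemma measurable_dyadicFloor (r : ℕ) : Measurable (dyadicFloor r) := by
  unfold dyadicFloor
  fun_prop

lemma abs_saw_sub_saw_dyadicFloor_le (a b : ℝ) {ν : ℝ} (hν : 0 < ν) (r : ℕ) (x : ℝ) :
    |saw a b (ν * x) - saw a b (ν * dyadicFloor r x)|
      ≤ (ν / 2 ^ r + saw a (a + ν / 2 ^ r) (ν * x))
        + (ν / 2 ^ r + saw b (b + ν / 2 ^ r) (ν * x)) := by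
  set σ := ν / 2 ^ r with hσ
  have h1 : ν * dyadicFloor r x ≤ ν * x := mul_le_mul_of_nonneg_left (dyadicFloor_le r x) hν.le
  have h2 : ν * x - σ ≤ ν * dyadicFloor r x := by
    have := mul_le_mul_of_nonneg_left (lt_dyadicFloor_add r x).le hν.le
    have e : ν * (dyadicFloor r x + 1 / 2 ^ r) = ν * dyadicFloor r x + σ := by rw [hσ]; ring
    linarith
  have key : ∀ t : ℝ, |(⌊ν * x - t⌋ : ℝ) - ⌊ν * dyadicFloor r x - t⌋| ≤ σ + saw t (t + σ) (ν * x) := by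
    intro t
    have h3 : (⌊ν * dyadicFloor r x - t⌋ : ℝ) ≤ ⌊ν * x - t⌋ := by
      exact_mod_cast Int.floor_le_floor (by linarith)
    have h4 : (⌊ν * x - (t + σ)⌋ : ℝ) ≤ ⌊ν * dyadicFloor r x - t⌋ := by
      exact_mod_cast Int.floor_le_floor (by linarith)
    rw [abs_of_nonneg (by linarith), saw_eq_floor]
    linarith
  have ha := key a
  have hb := key b
  rw [saw_eq_floor, saw_eq_floor]
  rw [abs_le] at ha hb ⊢
  constructor <;> linarith

lemma integral_abs_saw_sub_saw_dyadicFloor_le (a b : ℝ) {ν u v : ℝ} (hν : 0 < ν) (r : ℕ)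
    (huv : u ≤ v) (h1 : 1 ≤ ν * (v - u)) :
    ∫ x in u..v, |saw a b (ν * x) - saw a b (ν * dyadicFloor r x)|
      ≤ 4 * (ν / 2 ^ r) * (v - u) := by
  set σ := ν / 2 ^ r with hσ
  have hσ0 : 0 ≤ σ := by positivity
  have hi : ∀ c d, IntervalIntegrable (fun x => saw c d (ν * x)) volume u v := fun c d =>
    intervalIntegrable_of_abs_le ((measurable_saw c d).comp (measurable_const_mul ν))
      (fun x => abs_saw_le _ _ _) u v
  have hs : ∀ t, ∫ x in u..v, (σ + saw t (t + σ) (ν * x)) ≤ 2 * σ * (v - u) := by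
    intro t
    rw [intervalIntegral.integral_add intervalIntegrable_const (hi _ _),
      intervalIntegral.integral_const, smul_eq_mul]
    have h2 := (le_abs_self _).trans
      (abs_integral_saw_mul_le (show t ≤ t + σ by linarith) hν u v)
    have h3 : (t + σ - t) / ν ≤ σ * (v - u) := by
      rw [div_le_iff₀ hν]; nlinarith
    linarith
  calc _ ≤ ∫ x in u..v, ((σ + saw a (a + σ) (ν * x)) + (σ + saw b (b + σ) (ν * x))) := by
        refine intervalIntegral.integral_mono_on huv ?_ ?_
          fun x _ => abs_saw_sub_saw_dyadicFloor_le a b hν r x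
        · refine intervalIntegrable_of_abs_le (C := 2) ?_ (fun x => ?_) u v
          · have h2 := (measurable_saw a b).comp (measurable_const_mul ν)
            have h3 := (measurable_saw a b).comp ((measurable_dyadicFloor r).const_mul ν)
            exact (h2.sub h3).abs
          · have h2 := abs_saw_le a b (ν * x)
            have h3 := abs_saw_le a b (ν * dyadicFloor r x)
            rw [abs_abs]
            exact (abs_sub _ _).trans (by linarith)
        · exact (intervalIntegrable_const.add (hi _ _)).add (intervalIntegrable_const.add (hi _ _))
    _ = (∫ x in u..v, (σ + saw a (a + σ) (ν * x))) + ∫ x in u..v, (σ + saw b (b + σ) (ν * x)) :=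
        intervalIntegral.integral_add (intervalIntegrable_const.add (hi _ _))
          (intervalIntegrable_const.add (hi _ _))
    _ ≤ _ := by linarith [hs a, hs b]

lemma dyadicFloor_eq {r : ℕ} {j : ℤ} {x : ℝ} (h1 : (j : ℝ) / 2 ^ r ≤ x) (h2 : x < (j + 1) / 2 ^ r) :
    dyadicFloor r x = j / 2 ^ r := by
  rw [dyadicFloor]
  congr 2
  rw [div_le_iff₀ (by positivity)] at h1
  rw [lt_div_iff₀ (by positivity)] at h2
  rw [Int.floor_eq_iff]
  constructor <;> linarith

lemma dyadicFloor_dyadicFloor {r s : ℕ} (h : r ≤ s) (x : ℝ) :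
    dyadicFloor r (dyadicFloor s x) = dyadicFloor r x := by
  obtain ⟨d, rfl⟩ := Nat.exists_eq_add_of_le h
  have h2 : (0 : ℝ) < 2 ^ r := by positivity
  conv_rhs => rw [dyadicFloor]
  refine dyadicFloor_eq ?_ ?_
  · rw [dyadicFloor, div_le_div_iff₀ h2 (by positivity), pow_add]
    have : (⌊(2 : ℝ) ^ r * x⌋ * 2 ^ d : ℤ) ≤ ⌊(2 : ℝ) ^ (r + d) * x⌋ := by
      rw [Int.le_floor]
      push_cast
      rw [pow_add]
      have := mul_le_mul_of_nonneg_right (Int.floor_le ((2 : ℝ) ^ r * x))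
        (show (0 : ℝ) ≤ 2 ^ d by positivity)
      linarith
    have h3 : (⌊(2 : ℝ) ^ r * x⌋ * 2 ^ d : ℝ) ≤ ⌊(2 : ℝ) ^ r * 2 ^ d * x⌋ := by
      rw [← pow_add]; exact_mod_cast this
    nlinarith
  · refine (dyadicFloor_le _ x).trans_lt ?_
    rw [lt_div_iff₀ h2]
    linarith [Int.lt_floor_add_one ((2 : ℝ) ^ r * x)]

lemma integral_mul_le_of_dyadic {r : ℕ} {G H : ℝ → ℝ} {A : ℝ} (hG0 : ∀ x, 0 ≤ G x)
    (hG : ∀ x, G (dyadicFloor r x) = G x)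
    (hGi : ∀ u v, IntervalIntegrable G volume u v)
    (hGH : ∀ u v, IntervalIntegrable (fun x => G x * H x) volume u v)
    (hH : ∀ j : ℕ, j < 2 ^ r →
      ∫ x in (j / 2 ^ r : ℝ)..((j + 1) / 2 ^ r), H x ≤ A * ((j + 1) / 2 ^ r - j / 2 ^ r)) :
    ∫ x in (0 : ℝ)..1, G x * H x ≤ A * ∫ x in (0 : ℝ)..1, G x := by
  have split : ∀ F : ℝ → ℝ, (∀ u v, IntervalIntegrable F volume u v) →
      ∑ j ∈ Finset.range (2 ^ r), ∫ x in (j / 2 ^ r : ℝ)..((j + 1) / 2 ^ r), F x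
        = ∫ x in (0 : ℝ)..1, F x := by
    intro F hF
    have := intervalIntegral.sum_integral_adjacent_intervals (f := F) (μ := volume)
      (a := fun j : ℕ => (j : ℝ) / 2 ^ r) (n := 2 ^ r) (fun k _ => hF _ _)
    push_cast at this
    rw [this, zero_div, div_self (by positivity)]
  rw [← split _ hGH, ← split _ hGi, Finset.mul_sum]
  refine Finset.sum_le_sum fun j hj => ?_
  have hle : (j : ℝ) / 2 ^ r ≤ (j + 1) / 2 ^ r := by gcongr; linarith
  have hc : ∀ x ∈ Set.Ioo ((j : ℝ) / 2 ^ r) ((j + 1) / 2 ^ r), G x = G (j / 2 ^ r) := by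
    intro x hx
    rw [← hG x, dyadicFloor_eq (j := (j : ℤ)) (by rw [Int.cast_natCast]; exact hx.1.le)
      (by rw [Int.cast_natCast]; exact hx.2), Int.cast_natCast]
  rw [intervalIntegral.integral_congr_Ioo_of_le (g := fun x => G (j / 2 ^ r) * H x) hle
    (fun x hx => by simp only [hc x hx]), intervalIntegral.integral_const_mul,
    intervalIntegral.integral_congr_Ioo_of_le (g := fun x => G (j / 2 ^ r)) hle hc,
    intervalIntegral.integral_const, smul_eq_mul]
  calc _ ≤ G (j / 2 ^ r) * (A * ((j + 1) / 2 ^ r - j / 2 ^ r)) :=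
        mul_le_mul_of_nonneg_left (hH j (Finset.mem_range.mp hj)) (hG0 _)
    _ = _ := by ring

lemma exp_le_of_abs_le_one {y z : ℝ} (hy : |y| ≤ 1) (hz : |z| ≤ 1) :
    Real.exp z ≤ 1 + y + y ^ 2 + 3 * |z - y| := by
  have h1 := exp_le_one_add_add_sq hy
  have h2 : Real.exp z - Real.exp y ≤ 3 * |z - y| := by
    have h3 := Real.add_one_le_exp (y - z)
    have h4 : Real.exp y = Real.exp z * Real.exp (y - z) := by rw [← Real.exp_add]; ring_nf
    have h5 : Real.exp z ≤ 3 := by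
      have := Real.exp_one_lt_d9
      have := Real.exp_le_exp.mpr (le_of_abs_le hz)
      linarith
    have h6 := Real.exp_pos z
    have h7 := le_abs_self (z - y)
    have h8 := abs_nonneg (z - y)
    nlinarith [mul_le_mul_of_nonneg_left h3 h6.le]
  linarith

lemma abs_mul_sum_saw_le {a b μ : ℝ} (s : Finset ℕ) {c : ℕ → ℝ} (hc : ∀ k, |c k| ≤ 1)
    (hμ : |μ| * s.card ≤ 1) (y : ℕ → ℝ) : |μ * ∑ k ∈ s, c k * saw a b (y k)| ≤ 1 := by
  rw [abs_mul]
  refine (mul_le_mul_of_nonneg_left ?_ (abs_nonneg μ)).trans hμ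
  refine (Finset.abs_sum_le_sum_abs _ _).trans ?_
  rw [← nsmul_one, ← Finset.sum_const]
  refine Finset.sum_le_sum fun k _ => ?_
  rw [abs_mul]
  exact mul_le_one₀ (hc k) (abs_nonneg _) (abs_saw_le _ _ _)

/-- Conditional exponential moment bound for a block of discretized centred indicators. -/
lemma integral_exp_block_le {q : ℝ} {ν : ℕ → ℕ} (hq : 1 < q) (h : IsLacunary q ν)
    {a b u v μ T : ℝ} (hab : a ≤ b) (hb : b ≤ a + 1) (huv : u ≤ v) (s : Finset ℕ) {c : ℕ → ℝ}
    (hc : ∀ k, |c k| ≤ 1) (hμ : |μ| * s.card ≤ 1) (hT : 2 ≤ T) {r : ℕ}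
    (hs : ∀ k ∈ s, T ≤ 2 * (ν k * (v - u))) (hr : ∀ k ∈ s, T * ν k ≤ 2 ^ r) :
    ∫ x in u..v, Real.exp (μ * ∑ k ∈ s, c k * saw a b (ν k * dyadicFloor r x))
      ≤ (1 + (6 * q / (q - 1) * (b - a) * (μ ^ 2 * s.card) + 14 / T)) * (v - u) := by
  have hpos : ∀ k, (0 : ℝ) < ν k := fun k => by exact_mod_cast h.1 k
  have m1 : ∀ k, Measurable fun x : ℝ => saw a b (ν k * x) := fun k =>
    (measurable_saw a b).comp (measurable_const_mul _)
  have m2 : ∀ k, Measurable fun x : ℝ => saw a b (ν k * dyadicFloor r x) := fun k =>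
    (measurable_saw a b).comp ((measurable_dyadicFloor r).const_mul _)
  have mX : Measurable fun x : ℝ => ∑ k ∈ s, c k * saw a b (ν k * x) :=
    Finset.measurable_fun_sum s fun k _ => (m1 k).const_mul (c k)
  have mY : Measurable fun x : ℝ => ∑ k ∈ s, c k * saw a b (ν k * dyadicFloor r x) :=
    Finset.measurable_fun_sum s fun k _ => (m2 k).const_mul (c k)
  have bX := fun x : ℝ => abs_mul_sum_saw_le (a := a) (b := b) s hc hμ fun k => (ν k : ℝ) * x
  have bY := fun x : ℝ => abs_mul_sum_saw_le (a := a) (b := b) s hc hμ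
    fun k => (ν k : ℝ) * dyadicFloor r x
  have iX : IntervalIntegrable (fun x : ℝ => μ * ∑ k ∈ s, c k * saw a b (ν k * x)) volume u v :=
    intervalIntegrable_of_abs_le (mX.const_mul μ) bX u v
  have iX2 : IntervalIntegrable (fun x : ℝ => (μ * ∑ k ∈ s, c k * saw a b (ν k * x)) ^ 2)
      volume u v := by
    refine intervalIntegrable_of_abs_le (C := 1) ((mX.const_mul μ).pow_const 2) (fun x => ?_) u v
    rw [abs_pow]
    exact pow_le_one₀ (abs_nonneg _) (bX x)
  have iD : ∀ k, IntervalIntegrable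
      (fun x : ℝ => |saw a b (ν k * x) - saw a b (ν k * dyadicFloor r x)|) volume u v := fun k => by
    refine intervalIntegrable_of_abs_le (C := 2) ((m1 k).sub (m2 k)).abs (fun x => ?_) u v
    have h1 := abs_saw_le a b (ν k * x)
    have h2 := abs_saw_le a b (ν k * dyadicFloor r x)
    rw [abs_abs]
    exact (abs_sub _ _).trans (add_le_add h1 h2 |>.trans (by norm_num))
  have iS : IntervalIntegrable
      (fun x : ℝ => ∑ k ∈ s, |saw a b (ν k * x) - saw a b (ν k * dyadicFloor r x)|) volume u v := by
    have := IntervalIntegrable.sum (μ := volume) (a := u) (b := v) s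
      (f := fun k x => |saw a b (ν k * x) - saw a b (ν k * dyadicFloor r x)|) (fun k _ => iD k)
    simpa only [Finset.sum_fn] using this
  have hw : 0 ≤ v - u := by linarith
  have hT0 : 0 < T := by linarith
  have I1 : ∫ x in u..v, μ * ∑ k ∈ s, c k * saw a b (ν k * x) ≤ 2 / T * (v - u) := by
    rw [intervalIntegral.integral_const_mul, intervalIntegral.integral_finsetSum]
    · have : |∑ k ∈ s, ∫ x in u..v, c k * saw a b (ν k * x)| ≤ s.card * (2 / T * (v - u)) := by
        refine (Finset.abs_sum_le_sum_abs _ _).trans ?_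
        rw [← nsmul_eq_mul, ← Finset.sum_const]
        refine Finset.sum_le_sum fun k hk => ?_
        rw [intervalIntegral.integral_const_mul, abs_mul]
        refine (mul_le_of_le_one_left (abs_nonneg _) (hc k)).trans ?_
        refine (abs_integral_saw_mul_le hab (hpos k) u v).trans ?_
        rw [div_le_iff₀ (hpos k), div_mul_eq_mul_div, div_mul_eq_mul_div, le_div_iff₀ hT0]
        nlinarith [hs k hk]
      calc _ ≤ |μ| * |∑ k ∈ s, ∫ x in u..v, c k * saw a b (ν k * x)| := by
            rw [← abs_mul]; exact le_abs_self _
        _ ≤ |μ| * (s.card * (2 / T * (v - u))) :=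
            mul_le_mul_of_nonneg_left this (abs_nonneg _)
        _ = (|μ| * s.card) * (2 / T * (v - u)) := by ring
        _ ≤ 1 * (2 / T * (v - u)) := mul_le_mul_of_nonneg_right hμ (by positivity)
        _ = _ := one_mul _
    · intro k _
      exact (intervalIntegrable_of_abs_le (m1 k) (fun x => abs_saw_le _ _ _) u v).const_mul _
  have I2 : ∫ x in u..v, (μ * ∑ k ∈ s, c k * saw a b (ν k * x)) ^ 2
      ≤ 6 * q / (q - 1) * (b - a) * (μ ^ 2 * s.card) * (v - u) := by
    simp_rw [mul_pow]
    rw [intervalIntegral.integral_const_mul]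
    have := integral_sum_saw_sq_le hq h hab hb huv s
      (fun k hk => by linarith [hs k hk]) hc
    calc _ ≤ _ := mul_le_mul_of_nonneg_left this (sq_nonneg μ)
      _ = _ := by ring
  have I3 : ∫ x in u..v, ∑ k ∈ s, |saw a b (ν k * x) - saw a b (ν k * dyadicFloor r x)|
      ≤ s.card * (4 / T * (v - u)) := by
    rw [intervalIntegral.integral_finsetSum fun k _ => iD k, ← nsmul_eq_mul, ← Finset.sum_const]
    refine Finset.sum_le_sum fun k hk => ?_
    refine (integral_abs_saw_sub_saw_dyadicFloor_le a b (hpos k) r huv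
      (by linarith [hs k hk])).trans ?_
    refine mul_le_mul_of_nonneg_right ?_ hw
    rw [mul_div_assoc', div_le_div_iff₀ (by positivity) hT0]
    linarith [hr k hk]
  calc _ ≤ ∫ x in u..v, (1 + μ * ∑ k ∈ s, c k * saw a b (ν k * x)
          + (μ * ∑ k ∈ s, c k * saw a b (ν k * x)) ^ 2
          + 3 * |μ| * ∑ k ∈ s, |saw a b (ν k * x) - saw a b (ν k * dyadicFloor r x)|) := by
        refine intervalIntegral.integral_mono_on huv ?_
          (((intervalIntegrable_const.add iX).add iX2).add (iS.const_mul _)) fun x _ => ?_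
        · refine intervalIntegrable_of_abs_le (C := Real.exp 1) (mY.const_mul μ).exp (fun x => ?_) u v
          rw [Real.abs_exp]
          exact Real.exp_le_exp.mpr (le_of_abs_le (bY x))
        · refine (exp_le_of_abs_le_one (bX x) (bY x)).trans ?_
          rw [← mul_sub, abs_mul, ← Finset.sum_sub_distrib, mul_assoc]
          gcongr
          refine (Finset.abs_sum_le_sum_abs _ _).trans (Finset.sum_le_sum fun k _ => ?_)
          rw [← mul_sub, abs_mul, abs_sub_comm]
          exact mul_le_of_le_one_left (abs_nonneg _) (hc k)
    _ = (v - u) + (∫ x in u..v, μ * ∑ k ∈ s, c k * saw a b (ν k * x))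
          + (∫ x in u..v, (μ * ∑ k ∈ s, c k * saw a b (ν k * x)) ^ 2)
          + 3 * |μ| * ∫ x in u..v, ∑ k ∈ s, |saw a b (ν k * x) - saw a b (ν k * dyadicFloor r x)| := by
        rw [intervalIntegral.integral_add ((intervalIntegrable_const.add iX).add iX2)
          (iS.const_mul _), intervalIntegral.integral_add (intervalIntegrable_const.add iX) iX2,
          intervalIntegral.integral_add intervalIntegrable_const iX,
          intervalIntegral.integral_const_mul (3 * |μ|)]
        simp
    _ ≤ (v - u) + 2 / T * (v - u) + 6 * q / (q - 1) * (b - a) * (μ ^ 2 * s.card) * (v - u)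
          + 12 / T * (v - u) := by
        refine add_le_add (add_le_add (add_le_add le_rfl I1) I2) ?_
        calc _ ≤ 3 * |μ| * (s.card * (4 / T * (v - u))) :=
              mul_le_mul_of_nonneg_left I3 (by positivity)
          _ = (|μ| * s.card) * (12 / T * (v - u)) := by ring
          _ ≤ 1 * (12 / T * (v - u)) := mul_le_mul_of_nonneg_right hμ (by positivity)
          _ = _ := one_mul _
    _ = _ := by ring

/-- The discretization level of the `j`-th block. -/
noncomputable def blockLevel (ν : ℕ → ℕ) (t B j : ℕ) : ℕ := t + Nat.clog 2 (ν (j * (B + B) + B))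

/-- A block of discretized centred indicators. -/
noncomputable def sawBlock (ν : ℕ → ℕ) (a b : ℝ) (c : ℕ → ℝ) (t B j : ℕ) (x : ℝ) : ℝ :=
  ∑ k ∈ Finset.Ico (j * (B + B)) (j * (B + B) + B),
    c k * saw a b (ν k * dyadicFloor (blockLevel ν t B j) x)

lemma blockLevel_mono {q : ℝ} {ν : ℕ → ℕ} (hq : 1 < q) (h : IsLacunary q ν) (t B : ℕ) :
    Monotone (blockLevel ν t B) := by
  intro i j hij
  refine Nat.add_le_add_left (Nat.clog_mono_right 2 ((h.strictMono hq).monotone ?_)) t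
  exact Nat.add_le_add_right (Nat.mul_le_mul_right _ hij) B

lemma mul_le_two_pow_blockLevel {q : ℝ} {ν : ℕ → ℕ} (hq : 1 < q) (h : IsLacunary q ν)
    (t B j : ℕ) {k : ℕ} (hk : k ≤ j * (B + B) + B) :
    (2 : ℝ) ^ t * ν k ≤ 2 ^ blockLevel ν t B j := by
  have h1 : ν k ≤ 2 ^ Nat.clog 2 (ν (j * (B + B) + B)) :=
    ((h.strictMono hq).monotone hk).trans (Nat.le_pow_clog one_lt_two _)
  rw [blockLevel, pow_add]
  refine mul_le_mul_of_nonneg_left ?_ (by positivity)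
  exact_mod_cast h1

lemma two_pow_blockLevel_le {q : ℝ} {ν : ℕ → ℕ} (hq : 1 < q) (h : IsLacunary q ν)
    {t B : ℕ} (hB : ((2 : ℝ) ^ t) ^ 2 ≤ q ^ B) (j : ℕ) {k : ℕ} (hk : (j + 1) * (B + B) ≤ k) :
    (2 : ℝ) ^ t * 2 ^ blockLevel ν t B j ≤ 2 * ν k := by
  have h0 := h.1 (j * (B + B) + B)
  have h1 : 2 ^ Nat.clog 2 (ν (j * (B + B) + B)) ≤ 2 * ν (j * (B + B) + B) := by
    rcases Nat.lt_or_ge 1 (ν (j * (B + B) + B)) with h1 | h1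
    · have h2 := Nat.pow_pred_clog_lt_self one_lt_two h1
      have h3 := Nat.clog_pos one_lt_two h1
      obtain ⟨m, hm⟩ := Nat.exists_eq_succ_of_ne_zero h3.ne'
      rw [hm] at h2 ⊢
      rw [pow_succ]
      simp only [Nat.pred_eq_sub_one, Nat.succ_eq_add_one, Nat.add_sub_cancel] at h2
      omega
    · rw [Nat.clog_of_right_le_one h1]; omega
  have h2 : (2 : ℝ) ^ Nat.clog 2 (ν (j * (B + B) + B)) ≤ 2 * ν (j * (B + B) + B) := by
    exact_mod_cast h1
  have h3 := h.pow_mul_le hq (j * (B + B) + B) B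
  have h4 : (ν (j * (B + B) + B + B) : ℝ) ≤ ν k := by
    refine Nat.cast_le.mpr ((h.strictMono hq).monotone ?_)
    linarith
  have h5 : (0 : ℝ) ≤ ν (j * (B + B) + B) := Nat.cast_nonneg _
  calc (2 : ℝ) ^ t * 2 ^ blockLevel ν t B j
      = ((2 : ℝ) ^ t) ^ 2 * 2 ^ Nat.clog 2 (ν (j * (B + B) + B)) := by rw [blockLevel]; ring
    _ ≤ ((2 : ℝ) ^ t) ^ 2 * (2 * ν (j * (B + B) + B)) := by gcongr
    _ ≤ q ^ B * (2 * ν (j * (B + B) + B)) := by gcongr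
    _ ≤ _ := by linarith

lemma measurable_sawBlock (ν : ℕ → ℕ) (a b : ℝ) (c : ℕ → ℝ) (t B j : ℕ) :
    Measurable (sawBlock ν a b c t B j) :=
  Finset.measurable_fun_sum _ fun k _ =>
    ((measurable_saw a b).comp ((measurable_dyadicFloor _).const_mul _)).const_mul (c k)

lemma abs_mul_sawBlock_le {μ : ℝ} (ν : ℕ → ℕ) (a b : ℝ) {c : ℕ → ℝ} (hc : ∀ k, |c k| ≤ 1)
    (t j : ℕ) {B : ℕ} (hμ : |μ| * B ≤ 1) (x : ℝ) : |μ * sawBlock ν a b c t B j x| ≤ 1 :=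
  abs_mul_sum_saw_le _ hc (by simpa using hμ) _

lemma intervalIntegrable_exp_sum_sawBlock {μ : ℝ} (ν : ℕ → ℕ) (a b : ℝ) {c : ℕ → ℝ}
    (hc : ∀ k, |c k| ≤ 1) (t : ℕ) {B : ℕ} (hμ : |μ| * B ≤ 1) (s : Finset ℕ) (u v : ℝ) :
    IntervalIntegrable (fun x => Real.exp (μ * ∑ j ∈ s, sawBlock ν a b c t B j x))
      volume u v := by
  refine intervalIntegrable_of_abs_le (C := Real.exp s.card)
    ((Finset.measurable_fun_sum s fun j _ => measurable_sawBlock ν a b c t B j).const_mul μ).exp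
    (fun x => ?_) u v
  rw [Real.abs_exp, Finset.mul_sum]
  refine Real.exp_le_exp.mpr ?_
  rw [← nsmul_one, ← Finset.sum_const]
  exact Finset.sum_le_sum fun j _ => le_of_abs_le (abs_mul_sawBlock_le ν a b hc t j hμ x)

lemma integral_exp_sum_sawBlock_succ_le {q : ℝ} {ν : ℕ → ℕ} (hq : 1 < q) (h : IsLacunary q ν)
    {a b μ : ℝ} (hab : a ≤ b) (hb : b ≤ a + 1) {c : ℕ → ℝ} (hc : ∀ k, |c k| ≤ 1) {t B : ℕ}
    (ht : 1 ≤ t) (hB : ((2 : ℝ) ^ t) ^ 2 ≤ q ^ B) (hμ : |μ| * B ≤ 1) (M : ℕ) :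
    ∫ x in (0 : ℝ)..1, Real.exp (μ * ∑ j ∈ Finset.range (M + 1), sawBlock ν a b c t B j x)
      ≤ (1 + (6 * q / (q - 1) * (b - a) * (μ ^ 2 * B) + 14 / 2 ^ t)) ^ M * Real.exp 1 := by
  have hi := intervalIntegrable_exp_sum_sawBlock (μ := μ) ν a b hc t hμ
  have hq1 : 0 < q - 1 := by linarith
  have hl : 0 ≤ b - a := by linarith
  induction M with
  | zero =>
    rw [pow_zero, one_mul]
    calc _ ≤ ∫ x in (0 : ℝ)..1, Real.exp 1 := by
          refine intervalIntegral.integral_mono_on zero_le_one (hi _ _ _)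
            intervalIntegrable_const fun x _ => Real.exp_le_exp.mpr ?_
          rw [Finset.sum_range_one]
          exact le_of_abs_le (abs_mul_sawBlock_le ν a b hc t 0 hμ x)
      _ = _ := by simp
  | succ M ih =>
    have e : ∀ x, Real.exp (μ * ∑ j ∈ Finset.range (M + 1 + 1), sawBlock ν a b c t B j x)
        = Real.exp (μ * ∑ j ∈ Finset.range (M + 1), sawBlock ν a b c t B j x)
          * Real.exp (μ * sawBlock ν a b c t B (M + 1) x) := fun x => by
      rw [Finset.sum_range_succ, mul_add, Real.exp_add]
    have hi2 := hi (Finset.range (M + 1 + 1))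
    simp_rw [e] at hi2 ⊢
    rw [pow_succ', mul_assoc]
    refine (integral_mul_le_of_dyadic (r := blockLevel ν t B M)
      (A := 1 + (6 * q / (q - 1) * (b - a) * (μ ^ 2 * B) + 14 / 2 ^ t)) (fun x => (Real.exp_pos _).le)
      (fun x => ?_) (hi _) hi2 fun i _ => ?_).trans (mul_le_mul_of_nonneg_left ih (by positivity))
    · congr 2
      refine Finset.sum_congr rfl fun j hj => ?_
      refine Finset.sum_congr rfl fun k _ => ?_
      rw [dyadicFloor_dyadicFloor (blockLevel_mono hq h t B (by
        have := Finset.mem_range.mp hj; omega))]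
    · have hle : (i : ℝ) / 2 ^ blockLevel ν t B M ≤ (i + 1) / 2 ^ blockLevel ν t B M := by
        gcongr; linarith
      have := integral_exp_block_le (μ := μ) (T := 2 ^ t) (r := blockLevel ν t B (M + 1)) hq h hab hb hle
        (Finset.Ico ((M + 1) * (B + B)) ((M + 1) * (B + B) + B)) hc (by simpa using hμ)
        (by simpa using pow_le_pow_right₀ (one_le_two (α := ℝ)) ht) ?_ ?_
      · simpa [sawBlock] using this
      · intro k hk
        have h2 := two_pow_blockLevel_le hq h hB M (Finset.mem_Ico.mp hk).1
        rw [← sub_div, add_sub_cancel_left, mul_one_div, mul_div_assoc', le_div_iff₀ (by positivity)]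
        exact h2
      · intro k hk
        exact mul_le_two_pow_blockLevel hq h t B (M + 1) (Finset.mem_Ico.mp hk).2.le

lemma integral_exp_sum_sawBlock_le {q : ℝ} {ν : ℕ → ℕ} (hq : 1 < q) (h : IsLacunary q ν)
    {a b μ : ℝ} (hab : a ≤ b) (hb : b ≤ a + 1) {c : ℕ → ℝ} (hc : ∀ k, |c k| ≤ 1) {t B M : ℕ}
    (ht : 1 ≤ t) (hB : ((2 : ℝ) ^ t) ^ 2 ≤ q ^ B) (hμ : |μ| * B ≤ 1) (hM : (14 * M : ℝ) ≤ 2 ^ t) :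
    ∫ x in (0 : ℝ)..1, Real.exp (μ * ∑ j ∈ Finset.range M, sawBlock ν a b c t B j x)
      ≤ Real.exp (2 + 6 * q / (q - 1) * (b - a) * (μ ^ 2 * (M * B))) := by
  have hq1 : 0 < q - 1 := by linarith
  have hl : 0 ≤ b - a := by linarith
  cases M with
  | zero => simp
  | succ M =>
    refine (integral_exp_sum_sawBlock_succ_le hq h hab hb hc ht hB hμ M).trans ?_
    set ρ := 6 * q / (q - 1) * (b - a) * (μ ^ 2 * B) with hρ
    have hρ0 : 0 ≤ ρ := by positivity
    have h1 : (1 + (ρ + 14 / 2 ^ t)) ^ M ≤ Real.exp (M * (ρ + 14 / 2 ^ t)) := by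
      rw [Real.exp_nat_mul]
      refine pow_le_pow_left₀ (by positivity) ?_ M
      linarith [Real.add_one_le_exp (ρ + 14 / 2 ^ t)]
    refine (mul_le_mul_of_nonneg_right h1 (Real.exp_pos _).le).trans ?_
    rw [← Real.exp_add]
    refine Real.exp_le_exp.mpr ?_
    have h2 : (M : ℝ) * (14 / 2 ^ t) ≤ 1 := by
      rw [mul_div_assoc', div_le_one (by positivity)]
      push_cast at hM
      linarith
    have e : 6 * q / (q - 1) * (b - a) * (μ ^ 2 * (((M + 1 : ℕ) : ℝ) * B)) = M * ρ + ρ := by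
      rw [hρ]; push_cast; ring
    rw [e]; linarith

lemma measureReal_le_integral_div {f : ℝ → ℝ} {C ε : ℝ} (hf : Measurable f) (h0 : ∀ x, 0 ≤ f x)
    (hC : ∀ x, f x ≤ C) (hε : 0 < ε) :
    (volume.restrict (Set.Icc (0 : ℝ) 1)).real {x | ε ≤ f x} ≤ (∫ x in (0 : ℝ)..1, f x) / ε := by
  have hi : Integrable f (volume.restrict (Set.Icc (0 : ℝ) 1)) := by
    refine Integrable.of_bound hf.aestronglyMeasurable C (Eventually.of_forall fun x => ?_)
    rw [Real.norm_eq_abs, abs_of_nonneg (h0 x)]; exact hC x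
  have := mul_meas_ge_le_integral_of_nonneg (Eventually.of_forall h0) hi ε
  rw [le_div_iff₀ hε, intervalIntegral.integral_of_le zero_le_one, ← integral_Icc_eq_integral_Ioc]
  linarith

/-- Subgaussian tail bound for the even-numbered blocks. -/
lemma measureReal_sum_blocks_ge_le {q : ℝ} {ν : ℕ → ℕ} (hq : 1 < q) (h : IsLacunary q ν)
    {a b μ : ℝ} (hab : a ≤ b) (hb : b ≤ a + 1) {c : ℕ → ℝ} (hc : ∀ k, |c k| ≤ 1) {t B M : ℕ}
    (hB0 : 1 ≤ B) (ht : 1 ≤ t) (hB : ((2 : ℝ) ^ t) ^ 2 ≤ q ^ B) (hμ0 : 0 < μ) (hμ : μ * B ≤ 1)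
    (hM : (14 * M : ℝ) ≤ 2 ^ t) (τ : ℝ) :
    (volume.restrict (Set.Icc (0 : ℝ) 1)).real
        {x | τ ≤ ∑ j ∈ Finset.range M, ∑ k ∈ Finset.Ico (j * (B + B)) (j * (B + B) + B),
          c k * saw a b (ν k * x)}
      ≤ Real.exp (3 + 6 * q / (q - 1) * (b - a) * (μ ^ 2 * (M * B)) - μ * τ)
        + 4 * (M * B) / 2 ^ t := by
  have hB1 : (1 : ℝ) ≤ B := by exact_mod_cast hB0
  have hμ1 : μ ≤ 1 := by nlinarith
  have habs : |μ| * B ≤ 1 := by rwa [abs_of_pos hμ0]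
  set X : ℝ → ℝ := fun x => ∑ j ∈ Finset.range M, sawBlock ν a b c t B j x with hX
  set D : ℝ → ℝ := fun x => ∑ j ∈ Finset.range M,
    ∑ k ∈ Finset.Ico (j * (B + B)) (j * (B + B) + B),
      |saw a b (ν k * x) - saw a b (ν k * dyadicFloor (blockLevel ν t B j) x)| with hD
  have mX : Measurable X := Finset.measurable_fun_sum _ fun j _ => measurable_sawBlock ν a b c t B j
  have mD1 : ∀ j k, Measurable fun x : ℝ =>
      |saw a b (ν k * x) - saw a b (ν k * dyadicFloor (blockLevel ν t B j) x)| := fun j k =>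
    (((measurable_saw a b).comp (measurable_const_mul _)).sub
      ((measurable_saw a b).comp ((measurable_dyadicFloor _).const_mul _))).abs
  have mD : Measurable D := Finset.measurable_fun_sum _ fun j _ =>
    Finset.measurable_fun_sum _ fun k _ => mD1 j k
  have bD : ∀ (j k : ℕ) (x : ℝ),
      |saw a b (ν k * x) - saw a b (ν k * dyadicFloor (blockLevel ν t B j) x)| ≤ 2 := fun j k x =>
    (abs_sub _ _).trans ((add_le_add (abs_saw_le _ _ _) (abs_saw_le _ _ _)).trans (by norm_num))
  have iD : ∀ j k, IntervalIntegrable (fun x : ℝ =>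
      |saw a b (ν k * x) - saw a b (ν k * dyadicFloor (blockLevel ν t B j) x)|) volume 0 1 :=
    fun j k => intervalIntegrable_of_abs_le (mD1 j k) (fun x => by rw [abs_abs]; exact bD j k x) 0 1
  have sub : {x | τ ≤ ∑ j ∈ Finset.range M, ∑ k ∈ Finset.Ico (j * (B + B)) (j * (B + B) + B),
      c k * saw a b (ν k * x)}
      ⊆ {x | Real.exp (μ * (τ - 1)) ≤ Real.exp (μ * X x)} ∪ {x | 1 ≤ D x} := by
    intro x hx
    rw [Set.mem_ofPred_eq] at hx
    by_cases h1 : 1 ≤ D x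
    · exact Or.inr h1
    · refine Or.inl ?_
      rw [Set.mem_ofPred_eq, Real.exp_le_exp]
      refine mul_le_mul_of_nonneg_left ?_ hμ0.le
      have : (∑ j ∈ Finset.range M, ∑ k ∈ Finset.Ico (j * (B + B)) (j * (B + B) + B),
          c k * saw a b (ν k * x)) - X x ≤ D x := by
        rw [hX, ← Finset.sum_sub_distrib]
        refine Finset.sum_le_sum fun j _ => ?_
        rw [sawBlock, ← Finset.sum_sub_distrib]
        refine Finset.sum_le_sum fun k _ => ?_
        rw [← mul_sub]
        refine (le_abs_self _).trans ?_
        rw [abs_mul]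
        exact mul_le_of_le_one_left (abs_nonneg _) (hc k)
      linarith
  refine (measureReal_mono sub).trans ((measureReal_union_le _ _).trans (add_le_add ?_ ?_))
  · refine (measureReal_le_integral_div (C := Real.exp M) (mX.const_mul μ).exp
      (fun x => (Real.exp_pos _).le) (fun x => ?_) (Real.exp_pos _)).trans ?_
    · rw [hX]
      simp only
      rw [Finset.mul_sum]
      refine Real.exp_le_exp.mpr ?_
      calc _ ≤ ∑ j ∈ Finset.range M, (1 : ℝ) := Finset.sum_le_sum fun j _ =>
            le_of_abs_le (abs_mul_sawBlock_le ν a b hc t j habs x)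
        _ = M := by simp
    · rw [div_le_iff₀ (Real.exp_pos _), ← Real.exp_add]
      refine (integral_exp_sum_sawBlock_le hq h hab hb hc ht hB habs hM).trans ?_
      refine Real.exp_le_exp.mpr ?_
      linarith
  · refine (measureReal_le_integral_div (C := ∑ j ∈ Finset.range M,
      ∑ k ∈ Finset.Ico (j * (B + B)) (j * (B + B) + B), 2) mD
      (fun x => Finset.sum_nonneg fun j _ => Finset.sum_nonneg fun k _ => abs_nonneg _)
      (fun x => Finset.sum_le_sum fun j _ => Finset.sum_le_sum fun k _ => bD j k x)
      one_pos).trans ?_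
    rw [div_one, hD, intervalIntegral.integral_finsetSum]
    · calc _ ≤ ∑ j ∈ Finset.range M, ∑ k ∈ Finset.Ico (j * (B + B)) (j * (B + B) + B),
            (4 / 2 ^ t : ℝ) := by
            refine Finset.sum_le_sum fun j _ => ?_
            rw [intervalIntegral.integral_finsetSum fun k _ => iD j k]
            refine Finset.sum_le_sum fun k hk => ?_
            have hν : (1 : ℝ) ≤ ν k := by exact_mod_cast h.1 k
            refine (integral_abs_saw_sub_saw_dyadicFloor_le a b (by linarith) _ zero_le_one
              (by simpa using hν)).trans ?_
            have := mul_le_two_pow_blockLevel hq h t B j (Finset.mem_Ico.mp hk).2.le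
            rw [sub_zero, mul_one, mul_div_assoc', div_le_div_iff₀ (by positivity) (by positivity)]
            linarith
        _ = _ := by simp; ring
    · intro j _
      have := IntervalIntegrable.sum (μ := volume) (a := 0) (b := 1)
        (Finset.Ico (j * (B + B)) (j * (B + B) + B)) (f := fun k x =>
          |saw a b (ν k * x) - saw a b (ν k * dyadicFloor (blockLevel ν t B j) x)|)
        (fun k _ => iD j k)
      simpa only [Finset.sum_fn] using this

/-- Subgaussian tail bound for lacunary sums of centred indicators. -/
lemma measureReal_abs_sum_saw_ge_le {q : ℝ} {ν : ℕ → ℕ} (hq : 1 < q) (h : IsLacunary q ν)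
    {a b μ : ℝ} (hab : a ≤ b) (hb : b ≤ a + 1) {t B M L : ℕ}
    (hB0 : 1 ≤ B) (ht : 1 ≤ t) (hB : ((2 : ℝ) ^ t) ^ 2 ≤ q ^ B) (hμ0 : 0 < μ) (hμ : μ * B ≤ 1)
    (hM : (14 * M : ℝ) ≤ 2 ^ t) (hL : L ≤ M * (B + B)) (τ : ℝ) :
    (volume.restrict (Set.Icc (0 : ℝ) 1)).real
        {x | τ ≤ |∑ k ∈ Finset.range L, saw a b (ν k * x)|}
      ≤ 4 * (Real.exp (3 + 6 * q / (q - 1) * (b - a) * (μ ^ 2 * (M * B)) - μ * (τ / 2))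
        + 4 * (M * B) / 2 ^ t) := by
  set F : (ℕ → ℕ) → (ℕ → ℝ) → ℝ → ℝ := fun ν c x =>
    ∑ j ∈ Finset.range M, ∑ k ∈ Finset.Ico (j * (B + B)) (j * (B + B) + B),
      c k * saw a b (ν k * x) with hF
  set c : ℕ → ℝ := fun k => if k < L then 1 else 0 with hc
  have hc1 : ∀ k, |c k| ≤ 1 := fun k => by
    rw [hc]; simp only; split_ifs <;> simp
  have hc2 : ∀ k, |(-c) k| ≤ 1 := fun k => by rw [Pi.neg_apply, abs_neg]; exact hc1 k
  have e : ∀ x, ∑ k ∈ Finset.range L, saw a b (ν k * x)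
      = F ν c x + F (fun k => ν (B + k)) (fun k => c (B + k)) x := by
    intro x
    have h1 := sum_range_mul_two_blocks (fun k => c k * saw a b (ν k * x)) B M
    simp only [add_comm _ B] at h1
    rw [hF]
    simp only [add_comm _ B]
    rw [← h1, ← Finset.sum_subset (Finset.range_mono hL)]
    · refine Finset.sum_congr rfl fun k hk => ?_
      rw [hc]; simp [Finset.mem_range.mp hk]
    · intro k _ hk
      rw [hc]; simp [Finset.mem_range.not.mp hk]
  have hneg : ∀ ν c x, F ν (-c) x = -F ν c x := fun ν c x => by
    rw [hF]; simp [Finset.sum_neg_distrib]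
  have h' : IsLacunary q (fun k => ν (B + k)) := by
    refine ⟨fun k => h.1 _, fun k => h.2 _⟩
  have t1 := measureReal_sum_blocks_ge_le hq h hab hb hc1 hB0 ht hB hμ0 hμ hM (τ / 2)
  have t2 := measureReal_sum_blocks_ge_le hq h hab hb hc2 hB0 ht hB hμ0 hμ hM (τ / 2)
  have t3 := measureReal_sum_blocks_ge_le hq h' hab hb (fun k => hc1 (B + k)) hB0 ht hB hμ0 hμ hM
    (τ / 2)
  have t4 := measureReal_sum_blocks_ge_le hq h' hab hb (fun k => hc2 (B + k)) hB0 ht hB hμ0 hμ hM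
    (τ / 2)
  have sub : {x | τ ≤ |∑ k ∈ Finset.range L, saw a b (ν k * x)|}
      ⊆ ({x | τ / 2 ≤ F ν c x} ∪ {x | τ / 2 ≤ F ν (-c) x})
        ∪ ({x | τ / 2 ≤ F (fun k => ν (B + k)) (fun k => c (B + k)) x}
          ∪ {x | τ / 2 ≤ F (fun k => ν (B + k)) (fun k => (-c) (B + k)) x}) := by
    intro x hx
    rw [Set.mem_ofPred_eq, e] at hx
    have e4 : F (fun k => ν (B + k)) (fun k => (-c) (B + k)) x
        = -F (fun k => ν (B + k)) (fun k => c (B + k)) x := hneg _ _ x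
    simp only [Set.mem_union, Set.mem_ofPred_eq, e4, hneg]
    by_contra! hcon
    obtain ⟨⟨h1, h2⟩, h3, h4⟩ := hcon
    have : |F ν c x + F (fun k => ν (B + k)) (fun k => c (B + k)) x| < τ := by
      rw [abs_lt]; constructor <;> linarith
    linarith
  refine (measureReal_mono sub).trans ((measureReal_union_le _ _).trans ?_)
  refine (add_le_add (measureReal_union_le _ _) (measureReal_union_le _ _)).trans ?_
  refine (add_le_add (add_le_add t1 t2) (add_le_add t3 t4)).trans ?_
  linarith

/-- The chaining threshold at stage `i`, time scale `e` and space scale `e'`. -/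
noncomputable def chainThreshold (K s : ℝ) (i e e' : ℕ) : ℝ :=
  K * √(Real.log i) * s ^ (6 * i + e + e')

/-- The exceptional set of one chaining increment. -/
def chainEvent (ν : ℕ → ℕ) (K s : ℝ) (i e e' p c : ℕ) : Set ℝ :=
  {x | chainThreshold K s i e e' ≤ |∑ k ∈ Finset.range (2 ^ (i + e)),
    saw (c * 2 ^ e' / 2 ^ i) ((c + 1) * 2 ^ e' / 2 ^ i) (ν (k + p * 2 ^ (i + e)) * x)|}

/-- The exceptional set of stage `i`. -/
def stageEvent (ν : ℕ → ℕ) (K s : ℝ) (i : ℕ) : Set ℝ :=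
  ⋃ e ∈ Finset.range i, ⋃ e' ∈ Finset.range i, ⋃ p ∈ Finset.range (2 ^ (i - e)),
    ⋃ c ∈ Finset.range (2 ^ (i - e')), chainEvent ν K s i e e' p c

lemma exists_block_count {B L : ℕ} (hB : 1 ≤ B) (hBL : B ≤ L) :
    ∃ M : ℕ, L ≤ M * (B + B) ∧ M * B ≤ 2 * L ∧ M ≤ L + 1 := by
  refine ⟨L / (B + B) + 1, ?_, ?_, ?_⟩
  · have := Nat.lt_div_mul_add (a := L) (b := B + B) (by omega)
    rw [add_mul, one_mul]; omega
  · have := Nat.div_mul_le_self L (B + B)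
    rw [add_mul, one_mul]
    rw [mul_add] at this
    omega
  · exact Nat.add_le_add_right (Nat.div_le_self _ _) 1

set_option maxHeartbeats 800000 in
lemma measureReal_chainEvent_le {q : ℝ} {ν : ℕ → ℕ} (hq : 1 < q) (h : IsLacunary q ν) {s K : ℝ}
    (hs : 1 < s) (hs8 : s ^ 8 = 2) (hK1 : 2 * (6 * q / (q - 1)) + 4 ≤ K / 2)
    (hK2 : 1 ≤ K / 2 * (s - 1)) {β i : ℕ} (hβ1 : 1 ≤ β) (hβ : (2 : ℝ) ^ 20 ≤ q ^ β) (hi : 3 ≤ i)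
    (hβi : β * (i : ℝ) ^ 2 ≤ s ^ (4 * i)) {e e' : ℕ} (he : e < i) (he' : e' < i) (p c : ℕ) :
    (2 : ℝ) ^ (i - e) * 2 ^ (i - e') *
      (volume.restrict (Set.Icc (0 : ℝ) 1)).real (chainEvent ν K s i e e' p c)
      ≤ (4 * Real.exp 3 + 32) / (i : ℝ) ^ 4 := by
  set V := 6 * q / (q - 1) with hV
  have hV0 : 0 ≤ V := div_nonneg (by linarith) (by linarith)
  have hs0 : 0 < s := by linarith
  have hi1 : (3 : ℝ) ≤ i := by exact_mod_cast hi
  have hlog1 : 1 ≤ Real.log i := by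
    rw [Real.le_log_iff_exp_le (by linarith)]
    have := Real.exp_one_lt_d9
    linarith
  have hpow : ∀ n : ℕ, (2 : ℝ) ^ n = s ^ (8 * n) := fun n => by rw [pow_mul, hs8]
  have hsqrt : √(Real.log i) ^ 2 = Real.log i := Real.sq_sqrt (by linarith)
  have hsqrt0 : 0 < √(Real.log i) := Real.sqrt_pos.mpr (by linarith)
  have hsqrti : √(Real.log i) ≤ i := by
    have h1 := Real.log_le_self (show (0 : ℝ) ≤ i by linarith)
    rw [Real.sqrt_le_left (by linarith)]
    nlinarith
  have h4i : s ^ (4 * i) ≤ 2 ^ i := by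
    rw [hpow]; exact pow_le_pow_right₀ hs.le (by omega)
  have hβi' : β * i ≤ 2 ^ i := by
    have h1 : ((β * i : ℕ) : ℝ) ≤ ((2 ^ i : ℕ) : ℝ) := by
      push_cast
      refine le_trans ?_ (hβi.trans h4i)
      have : (0 : ℝ) ≤ β := β.cast_nonneg
      refine mul_le_mul_of_nonneg_left ?_ this
      nlinarith
    exact_mod_cast h1
  have hL : 2 ^ i ≤ 2 ^ (i + e) := Nat.pow_le_pow_right (by norm_num) (by omega)
  obtain ⟨M, hM1, hM2, hM3⟩ := exists_block_count (B := β * i) (L := 2 ^ (i + e))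
    (Nat.mul_pos hβ1 (by omega)) (hβi'.trans hL)
  have hM2' : (M * (β * i : ℕ) : ℝ) ≤ 2 * 2 ^ (i + e) := by exact_mod_cast hM2
  have hL2 : (2 : ℝ) ^ (i + e) ≤ 2 ^ (2 * i) :=
    pow_le_pow_right₀ (by norm_num) (by omega)
  have hM3' : (14 * M : ℝ) ≤ 2 ^ (10 * i) := by
    have h1 : (M : ℝ) ≤ 2 ^ (i + e) + 1 := by exact_mod_cast hM3
    have h2 : (2 : ℝ) ^ (10 * i) = 2 ^ (2 * i) * 2 ^ (8 * i) := by rw [← pow_add]; congr 1; ring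
    have h3 : (2 : ℝ) ^ 8 ≤ 2 ^ (8 * i) := pow_le_pow_right₀ (by norm_num) (by omega)
    have h4 : (1 : ℝ) ≤ 2 ^ (2 * i) := one_le_pow₀ (by norm_num)
    rw [h2]
    nlinarith
  obtain ⟨A, hA⟩ : ∃ A, A = 4 * i + 2 * (e + e') := ⟨_, rfl⟩
  obtain ⟨d, hd⟩ : ∃ d, d = (i - e) + (i - e') := ⟨_, rfl⟩
  have hAd : 6 * i + e + e' = A + d := by omega
  set μ := √(Real.log i) / s ^ A with hμ
  have hμ0 : 0 < μ := by positivity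
  have hμB : μ * (β * i : ℕ) ≤ 1 := by
    rw [hμ, div_mul_eq_mul_div, div_le_one (by positivity)]
    push_cast
    have hβ0 : (0 : ℝ) ≤ β := β.cast_nonneg
    calc √(Real.log i) * (β * i) ≤ i * (β * i) := by gcongr
      _ = β * (i : ℝ) ^ 2 := by ring
      _ ≤ _ := hβi
      _ ≤ s ^ A := pow_le_pow_right₀ hs.le (by omega)
  have hB : ((2 : ℝ) ^ (10 * i)) ^ 2 ≤ q ^ (β * i) := by
    rw [← pow_mul, show 10 * i * 2 = 20 * i by ring, pow_mul, pow_mul]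
    exact pow_le_pow_left₀ (by positivity) hβ i
  have hlen : ((c + 1) * 2 ^ e' / 2 ^ i - c * 2 ^ e' / 2 ^ i : ℝ) = 2 ^ e' / 2 ^ i := by ring
  have hlen0 : (0 : ℝ) ≤ 2 ^ e' / 2 ^ i := by positivity
  have hlen1 : (2 : ℝ) ^ e' / 2 ^ i ≤ 1 := by
    rw [div_le_one (by positivity)]
    exact pow_le_pow_right₀ (by norm_num) he'.le
  have main := measureReal_abs_sum_saw_ge_le (t := 10 * i) (M := M) (L := 2 ^ (i + e)) (μ := μ)
    hq (h.shift (p * 2 ^ (i + e)))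
    (a := c * 2 ^ e' / 2 ^ i) (b := (c + 1) * 2 ^ e' / 2 ^ i) (by linarith) (by linarith)
    (Nat.mul_pos hβ1 (by omega)) (by omega) hB hμ0 hμB hM3' hM1 (chainThreshold K s i e e')
  rw [hlen] at main
  have hev : chainEvent ν K s i e e' p c = {x | chainThreshold K s i e e' ≤
      |∑ k ∈ Finset.range (2 ^ (i + e)), saw (c * 2 ^ e' / 2 ^ i) ((c + 1) * 2 ^ e' / 2 ^ i)
        (ν (k + p * 2 ^ (i + e)) * x)|} := rfl
  have hexp : 3 + V * (2 ^ e' / 2 ^ i) * (μ ^ 2 * (M * (β * i : ℕ)))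
      - μ * (chainThreshold K s i e e' / 2) ≤ 3 - 4 * Real.log i - d := by
    have h1 : μ * (chainThreshold K s i e e' / 2) = K / 2 * Real.log i * s ^ d := by
      rw [hμ, chainThreshold, hAd, pow_add]
      nth_rewrite 3 [← hsqrt]
      field_simp
    have h2 : (2 : ℝ) ^ e' / 2 ^ i * (μ ^ 2 * (M * (β * i : ℕ))) ≤ 2 * Real.log i := by
      calc _ ≤ (2 : ℝ) ^ e' / 2 ^ i * (μ ^ 2 * (2 * 2 ^ (i + e))) := by gcongr
        _ = 2 * Real.log i * (2 ^ (e + e') / s ^ (2 * A)) := by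
            rw [hμ, div_pow, hsqrt, pow_add, pow_add, mul_comm 2 A, pow_mul]
            field_simp
        _ ≤ 2 * Real.log i * 1 := by
            refine mul_le_mul_of_nonneg_left ?_ (by linarith)
            rw [div_le_one (by positivity), hpow]
            exact pow_le_pow_right₀ hs.le (by omega)
        _ = _ := mul_one _
    have h3 : 1 + d * (s - 1) ≤ s ^ d := by
      have := one_add_mul_le_pow (show -2 ≤ s - 1 by linarith) d
      rwa [add_sub_cancel] at this
    have hK0 : 0 ≤ K / 2 := by linarith
    have hd0 : (0 : ℝ) ≤ d := d.cast_nonneg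
    have h4 : 2 * V + 4 + d ≤ K / 2 * s ^ d := by
      have := mul_le_mul_of_nonneg_left h3 hK0
      nlinarith [mul_le_mul_of_nonneg_left hK2 hd0]
    have h5 := mul_le_mul_of_nonneg_left h2 hV0
    have h6 := mul_le_mul_of_nonneg_left h4 (show 0 ≤ Real.log i by linarith)
    rw [h1]
    linarith [mul_le_mul_of_nonneg_right hlog1 hd0]
  have hexp2 : (2 : ℝ) ^ d * Real.exp (3 - 4 * Real.log i - d) ≤ Real.exp 3 / (i : ℝ) ^ 4 := by
    have h1 : (2 : ℝ) ^ d ≤ Real.exp d := by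
      rw [← Real.exp_one_pow]
      refine pow_le_pow_left₀ (by norm_num) ?_ d
      linarith [Real.add_one_le_exp 1]
    have h2 : Real.exp (3 - 4 * Real.log i - d) = Real.exp 3 / (i : ℝ) ^ 4 / Real.exp d := by
      rw [Real.exp_sub, Real.exp_sub]
      congr 2
      rw [mul_comm, Real.exp_mul, Real.exp_log (by linarith)]
      norm_cast
    rw [h2, mul_div_assoc', div_le_iff₀ (Real.exp_pos _), mul_comm]
    exact mul_le_mul_of_nonneg_left h1 (by positivity)
  have hdisc : (2 : ℝ) ^ d * (4 * (M * (β * i : ℕ)) / 2 ^ (10 * i)) ≤ 8 / (i : ℝ) ^ 4 := by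
    rw [mul_div_assoc', div_le_div_iff₀ (by positivity) (by positivity)]
    have h1 : (2 : ℝ) ^ d ≤ 2 ^ (2 * i) := pow_le_pow_right₀ (by norm_num) (by omega)
    have h2 : (i : ℝ) ^ 4 ≤ 2 ^ (4 * i) := by
      rw [mul_comm, pow_mul]
      exact pow_le_pow_left₀ (by linarith) (by exact_mod_cast Nat.lt_two_pow_self.le) 4
    calc _ ≤ (2 : ℝ) ^ (2 * i) * (4 * (2 * 2 ^ (2 * i))) * 2 ^ (4 * i) := by
          gcongr ?_ * (4 * ?_) * ?_
          exact hM2'.trans (mul_le_mul_of_nonneg_left hL2 zero_le_two)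
      _ = 8 * 2 ^ (8 * i) := by
          rw [show 8 * i = 2 * i + 2 * i + 4 * i by ring, pow_add, pow_add]; ring
      _ ≤ 8 * 2 ^ (10 * i) := by
          gcongr
          · norm_num
          · norm_num
  rw [← pow_add, ← hd, hev]
  calc _ ≤ (2 : ℝ) ^ d * (4 * (Real.exp (3 - 4 * Real.log i - d)
        + 4 * (M * (β * i : ℕ)) / 2 ^ (10 * i))) := by
        refine mul_le_mul_of_nonneg_left (main.trans ?_) (by positivity)
        gcongr
    _ = 4 * ((2 : ℝ) ^ d * Real.exp (3 - 4 * Real.log i - d)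
        + 2 ^ d * (4 * (M * (β * i : ℕ)) / 2 ^ (10 * i))) := by ring
    _ ≤ 4 * (Real.exp 3 / (i : ℝ) ^ 4 + 8 / (i : ℝ) ^ 4) := by gcongr
    _ = _ := by ring

lemma measureReal_stageEvent_le {q : ℝ} {ν : ℕ → ℕ} (hq : 1 < q) (h : IsLacunary q ν) {s K : ℝ}
    (hs : 1 < s) (hs8 : s ^ 8 = 2) (hK1 : 2 * (6 * q / (q - 1)) + 4 ≤ K / 2)
    (hK2 : 1 ≤ K / 2 * (s - 1)) {β i : ℕ} (hβ1 : 1 ≤ β) (hβ : (2 : ℝ) ^ 20 ≤ q ^ β) (hi : 3 ≤ i)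
    (hβi : β * (i : ℝ) ^ 2 ≤ s ^ (4 * i)) :
    (volume.restrict (Set.Icc (0 : ℝ) 1)).real (stageEvent ν K s i)
      ≤ (4 * Real.exp 3 + 32) * (1 / (i : ℝ) ^ 2) := by
  have hi0 : (0 : ℝ) < i := by exact_mod_cast (show 0 < i by omega)
  calc _ ≤ ∑ e ∈ Finset.range i, ∑ e' ∈ Finset.range i, ∑ p ∈ Finset.range (2 ^ (i - e)),
        ∑ c ∈ Finset.range (2 ^ (i - e')),
          (volume.restrict (Set.Icc (0 : ℝ) 1)).real (chainEvent ν K s i e e' p c) := by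
        refine (measureReal_biUnion_finset_le _ _).trans (Finset.sum_le_sum fun e _ => ?_)
        refine (measureReal_biUnion_finset_le _ _).trans (Finset.sum_le_sum fun e' _ => ?_)
        refine (measureReal_biUnion_finset_le _ _).trans (Finset.sum_le_sum fun p _ => ?_)
        exact measureReal_biUnion_finset_le _ _
    _ ≤ ∑ e ∈ Finset.range i, ∑ e' ∈ Finset.range i, (4 * Real.exp 3 + 32) / (i : ℝ) ^ 4 := by
        refine Finset.sum_le_sum fun e he => Finset.sum_le_sum fun e' he' => ?_
        rw [Finset.mem_range] at he he'
        calc _ ≤ ∑ p ∈ Finset.range (2 ^ (i - e)), ∑ c ∈ Finset.range (2 ^ (i - e')),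
              (4 * Real.exp 3 + 32) / (i : ℝ) ^ 4 / (2 ^ (i - e) * 2 ^ (i - e')) := by
              refine Finset.sum_le_sum fun p _ => Finset.sum_le_sum fun c _ => ?_
              rw [le_div_iff₀' (by positivity)]
              exact measureReal_chainEvent_le hq h hs hs8 hK1 hK2 hβ1 hβ hi hβi he he' p c
          _ = _ := by
              simp only [Finset.sum_const, Finset.card_range, nsmul_eq_mul]
              push_cast
              field_simp
    _ = _ := by
        simp only [Finset.sum_const, Finset.card_range, nsmul_eq_mul]
        field_simp

lemma ae_eventually_notMem_stageEvent {q : ℝ} {ν : ℕ → ℕ} (hq : 1 < q) (h : IsLacunary q ν)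
    {s K : ℝ} (hs : 1 < s) (hs8 : s ^ 8 = 2) (hK1 : 2 * (6 * q / (q - 1)) + 4 ≤ K / 2)
    (hK2 : 1 ≤ K / 2 * (s - 1)) :
    ∀ᵐ x ∂(volume.restrict (Set.Icc (0 : ℝ) 1)), ∀ᶠ i in atTop, x ∉ stageEvent ν K s i := by
  obtain ⟨β, hβ⟩ := pow_unbounded_of_one_lt ((2 : ℝ) ^ 20) hq
  have hβ1 : 1 ≤ β := by
    by_contra! h0
    rw [Nat.lt_one_iff.mp h0] at hβ
    norm_num at hβ
  have hgrow : ∀ᶠ i : ℕ in atTop, β * (i : ℝ) ^ 2 ≤ s ^ (4 * i) := by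
    have h1 := tendsto_pow_const_div_const_pow_of_one_lt 2 (one_lt_pow₀ hs (n := 4) (by norm_num))
    have hβ0 : (0 : ℝ) < β := by exact_mod_cast hβ1
    filter_upwards [h1.eventually_lt_const (inv_pos.mpr hβ0)] with i hi
    rw [div_lt_iff₀ (by positivity), ← div_eq_inv_mul, lt_div_iff₀ hβ0, ← pow_mul] at hi
    linarith
  have hsum : Summable fun i => (volume.restrict (Set.Icc (0 : ℝ) 1)).real (stageEvent ν K s i) := by
    refine Summable.of_norm_bounded_eventually_nat
      (((Real.summable_one_div_nat_pow (p := 2)).mpr one_lt_two).mul_left (4 * Real.exp 3 + 32)) ?_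
    filter_upwards [hgrow, eventually_ge_atTop 3] with i hi hi3
    rw [Real.norm_eq_abs, abs_of_nonneg measureReal_nonneg]
    exact measureReal_stageEvent_le hq h hs hs8 hK1 hK2 hβ1 hβ.le hi3 hi
  refine ae_eventually_notMem ?_
  have := hsum.tsum_ofReal_ne_top
  simpa only [ofReal_measureReal (measure_ne_top _ _)] using this

lemma abs_sub_le_sum_of_dyadic_increments (E : ℕ) : ∀ {f σ : ℕ → ℝ},
    (∀ e < E, ∀ c < 2 ^ (E - e), |f ((c + 1) * 2 ^ e) - f (c * 2 ^ e)| ≤ σ e) →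
    ∀ n < 2 ^ E, |f n - f 0| ≤ ∑ e ∈ Finset.range E, σ e := by
  induction E with
  | zero =>
    intro f σ _ n hn
    rw [Nat.lt_one_iff.mp hn]
    simp
  | succ E ih =>
    intro f σ h n hn
    have h0 : ∀ c < 2 ^ (E + 1), |f (c + 1) - f c| ≤ σ 0 := fun c hc => by
      simpa using h 0 (Nat.succ_pos E) c hc
    have hrec := ih (f := fun m => f (m * 2)) (σ := fun e => σ (e + 1)) (fun e he c hc => by
      have := h (e + 1) (by omega) c (by rwa [Nat.add_sub_add_right])
      simpa only [pow_succ, mul_assoc] using this) (n / 2) (by rw [pow_succ] at hn; omega)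
    have hlast : |f n - f (n / 2 * 2)| ≤ σ 0 := by
      rcases Nat.mod_two_eq_zero_or_one n with hm | hm
      · rw [show n / 2 * 2 = n by omega, sub_self, abs_zero]
        exact (abs_nonneg _).trans (h0 0 (by positivity))
      · have := h0 (n / 2 * 2) (by omega)
        rwa [show n / 2 * 2 + 1 = n by omega] at this
    rw [Finset.sum_range_succ']
    simp only [zero_mul] at hrec
    calc |f n - f 0| = |(f (n / 2 * 2) - f 0) + (f n - f (n / 2 * 2))| := by ring_nf
      _ ≤ _ := (abs_add_le _ _).trans (add_le_add hrec hlast)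

lemma saw_eq_sub (a b y : ℝ) : saw a b y = saw 0 b y - saw 0 a y := by
  rw [saw, saw, saw]; ring

lemma saw_zero_zero (y : ℝ) : saw 0 0 y = 0 := by rw [saw, sub_self]

lemma saw_zero_one (y : ℝ) : saw 0 1 y = 0 := by
  rw [saw, sub_zero, Int.fract_sub_one, sub_self]

lemma saw_zero_add_mono {a b : ℝ} (hab : a ≤ b) (y : ℝ) : saw 0 a y + a ≤ saw 0 b y + b := by
  rw [saw_eq_floor, saw_eq_floor]
  have : (⌊y - b⌋ : ℝ) ≤ ⌊y - a⌋ := by exact_mod_cast Int.floor_le_floor (by linarith)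
  linarith

lemma indicator_sub_eq_saw {a : ℝ} (ha : a ∈ Set.Icc (0 : ℝ) 1) (y : ℝ) :
    (Set.Ico (0 : ℝ) a).indicator (fun _ => (1 : ℝ)) (Int.fract y) - a = saw 0 a y := by
  have h1 : y = ⌊y⌋ + Int.fract y := (Int.floor_add_fract y).symm
  have h2 := Int.fract_nonneg y
  have h3 := Int.fract_lt_one y
  by_cases h : Int.fract y < a
  · rw [Set.indicator_of_mem (by exact ⟨h2, h⟩),
      saw_of_lt (z := ⌊y⌋) (by linarith [ha.2]) (by linarith) (by linarith), sub_zero]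
  · rw [Set.indicator_of_notMem (fun hm => h hm.2),
      saw_of_ge (z := ⌊y⌋) ha.1 (by linarith) (by linarith), sub_zero, zero_sub]

lemma notMem_stageEvent {ν : ℕ → ℕ} {K s x : ℝ} {i : ℕ} (hx : x ∉ stageEvent ν K s i)
    {e e' p c : ℕ} (he : e < i) (he' : e' < i) (hp : p < 2 ^ (i - e)) (hc : c < 2 ^ (i - e')) :
    |∑ k ∈ Finset.range (2 ^ (i + e)), saw (c * 2 ^ e' / 2 ^ i) ((c + 1) * 2 ^ e' / 2 ^ i)
      (ν (k + p * 2 ^ (i + e)) * x)| ≤ chainThreshold K s i e e' := by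
  by_contra! hlt
  refine hx ?_
  simp only [stageEvent, Set.mem_iUnion, Finset.mem_range]
  exact ⟨e, he, e', he', p, hp, c, hc, hlt.le⟩

lemma sum_chainThreshold_le {K s : ℝ} (hs : 1 < s) (hs8 : s ^ 8 = 2) (hK : 0 ≤ K) (i : ℕ) :
    ∑ e ∈ Finset.range i, ∑ e' ∈ Finset.range i, chainThreshold K s i e e'
      ≤ K / (s - 1) ^ 2 * √(Real.log i) * 2 ^ i := by
  have hs1 : 0 < s - 1 := by linarith
  have hg : ∑ e ∈ Finset.range i, s ^ e ≤ s ^ i / (s - 1) := by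
    rw [geom_sum_eq hs.ne']
    gcongr
    linarith
  have hg0 : 0 ≤ ∑ e ∈ Finset.range i, s ^ e := Finset.sum_nonneg fun e _ => by positivity
  calc _ = K * √(Real.log i) * s ^ (6 * i)
        * ((∑ e ∈ Finset.range i, s ^ e) * ∑ e' ∈ Finset.range i, s ^ e') := by
        rw [Finset.sum_mul_sum, Finset.mul_sum]
        refine Finset.sum_congr rfl fun e _ => ?_
        rw [Finset.mul_sum]
        refine Finset.sum_congr rfl fun e' _ => ?_
        rw [chainThreshold, pow_add, pow_add]; ring
    _ ≤ K * √(Real.log i) * s ^ (6 * i) * ((s ^ i / (s - 1)) * (s ^ i / (s - 1))) := by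
        gcongr
    _ = K / (s - 1) ^ 2 * √(Real.log i) * (s ^ 8) ^ i := by
        rw [← pow_mul, show 8 * i = 6 * i + i + i by ring, pow_add, pow_add]
        field_simp
    _ = _ := by rw [hs8]

lemma abs_sum_saw_grid_le {ν : ℕ → ℕ} {K s x : ℝ} {i : ℕ} (hx : x ∉ stageEvent ν K s i)
    {n c : ℕ} (hn : n < 2 ^ i) (hc : c < 2 ^ i) :
    |∑ k ∈ Finset.range (n * 2 ^ i), saw 0 (c / 2 ^ i) (ν k * x)|
      ≤ ∑ e ∈ Finset.range i, ∑ e' ∈ Finset.range i, chainThreshold K s i e e' := by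
  have space : ∀ e < i, ∀ p < 2 ^ (i - e),
      |∑ k ∈ Finset.range (2 ^ (i + e)), saw 0 (c / 2 ^ i) (ν (k + p * 2 ^ (i + e)) * x)|
        ≤ ∑ e' ∈ Finset.range i, chainThreshold K s i e e' := by
    intro e he p hp
    have := abs_sub_le_sum_of_dyadic_increments i (f := fun c => ∑ k ∈ Finset.range (2 ^ (i + e)),
      saw 0 (c / 2 ^ i) (ν (k + p * 2 ^ (i + e)) * x)) (σ := fun e' => chainThreshold K s i e e')
      (fun e' he' c hc => by
        have := notMem_stageEvent hx he he' hp hc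
        simp only [saw_eq_sub (c * 2 ^ e' / 2 ^ i)] at this
        rw [← Finset.sum_sub_distrib]
        push_cast
        exact this) c hc
    simpa [saw_zero_zero] using this
  have time := abs_sub_le_sum_of_dyadic_increments i
    (f := fun n => ∑ k ∈ Finset.range (n * 2 ^ i), saw 0 (c / 2 ^ i) (ν k * x))
    (σ := fun e => ∑ e' ∈ Finset.range i, chainThreshold K s i e e')
    (fun e he p hp => by
      have := space e he p hp
      have e1 : (p + 1) * 2 ^ e * 2 ^ i = p * 2 ^ e * 2 ^ i + 2 ^ (i + e) := by ring
      have e2 : p * 2 ^ (i + e) = p * 2 ^ e * 2 ^ i := by ring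
      rw [e1, Finset.sum_range_add, add_sub_cancel_left, ← e2]
      simpa only [add_comm (p * 2 ^ (i + e))] using this) n hn
  simpa using time

lemma abs_sum_saw_le {ν : ℕ → ℕ} {K s x : ℝ} (hs : 1 < s) (hs8 : s ^ 8 = 2) (hK : 0 ≤ K) {i : ℕ}
    (hi : 3 ≤ i) (hx : x ∉ stageEvent ν K s i) {N : ℕ} (hN : N < 4 ^ i) {a : ℝ}
    (ha : a ∈ Set.Icc (0 : ℝ) 1) :
    |∑ k ∈ Finset.range N, saw 0 a (ν k * x)|
      ≤ (K / (s - 1) ^ 2 + 2) * √(Real.log i) * 2 ^ i := by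
  have h4 : 4 ^ i = 2 ^ i * 2 ^ i := by rw [← mul_pow]; norm_num
  have hn : N / 2 ^ i < 2 ^ i := by
    rw [Nat.div_lt_iff_lt_mul (by positivity)]; omega
  set W := K / (s - 1) ^ 2 * √(Real.log i) * 2 ^ i with hW
  have hW0 : 0 ≤ W := by positivity
  have grid : ∀ c : ℕ, c ≤ 2 ^ i →
      |∑ k ∈ Finset.range N, saw 0 (c / 2 ^ i) (ν k * x)| ≤ W + 2 ^ i := by
    intro c hc
    rcases hc.lt_or_eq with hc | rfl
    · rw [← Nat.div_add_mod' N (2 ^ i), Finset.sum_range_add]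
      refine (abs_add_le _ _).trans (add_le_add ?_ ?_)
      · exact (abs_sum_saw_grid_le hx hn hc).trans (sum_chainThreshold_le hs hs8 hK i)
      · refine (Finset.abs_sum_le_sum_abs _ _).trans ?_
        calc _ ≤ ∑ k ∈ Finset.range (N % 2 ^ i), (1 : ℝ) :=
              Finset.sum_le_sum fun k _ => abs_saw_le _ _ _
          _ = ((N % 2 ^ i : ℕ) : ℝ) := by simp
          _ ≤ ((2 ^ i : ℕ) : ℝ) := Nat.cast_le.mpr (Nat.mod_lt _ (by positivity)).le
          _ = 2 ^ i := by push_cast; rfl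
    · have : (((2 ^ i : ℕ) : ℝ) / 2 ^ i) = 1 := by push_cast; exact div_self (by positivity)
      rw [this]
      simp only [saw_zero_one, Finset.sum_const_zero, abs_zero]
      positivity
  have mono : ∀ {u v : ℝ}, u ≤ v → ∑ k ∈ Finset.range N, saw 0 u (ν k * x) + N * u
      ≤ ∑ k ∈ Finset.range N, saw 0 v (ν k * x) + N * v := by
    intro u v huv
    have := Finset.sum_le_sum fun k (_ : k ∈ Finset.range N) => saw_zero_add_mono huv (ν k * x)
    simpa [Finset.sum_add_distrib] using this
  have hNi : (N : ℝ) / 2 ^ i ≤ 2 ^ i := by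
    rw [div_le_iff₀ (by positivity)]
    exact_mod_cast (hN.trans_eq h4).le
  have key : |∑ k ∈ Finset.range N, saw 0 a (ν k * x)| ≤ W + 2 ^ i + 2 ^ i := by
    have hle : ⌊a * 2 ^ i⌋₊ ≤ 2 ^ i := by
      refine Nat.floor_le_of_le ?_
      push_cast
      exact mul_le_of_le_one_left (by positivity) ha.2
    have h1 : (⌊a * 2 ^ i⌋₊ : ℝ) ≤ a * 2 ^ i := Nat.floor_le (mul_nonneg ha.1 (by positivity))
    have h2 := Nat.lt_floor_add_one (a * 2 ^ i)
    set c := ⌊a * 2 ^ i⌋₊ with hc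
    have hlow : (c : ℝ) / 2 ^ i ≤ a := by rwa [div_le_iff₀ (by positivity)]
    have hgap : a < c / 2 ^ i + 1 / 2 ^ i := by rwa [← add_div, lt_div_iff₀ (by positivity)]
    have hN0 : (0 : ℝ) ≤ N := N.cast_nonneg
    have hlower : -(W + 2 ^ i + 2 ^ i) ≤ ∑ k ∈ Finset.range N, saw 0 a (ν k * x) := by
      have h3 := mono hlow
      have h4 := neg_le_of_abs_le (grid c hle)
      have h5 : N * (a - c / 2 ^ i) ≤ N / 2 ^ i := by
        rw [div_eq_mul_one_div (N : ℝ)]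
        exact mul_le_mul_of_nonneg_left (by linarith) hN0
      linarith
    rw [abs_le]
    refine ⟨hlower, ?_⟩
    rcases hle.lt_or_eq with hlt | heq
    · have hup : a ≤ ((c + 1 : ℕ) : ℝ) / 2 ^ i := by
        push_cast; rw [add_div]; exact hgap.le
      have h3 := mono hup
      have h4 := le_of_abs_le (grid (c + 1) hlt)
      have h5 : N * (((c + 1 : ℕ) : ℝ) / 2 ^ i - a) ≤ N / 2 ^ i := by
        rw [div_eq_mul_one_div (N : ℝ)]
        refine mul_le_mul_of_nonneg_left ?_ hN0
        push_cast; rw [add_div]; linarith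
      linarith
    · have ha1 : a = c / 2 ^ i := by
        refine le_antisymm ?_ hlow
        rw [heq]; push_cast; rw [div_self (by positivity)]; exact ha.2
      rw [ha1]
      have h3 := le_of_abs_le (grid c hle)
      have : (0 : ℝ) ≤ 2 ^ i := by positivity
      linarith
  have hsq : 1 ≤ √(Real.log i) := by
    rw [Real.one_le_sqrt]
    have hi1 : (3 : ℝ) ≤ i := by exact_mod_cast hi
    rw [Real.le_log_iff_exp_le (by linarith)]
    have := Real.exp_one_lt_d9
    linarith
  have h2i : (0 : ℝ) ≤ 2 ^ i := by positivity
  have : (2 : ℝ) ^ i ≤ √(Real.log i) * 2 ^ i := le_mul_of_one_le_left h2i hsq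
  calc _ ≤ _ := key
    _ ≤ W + 2 * (√(Real.log i) * 2 ^ i) := by linarith
    _ = _ := by rw [hW]; ring

/-- Bounded law of the iterated logarithm, uniformly over all intervals `[0, a)`. -/
lemma ae_eventually_abs_sum_saw_le {q : ℝ} {ν : ℕ → ℕ} (hq : 1 < q) (h : IsLacunary q ν)
    {s K : ℝ} (hs : 1 < s) (hs8 : s ^ 8 = 2) (hK1 : 2 * (6 * q / (q - 1)) + 4 ≤ K / 2)
    (hK2 : 1 ≤ K / 2 * (s - 1)) :
    ∀ᵐ x ∂(volume.restrict (Set.Icc (0 : ℝ) 1)), ∀ᶠ N : ℕ in atTop,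
      ∀ a ∈ Set.Icc (0 : ℝ) 1, |∑ k ∈ Finset.range N, saw 0 a (ν k * x)|
        ≤ 2 * (K / (s - 1) ^ 2 + 2) * √(N * Real.log (Real.log N)) := by
  have hK : 0 ≤ K := by
    have : 0 ≤ 6 * q / (q - 1) := div_nonneg (by linarith) (by linarith)
    linarith
  filter_upwards [ae_eventually_notMem_stageEvent hq h hs hs8 hK1 hK2] with x hx
  obtain ⟨i₀, hi₀⟩ := eventually_atTop.mp hx
  filter_upwards [eventually_ge_atTop (4 ^ (max i₀ 4))] with N hN a ha
  have hN0 : N ≠ 0 := by have : 0 < 4 ^ (max i₀ 4) := by positivity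
                         omega
  set m := Nat.log 4 N with hm
  have hm1 : max i₀ 4 ≤ m := Nat.le_log_of_pow_le (by norm_num) hN
  have hm4 : 4 ≤ m := (le_max_right _ _).trans hm1
  have hlow : 4 ^ m ≤ N := Nat.pow_log_le_self 4 hN0
  have hup : N < 4 ^ (m + 1) := Nat.lt_pow_succ_log_self (by norm_num) N
  refine (abs_sum_saw_le hs hs8 hK (by omega)
    (hi₀ (m + 1) (by have := le_max_left i₀ 4; omega)) hup ha).trans ?_
  have hlowR : (4 : ℝ) ^ m ≤ N := by exact_mod_cast hlow
  have hm4R : (4 : ℝ) ≤ m := by exact_mod_cast hm4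
  have hlogN : ((m + 1 : ℕ) : ℝ) ≤ Real.log N := by
    have h1 := Real.log_le_log (by positivity) hlowR
    rw [Real.log_pow, show (4 : ℝ) = 2 ^ 2 by norm_num, Real.log_pow] at h1
    have := Real.log_two_gt_d9
    push_cast at h1 ⊢
    nlinarith
  have hloglog : Real.log ((m + 1 : ℕ) : ℝ) ≤ Real.log (Real.log N) :=
    Real.log_le_log (by positivity) hlogN
  have h2 : (2 : ℝ) ^ (m + 1) ≤ 2 * √N := by
    rw [pow_succ, mul_comm]
    refine mul_le_mul_of_nonneg_left ?_ zero_le_two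
    refine Real.le_sqrt_of_sq_le ?_
    rw [← pow_mul, mul_comm, pow_mul]
    norm_num
    exact hlowR
  rw [Real.sqrt_mul (Nat.cast_nonneg N)]
  calc _ ≤ (K / (s - 1) ^ 2 + 2) * √(Real.log (Real.log N)) * (2 * √N) := by gcongr
    _ = _ := by ring

lemma starDiscrepancy_le_div {N : ℕ} {x : ℕ → ℝ} {B : ℝ} (hN : 0 < N)
    (hB : ∀ a ∈ Set.Icc (0 : ℝ) 1, |∑ k ∈ Finset.range N, saw 0 a (x (k + 1))| ≤ B) :
    N * starDiscrepancy N (fun k => Int.fract (x k)) ≤ B := by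
  have hN' : (0 : ℝ) < N := by exact_mod_cast hN
  rw [mul_comm, ← le_div_iff₀ hN']
  have : Nonempty (Set.Icc (0 : ℝ) 1) := ⟨⟨0, by simp⟩⟩
  refine ciSup_le fun a => ?_
  rw [le_div_iff₀ hN', ← abs_of_pos hN', ← abs_mul, abs_of_pos hN', sub_mul,
    div_mul_cancel₀ _ hN'.ne']
  have hB' := hB a a.2
  rw [Finset.sum_congr rfl fun k _ => (indicator_sub_eq_saw a.2 (x (k + 1))).symm,
    Finset.sum_sub_distrib, Finset.sum_const, Finset.card_range, nsmul_eq_mul, mul_comm (N : ℝ),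
    Finset.range_eq_Ico, Finset.sum_Ico_add' (fun k => (Set.Ico (0 : ℝ) a).indicator
      (fun _ => (1 : ℝ)) (Int.fract (x k))) 0 N 1, zero_add] at hB'
  exact hB'

lemma cos_two_pi_mul_fract (y : ℝ) : Real.cos (2 * π * Int.fract y) = Real.cos (2 * π * y) := by
  rw [← Real.cos_sub_int_mul_two_pi (2 * π * y) ⌊y⌋]
  congr 1
  rw [← Int.self_sub_floor]
  ring

lemma isLacunary_succ {q : ℝ} {n : ℕ → ℕ} (hn : ∀ k, 1 ≤ k → 0 < n k)
    (h : ∀ k, 1 ≤ k → q ≤ (n (k + 1) : ℝ) / (n k : ℝ)) :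
    IsLacunary q (fun k => n (k + 1)) :=
  ⟨fun k => hn _ (by omega), fun k => by
    have h0 : (0 : ℝ) < n (k + 1) := by exact_mod_cast hn (k + 1) (by omega)
    exact (le_div_iff₀ h0).1 (h (k + 1) (by omega))⟩

lemma exists_ae_eventually_starDiscrepancy_le {q : ℝ} (hq : 1 < q) :
    ∃ C : ℝ, 0 ≤ C ∧ ∀ n : ℕ → ℕ, IsLacunary q (fun k => n (k + 1)) →
      ∀ᵐ x ∂(volume.restrict (Set.Icc (0 : ℝ) 1)), ∀ᶠ N : ℕ in atTop,
        N * starDiscrepancy N (fun k => Int.fract (n k * x))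
          ≤ C * √(N * Real.log (Real.log N)) := by
  set s : ℝ := 2 ^ (1 / 8 : ℝ) with hs_def
  have hs : 1 < s := Real.one_lt_rpow (by norm_num) (by norm_num)
  have hs8 : s ^ 8 = 2 := by
    rw [hs_def, ← Real.rpow_natCast, ← Real.rpow_mul (by norm_num)]
    norm_num
  have hs1 : 0 < s - 1 := by linarith
  have hq1 : 0 < q - 1 := by linarith
  set K : ℝ := 2 * (2 * (6 * q / (q - 1)) + 4 + 1 / (s - 1)) with hK
  have hK1 : 2 * (6 * q / (q - 1)) + 4 ≤ K / 2 := by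
    have : 0 < 1 / (s - 1) := by positivity
    rw [hK]; linarith
  have hK2 : 1 ≤ K / 2 * (s - 1) := by
    have h1 : 1 / (s - 1) ≤ K / 2 := by
      have : 0 ≤ 6 * q / (q - 1) := by positivity
      rw [hK]; linarith
    rwa [div_le_iff₀ hs1] at h1
  have hK0 : 0 ≤ K := by positivity
  refine ⟨2 * (K / (s - 1) ^ 2 + 2), by positivity, fun n h => ?_⟩
  filter_upwards [ae_eventually_abs_sum_saw_le hq h hs hs8 hK1 hK2] with x hx
  filter_upwards [hx, eventually_gt_atTop 0] with N hN hpos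
  exact starDiscrepancy_le_div (x := fun k => n k * x) hpos hN

lemma ae_frequently_le_starDiscrepancy {q : ℝ} (hq : 1 < q) {n : ℕ → ℕ}
    (h : IsLacunary q (fun k => n (k + 1))) :
    ∀ᵐ x ∂(volume.restrict (Set.Icc (0 : ℝ) 1)), ∀ η : ℝ, 0 < η → ∃ᶠ N : ℕ in atTop,
      (1 - η) * √(N * Real.log (Real.log N))
        ≤ 4 * (N * starDiscrepancy N (fun k => Int.fract (n k * x))) := by
  filter_upwards [ae_frequently_cos_sum_ge hq h] with x hx η hη
  refine (hx η hη).mono fun N hN => hN.trans ?_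
  refine le_trans (le_of_eq ?_) (sum_cos_le_mul_starDiscrepancy N
    (x := fun k => Int.fract (n k * x)) fun k => ⟨Int.fract_nonneg _, Int.fract_lt_one _⟩)
  simp_rw [cos_two_pi_mul_fract]
  rw [Finset.range_eq_Ico, Finset.sum_Ico_add' (fun k => cosFn (n k) x) 0 N 1]
  refine Finset.sum_congr rfl fun k _ => ?_
  rw [cosFn, mul_assoc]

/-- (Philipp's law of the iterated logarithm for discrepancies; Erdős–Gál conjecture)
For every `q > 1` there is a constant `C_q` such that for every sequence `(n_k)_{k ≥ 1}` of
positive integers satisfying `n_{k+1}/n_k ≥ q`, for almost every `x ∈ [0,1]`,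
`1/(4√2) ≤ limsup_{N → ∞} N D_N^*(⟨n_1 x⟩, …, ⟨n_N x⟩) / √(2 N log log N) ≤ C_q`. -/
theorem philipp_lil_discrepancy (q : ℝ) (hq : 1 < q) :
    ∃ C : ℝ, ∀ n : ℕ → ℕ, (∀ k, 1 ≤ k → 0 < n k) →
      (∀ k, 1 ≤ k → q ≤ (n (k + 1) : ℝ) / (n k : ℝ)) →
      ∀ᵐ x ∂(volume.restrict (Set.Icc (0 : ℝ) 1)),
        1 / (4 * Real.sqrt 2)
            ≤ Filter.limsup
                (fun N : ℕ =>
                  (N : ℝ) * starDiscrepancy N (fun k => Int.fract ((n k : ℝ) * x))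
                    / Real.sqrt (2 * N * Real.log (Real.log N)))
                atTop
          ∧ Filter.limsup
              (fun N : ℕ =>
                (N : ℝ) * starDiscrepancy N (fun k => Int.fract ((n k : ℝ) * x))
                  / Real.sqrt (2 * N * Real.log (Real.log N)))
              atTop ≤ C := by
  obtain ⟨C, hC0, hC⟩ := exists_ae_eventually_starDiscrepancy_le hq
  refine ⟨C, fun n hn hgap => ?_⟩
  have hlac := isLacunary_succ hn hgap
  filter_upwards [hC n hlac, ae_frequently_le_starDiscrepancy hq hlac] with x hup hlow
  set f : ℕ → ℝ := fun N => (N : ℝ) * starDiscrepancy N (fun k => Int.fract ((n k : ℝ) * x))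
    / Real.sqrt (2 * N * Real.log (Real.log N)) with hf
  have hsqrt (N : ℕ) : √(2 * N * Real.log (Real.log N))
      = √2 * √(N * Real.log (Real.log N)) := by
    rw [mul_assoc, Real.sqrt_mul zero_le_two]
  have hpos : ∀ᶠ N : ℕ in atTop, 0 < √(N * Real.log (Real.log N)) := by
    have h1 : Tendsto (fun N : ℕ => Real.log (Real.log N)) atTop atTop :=
      Real.tendsto_log_atTop.comp (Real.tendsto_log_atTop.comp tendsto_natCast_atTop_atTop)
    filter_upwards [h1.eventually_gt_atTop 0, eventually_gt_atTop 0] with N hN hN0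
    have : (0 : ℝ) < N := by exact_mod_cast hN0
    positivity
  have h2 : 0 < √(2 : ℝ) := by positivity
  have hle : ∀ᶠ N in atTop, f N ≤ C := by
    filter_upwards [hup, hpos] with N hN hN0
    rw [hf]
    simp only [hsqrt]
    rw [div_le_iff₀ (by positivity)]
    refine hN.trans (mul_le_mul_of_nonneg_left ?_ hC0)
    exact le_mul_of_one_le_left hN0.le (Real.one_le_sqrt.2 one_le_two)
  have hnonneg : ∀ N, 0 ≤ f N := fun N =>
    div_nonneg (mul_nonneg N.cast_nonneg (starDiscrepancy_nonneg _ _)) (Real.sqrt_nonneg _)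
  refine ⟨?_, limsup_le_of_le (isCoboundedUnder_le_of_le atTop hnonneg) hle⟩
  refine le_of_forall_pos_le_add fun η hη => ?_
  rw [← sub_le_iff_le_add]
  refine le_limsup_of_frequently_le ?_ ⟨C, by simpa using hle⟩
  refine ((hlow η hη).and_eventually hpos).mono fun N ⟨hN, hN0⟩ => ?_
  rw [hf]
  simp only [hsqrt]
  have h4 : 1 ≤ √(2 : ℝ) := Real.one_le_sqrt.2 one_le_two
  calc 1 / (4 * √2) - η ≤ (1 - η) / (4 * √2) := by
        rw [sub_div 1 η]
        have : η / (4 * √2) ≤ η := div_le_self hη.le (by linarith)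
        linarith
    _ ≤ _ := by
        rw [div_le_div_iff₀ (by positivity) (by positivity)]
        nlinarith
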